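/- Let d ≥ 1 be an integer, s ∈ (0,d), and let h be a measure function such that h(r)/r^d is nonincreasing. There is a constant C depending only on d and s, and a compact set E ⊂ ℝ^d, such that M_h(E) > 0 and γ_{s,+}(E) ≤ C · M_h(E) · [∫_0^{t_2} (h(t)/t^s)² dt/t]^{−1/2}, where t_2 is defined by h(t_2) = M_h(E) (if the integral diverges, the conclusion is γ_{s,+}(E) = 0). -/

import Mathlib

open MeasureTheory Filter Metric Set
open scoped ENNReal NNReal Topology

noncomputable section

/-- The `s`-Riesz kernel `K^s(x) = x / |x|^{s+1}` in `ℝᵈ`. -/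
def rieszKernel (d : ℕ) (s : ℝ) (x : EuclideanSpace ℝ (Fin d)) : EuclideanSpace ℝ (Fin d) :=
  ‖x‖ ^ (-(s + 1)) • x

/-- The `ε`-truncated `s`-Riesz transform of the measure `ν`. -/
def truncRiesz (d : ℕ) (s : ℝ) (ν : Measure (EuclideanSpace ℝ (Fin d))) (ε : ℝ)
    (x : EuclideanSpace ℝ (Fin d)) : EuclideanSpace ℝ (Fin d) :=
  ∫ y in {y | ε < dist y x}, rieszKernel d s (y - x) ∂ν

/-- Existence of the principal value `s`-Riesz transform of `ν` at `x`. -/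
def rieszExists (d : ℕ) (s : ℝ) (ν : Measure (EuclideanSpace ℝ (Fin d)))
    (x : EuclideanSpace ℝ (Fin d)) : Prop :=
  ∃ L, Tendsto (fun ε => truncRiesz d s ν ε x) (𝓝[>] (0 : ℝ)) (𝓝 L)

/-- The principal value `s`-Riesz transform of `ν` at `x` (junk value if the limit
does not exist). -/
def rieszTransform (d : ℕ) (s : ℝ) (ν : Measure (EuclideanSpace ℝ (Fin d)))
    (x : EuclideanSpace ℝ (Fin d)) : EuclideanSpace ℝ (Fin d) :=
  limUnder (𝓝[>] (0 : ℝ)) (fun ε => truncRiesz d s ν ε x)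

/-- The capacity `γ_{s,+}(E)`: the supremum of total masses of positive measures
supported on `E` whose `s`-Riesz transform exists a.e. and is bounded by `1`. -/
def gammaPlus (d : ℕ) (s : ℝ) (E : Set (EuclideanSpace ℝ (Fin d))) : ℝ :=
  sSup {t : ℝ | ∃ ν : Measure (EuclideanSpace ℝ (Fin d)), IsFiniteMeasure ν ∧
    ν Eᶜ = 0 ∧
    (∀ᵐ x : EuclideanSpace ℝ (Fin d), rieszExists d s ν x ∧ ‖rieszTransform d s ν x‖ ≤ 1) ∧
    t = (ν univ).toReal}

/-- The Hausdorff content `M_h(G)` associated with a gauge function `h`: the infimum of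
`Σ_j h(r_j)` over all countable coverings of `G` by balls of radii `r_j`. -/
def hContent (d : ℕ) (h : ℝ → ℝ) (G : Set (EuclideanSpace ℝ (Fin d))) : ℝ≥0∞ :=
  ⨅ (x : ℕ → EuclideanSpace ℝ (Fin d)) (r : ℕ → ℝ) (_ : ∀ j, 0 < r j)
    (_ : G ⊆ ⋃ j, closedBall (x j) (r j)), ∑' j, ENNReal.ofReal (h (r j))

set_option linter.unusedSectionVars false

section Kernel

variable {d : ℕ} [NeZero d] {s : ℝ}

/-- The first coordinate of the Riesz kernel. -/
def rieszCoord (d : ℕ) [NeZero d] (s : ℝ) (u : EuclideanSpace ℝ (Fin d)) : ℝ :=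
  ‖u‖ ^ (-(s + 1)) * u 0

lemma rieszCoord_eq (u : EuclideanSpace ℝ (Fin d)) :
    rieszCoord d s u = rieszKernel d s u 0 := by
  simp [rieszCoord, rieszKernel]

lemma abs_coord_le_norm (u : EuclideanSpace ℝ (Fin d)) (i : Fin d) : |u i| ≤ ‖u‖ := by
  simpa using PiLp.norm_apply_le u i

lemma rieszCoord_neg (u : EuclideanSpace ℝ (Fin d)) : rieszCoord d s (-u) = -rieszCoord d s u := by
  simp [rieszCoord]

lemma measurable_rieszCoord : Measurable (rieszCoord d s) := by
  unfold rieszCoord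
  fun_prop

lemma abs_rieszCoord_le {ρ : ℝ} (hs : 0 < s) (hρ : 0 < ρ) {u : EuclideanSpace ℝ (Fin d)}
    (hu : ρ ≤ ‖u‖) : |rieszCoord d s u| ≤ ρ ^ (-s) := by
  have hu0 : 0 < ‖u‖ := hρ.trans_le hu
  calc |rieszCoord d s u| = ‖u‖ ^ (-(s + 1)) * |u 0| := by
        rw [rieszCoord, abs_mul, abs_of_nonneg (by positivity)]
    _ ≤ ‖u‖ ^ (-(s + 1)) * ‖u‖ := by gcongr; exact abs_coord_le_norm u 0
    _ = ‖u‖ ^ (-s) := by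
        rw [← Real.rpow_add_one hu0.ne']; congr 1; ring
    _ ≤ ρ ^ (-s) := Real.rpow_le_rpow_of_nonpos hρ hu (by linarith)

lemma rpow_neg_sub_le {p a b : ℝ} (hp : 0 ≤ p) (ha : 0 < a) (hab : a ≤ b) :
    a ^ (-p) - b ^ (-p) ≤ p * a ^ (-p - 1) * (b - a) := by
  have hb : 0 < b := ha.trans_le hab
  have h1 : b ^ (-p) = a ^ (-p) * (b / a) ^ (-p) := by
    rw [← Real.mul_rpow ha.le (by positivity)]; congr 1; field_simp
  have h2 : 1 - p * (b / a - 1) ≤ (b / a) ^ (-p) := by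
    rw [Real.rpow_def_of_pos (by positivity)]
    have h3 := Real.add_one_le_exp (Real.log (b / a) * -p)
    have h4 := Real.log_le_sub_one_of_pos (show 0 < b / a by positivity)
    nlinarith
  have h5 : a ^ (-p - 1) = a ^ (-p) / a := by rw [Real.rpow_sub_one ha.ne']
  have h6 : p * a ^ (-p - 1) * (b - a) = a ^ (-p) * (p * (b / a - 1)) := by
    rw [h5]; field_simp
  rw [h6, h1]
  have : 0 ≤ a ^ (-p) := by positivity
  nlinarith

lemma abs_rieszCoord_sub_le_aux {u v : EuclideanSpace ℝ (Fin d)} (hs : 0 < s) (hu : 0 < ‖u‖)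
    (huv : ‖u‖ ≤ ‖v‖) :
    |rieszCoord d s u - rieszCoord d s v| ≤ (s + 2) * ‖u‖ ^ (-s - 1) * ‖u - v‖ := by
  have hv : 0 < ‖v‖ := hu.trans_le huv
  have h1 : rieszCoord d s u - rieszCoord d s v
      = ‖v‖ ^ (-(s + 1)) * (u - v) 0 + (‖u‖ ^ (-(s + 1)) - ‖v‖ ^ (-(s + 1))) * u 0 := by
    simp only [rieszCoord, PiLp.sub_apply]; ring
  have h2 : |‖v‖ ^ (-(s + 1)) * (u - v) 0| ≤ ‖u‖ ^ (-s - 1) * ‖u - v‖ := by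
    rw [abs_mul, abs_of_nonneg (by positivity)]
    have h3 : ‖v‖ ^ (-(s + 1)) ≤ ‖u‖ ^ (-s - 1) := by
      rw [show -(s + 1) = -s - 1 by ring]
      exact Real.rpow_le_rpow_of_nonpos hu huv (by linarith)
    gcongr
    exact abs_coord_le_norm _ 0
  have h4 : |(‖u‖ ^ (-(s + 1)) - ‖v‖ ^ (-(s + 1))) * u 0| ≤ (s + 1) * ‖u‖ ^ (-s - 1) * ‖u - v‖ := by
    have h5 := rpow_neg_sub_le (p := s + 1) (by linarith) hu huv
    have h6 : ‖v‖ ^ (-(s + 1)) ≤ ‖u‖ ^ (-(s + 1)) :=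
      Real.rpow_le_rpow_of_nonpos hu huv (by linarith)
    have h7 : ‖v‖ - ‖u‖ ≤ ‖u - v‖ := by rw [norm_sub_rev]; exact norm_sub_norm_le v u
    rw [abs_mul, abs_of_nonneg (by linarith)]
    calc _ ≤ ((s + 1) * ‖u‖ ^ (-(s + 1) - 1) * (‖v‖ - ‖u‖)) * ‖u‖ := by
          gcongr
          exact abs_coord_le_norm u 0
      _ = (s + 1) * ‖u‖ ^ (-s - 1) * (‖v‖ - ‖u‖) := by
          have : ‖u‖ ^ (-s - 1) = ‖u‖ ^ (-(s + 1) - 1) * ‖u‖ := by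
            rw [← Real.rpow_add_one hu.ne']; congr 1; ring
          rw [this]; ring
      _ ≤ _ := by gcongr
  rw [h1]
  refine (abs_add_le _ _).trans ?_
  linarith

lemma abs_rieszCoord_sub_le {α ρ : ℝ} {u v : EuclideanSpace ℝ (Fin d)} (hs : 0 < s) (hα : 0 < α)
    (hα1 : α ≤ 1) (hρ : 0 < ρ) (hu : ρ ≤ ‖u‖) (hv : ρ ≤ ‖v‖) :
    |rieszCoord d s u - rieszCoord d s v| ≤ (s + 2) * ρ ^ (-s - α) * ‖u - v‖ ^ α := by
  wlog huv : ‖u‖ ≤ ‖v‖ generalizing u v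
  · rw [abs_sub_comm, norm_sub_rev]
    exact this hv hu (le_of_not_ge huv)
  have hu0 : 0 < ‖u‖ := hρ.trans_le hu
  have hmul : ρ ^ (-s - α) * ρ ^ α = ρ ^ (-s) := by
    rw [← Real.rpow_add hρ]; congr 1; ring
  rcases le_or_gt ρ ‖u - v‖ with h | h
  · have h1 : ρ ^ (-s) ≤ ρ ^ (-s - α) * ‖u - v‖ ^ α := by
      rw [← hmul]; gcongr
    have h2 := abs_rieszCoord_le hs hρ hu
    have h3 := abs_rieszCoord_le hs hρ hv
    have h4 := abs_sub (rieszCoord d s u) (rieszCoord d s v)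
    have : 0 ≤ ρ ^ (-s - α) * ‖u - v‖ ^ α := by positivity
    nlinarith
  · have h1 : ‖u‖ ^ (-s - 1) ≤ ρ ^ (-s - 1) := Real.rpow_le_rpow_of_nonpos hρ hu (by linarith)
    have h2 : ρ ^ (-s - 1) * ‖u - v‖ ≤ ρ ^ (-s - α) * ‖u - v‖ ^ α := by
      rcases (norm_nonneg (u - v)).eq_or_lt with h0 | h0
      · rw [← h0]; simp; positivity
      · have e1 : ρ ^ (-s - 1) = ρ ^ (-s - α) * ρ ^ (α - 1) := by
          rw [← Real.rpow_add hρ]; congr 1; ring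
        have e2 : ‖u - v‖ ^ α = ‖u - v‖ ^ (α - 1) * ‖u - v‖ := by
          rw [← Real.rpow_add_one h0.ne']; congr 1; ring
        rw [e1, e2, mul_assoc]
        gcongr ?_ * (?_ * ?_)
        exact Real.rpow_le_rpow_of_nonpos h0 h.le (by linarith)
    calc _ ≤ (s + 2) * ‖u‖ ^ (-s - 1) * ‖u - v‖ := abs_rieszCoord_sub_le_aux hs hu0 huv
      _ ≤ (s + 2) * (ρ ^ (-s - 1) * ‖u - v‖) := by rw [mul_assoc]; gcongr
      _ ≤ (s + 2) * (ρ ^ (-s - α) * ‖u - v‖ ^ α) := by gcongr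
      _ = _ := by ring

lemma le_rieszCoord {ρ : ℝ} {u : EuclideanSpace ℝ (Fin d)} (hs : 0 < s) (hρ : 0 < ρ)
    (h0 : ρ / 8 ≤ u 0) (hu : ‖u‖ ≤ 3 * ρ) : 3 ^ (-(s + 1)) / 8 * ρ ^ (-s) ≤ rieszCoord d s u := by
  have hu0 : 0 < ‖u‖ := by
    have := (le_abs_self _).trans (abs_coord_le_norm u 0); linarith
  have h1 : (3 * ρ) ^ (-(s + 1)) ≤ ‖u‖ ^ (-(s + 1)) :=
    Real.rpow_le_rpow_of_nonpos hu0 hu (by linarith)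
  have h2 : ρ ^ (-s) = ρ ^ (-(s + 1)) * ρ := by
    rw [← Real.rpow_add_one hρ.ne']; congr 1; ring
  calc 3 ^ (-(s + 1)) / 8 * ρ ^ (-s) = (3 * ρ) ^ (-(s + 1)) * (ρ / 8) := by
        rw [h2, Real.mul_rpow (by norm_num) hρ.le]; ring
    _ ≤ _ := by unfold rieszCoord; gcongr

/-- The uniform probability measure on an annulus of size `e`. -/
def annulusMeasure (d : ℕ) (e : ℝ) : Measure (EuclideanSpace ℝ (Fin d)) :=
  ProbabilityTheory.cond volume {a | e / 4 ≤ ‖a‖ ∧ ‖a‖ ≤ e / 2}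

lemma isProbabilityMeasure_annulusMeasure {e : ℝ} (he : 0 < e) :
    IsProbabilityMeasure (annulusMeasure d e) := by
  have hfin : volume {a : EuclideanSpace ℝ (Fin d) | e / 4 ≤ ‖a‖ ∧ ‖a‖ ≤ e / 2} ≠ ⊤ := by
    refine (lt_of_le_of_lt (measure_mono ?_)
      (measure_closedBall_lt_top (x := (0 : EuclideanSpace ℝ (Fin d))) (r := e / 2))).ne
    intro a ha
    simpa using ha.2
  refine ProbabilityTheory.cond_isProbabilityMeasure_of_finite ?_ hfin
  have hopen : IsOpen {a : EuclideanSpace ℝ (Fin d) | e / 4 < ‖a‖ ∧ ‖a‖ < e / 2} :=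
    (isOpen_lt continuous_const continuous_norm).inter (isOpen_lt continuous_norm continuous_const)
  have hne : {a : EuclideanSpace ℝ (Fin d) | e / 4 < ‖a‖ ∧ ‖a‖ < e / 2}.Nonempty := by
    refine ⟨EuclideanSpace.single 0 (3 * e / 8), ?_⟩
    simp only [mem_ofPred_eq, PiLp.norm_single, Real.norm_eq_abs]
    rw [abs_of_pos (by positivity)]
    constructor <;> linarith
  refine (lt_of_lt_of_le (hopen.measure_pos volume hne) (measure_mono ?_)).ne'
  intro a ha
  exact ⟨ha.1.le, ha.2.le⟩

lemma measurableSet_annulus (e : ℝ) :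
    MeasurableSet {a : EuclideanSpace ℝ (Fin d) | e / 4 ≤ ‖a‖ ∧ ‖a‖ ≤ e / 2} :=
  ((isClosed_le continuous_const continuous_norm).inter
    (isClosed_le continuous_norm continuous_const)).measurableSet

lemma ae_annulusMeasure (e : ℝ) :
    ∀ᵐ a ∂(annulusMeasure d e), e / 4 ≤ ‖a‖ ∧ ‖a‖ ≤ e / 2 :=
  ProbabilityTheory.ae_cond_mem (measurableSet_annulus e)

lemma annulusMeasure_absolutelyContinuous (e : ℝ) : annulusMeasure d e ≪ volume :=
  ProbabilityTheory.cond_absolutelyContinuous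

lemma integral_annulusMeasure_neg (e : ℝ) (f : EuclideanSpace ℝ (Fin d) → ℝ) :
    ∫ a, f (-a) ∂(annulusMeasure d e) = ∫ a, f a ∂(annulusMeasure d e) := by
  unfold annulusMeasure ProbabilityTheory.cond
  rw [integral_smul_measure, integral_smul_measure]
  congr 1
  have h := (Measure.measurePreserving_neg
    (volume : Measure (EuclideanSpace ℝ (Fin d)))).setIntegral_preimage_emb
    (Homeomorph.neg _).measurableEmbedding f {a | e / 4 ≤ ‖a‖ ∧ ‖a‖ ≤ e / 2}
  rw [← h]
  simp

/-- The first coordinate of the Riesz kernel averaged over an annulus of size `e`. -/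
def avgKernel (d : ℕ) [NeZero d] (s e : ℝ) (u : EuclideanSpace ℝ (Fin d)) : ℝ :=
  ∫ a, rieszCoord d s (u - a) ∂(annulusMeasure d e)

lemma avgKernel_neg (e : ℝ) (u : EuclideanSpace ℝ (Fin d)) :
    avgKernel d s e (-u) = -avgKernel d s e u := by
  unfold avgKernel
  rw [← integral_annulusMeasure_neg, ← integral_neg]
  congr 1; ext a
  rw [← rieszCoord_neg]; congr 1; abel

lemma avgKernel_zero (e : ℝ) : avgKernel d s e 0 = 0 := by
  have h := avgKernel_neg (d := d) (s := s) e 0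
  rw [neg_zero] at h; linarith

lemma integrable_rieszCoord_sub {e ρ : ℝ} (hs : 0 < s) (he : 0 < e) (hρ : 0 < ρ)
    {u : EuclideanSpace ℝ (Fin d)}
    (hu : ∀ᵐ a ∂(annulusMeasure d e), ρ ≤ ‖u - a‖) :
    Integrable (fun a => rieszCoord d s (u - a)) (annulusMeasure d e) := by
  have := isProbabilityMeasure_annulusMeasure (d := d) he
  refine Integrable.of_bound (C := ρ ^ (-s)) ?_ ?_
  · exact (measurable_rieszCoord.comp (measurable_const.sub measurable_id)).aestronglyMeasurable
  · filter_upwards [hu] with a ha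
    exact abs_rieszCoord_le hs hρ ha

lemma abs_integral_le_of_ae {Ω : Type*} [MeasurableSpace Ω] {μ : Measure Ω} [IsProbabilityMeasure μ]
    {f : Ω → ℝ} {c : ℝ} (h : ∀ᵐ a ∂μ, |f a| ≤ c) : |∫ a, f a ∂μ| ≤ c := by
  simpa using norm_integral_le_of_norm_le_const (μ := μ) (f := f) (C := c) h

lemma ae_half_le_norm_sub {e ρ : ℝ} (hρ : 4 * e ≤ ρ) (hρ0 : 0 < ρ)
    {u : EuclideanSpace ℝ (Fin d)} (hu : ρ ≤ ‖u‖) :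
    ∀ᵐ a ∂(annulusMeasure d e), ρ / 2 ≤ ‖u - a‖ := by
  filter_upwards [ae_annulusMeasure e] with a ha
  have := norm_sub_norm_le u a
  linarith [ha.2]

lemma ae_eighth_le_norm_sub {e : ℝ} {u : EuclideanSpace ℝ (Fin d)} (hu : ‖u‖ ≤ e / 8) :
    ∀ᵐ a ∂(annulusMeasure d e), e / 8 ≤ ‖u - a‖ := by
  filter_upwards [ae_annulusMeasure e] with a ha
  have := norm_sub_norm_le a u
  rw [norm_sub_rev]
  linarith [ha.1]

lemma abs_avgKernel_sub_le_of_ae {α ρ e : ℝ} {u v : EuclideanSpace ℝ (Fin d)} (hs : 0 < s)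
    (hα : 0 < α) (hα1 : α ≤ 1) (he : 0 < e) (hρ : 0 < ρ)
    (hu : ∀ᵐ a ∂(annulusMeasure d e), ρ ≤ ‖u - a‖)
    (hv : ∀ᵐ a ∂(annulusMeasure d e), ρ ≤ ‖v - a‖) :
    |avgKernel d s e u - avgKernel d s e v| ≤ (s + 2) * ρ ^ (-s - α) * ‖u - v‖ ^ α := by
  have := isProbabilityMeasure_annulusMeasure (d := d) he
  unfold avgKernel
  rw [← integral_sub (integrable_rieszCoord_sub hs he hρ hu)
    (integrable_rieszCoord_sub hs he hρ hv)]
  apply abs_integral_le_of_ae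
  filter_upwards [hu, hv] with a h1 h2
  simpa using abs_rieszCoord_sub_le hs hα hα1 hρ h1 h2

/-- The size, regularity and positivity estimates for the averaged kernels. -/
lemma exists_avgKernel_bounds {α : ℝ} (hs : 0 < s) (hα : 0 < α) (hα1 : α ≤ 1) :
    ∃ C c : ℝ, 0 < C ∧ 0 < c ∧ ∀ e : ℝ, 0 < e →
      (∀ ρ, 4 * e ≤ ρ → ∀ u : EuclideanSpace ℝ (Fin d), ρ ≤ ‖u‖ →
        |avgKernel d s e u| ≤ C * ρ ^ (-s)) ∧
      (∀ ρ, 4 * e ≤ ρ → ∀ u v : EuclideanSpace ℝ (Fin d), ρ ≤ ‖u‖ → ρ ≤ ‖v‖ →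
        |avgKernel d s e u - avgKernel d s e v| ≤ C * ρ ^ (-s - α) * ‖u - v‖ ^ α) ∧
      (∀ ρ, 4 * e ≤ ρ → ∀ u : EuclideanSpace ℝ (Fin d), ρ / 4 ≤ u 0 → ‖u‖ ≤ 2 * ρ →
        c * ρ ^ (-s) ≤ avgKernel d s e u) ∧
      (∀ u : EuclideanSpace ℝ (Fin d), ‖u‖ ≤ e / 8 →
        |avgKernel d s e u| ≤ C * e ^ (-s - α) * ‖u‖ ^ α) := by
  set C₁ : ℝ := (s + 2) * (1 / 8 : ℝ) ^ (-s - α) with hC₁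
  have hpos : 0 < C₁ := by positivity
  have key1 : (1 / 2 : ℝ) ^ (-s) ≤ C₁ := by
    have h1 : (1 / 2 : ℝ) ^ (-s) ≤ (1 / 8 : ℝ) ^ (-s) :=
      Real.rpow_le_rpow_of_nonpos (by norm_num) (by norm_num) (by linarith)
    have h2 : (1 / 8 : ℝ) ^ (-s) ≤ (1 / 8 : ℝ) ^ (-s - α) :=
      Real.rpow_le_rpow_of_exponent_ge (by norm_num) (by norm_num) (by linarith)
    have h3 : (0 : ℝ) < (1 / 8 : ℝ) ^ (-s - α) := by positivity
    nlinarith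
  have key2 : (s + 2) * (1 / 2 : ℝ) ^ (-s - α) ≤ C₁ := by
    have h1 : (1 / 2 : ℝ) ^ (-s - α) ≤ (1 / 8 : ℝ) ^ (-s - α) :=
      Real.rpow_le_rpow_of_nonpos (by norm_num) (by norm_num) (by linarith)
    rw [hC₁]
    gcongr
  refine ⟨C₁, 3 ^ (-(s + 1)) / 8, hpos, by positivity, fun e he => ⟨?_, ?_, ?_, ?_⟩⟩
  · intro ρ hρ u hu
    have hρ0 : 0 < ρ := by linarith
    have := isProbabilityMeasure_annulusMeasure (d := d) he
    have h1 : |avgKernel d s e u| ≤ (ρ / 2) ^ (-s) := by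
      apply abs_integral_le_of_ae
      filter_upwards [ae_half_le_norm_sub hρ hρ0 hu] with a ha
      exact abs_rieszCoord_le hs (by positivity) ha
    refine h1.trans ?_
    rw [show ρ / 2 = 1 / 2 * ρ by ring, Real.mul_rpow (by norm_num) hρ0.le]
    gcongr
  · intro ρ hρ u v hu hv
    have hρ0 : 0 < ρ := by linarith
    refine (abs_avgKernel_sub_le_of_ae hs hα hα1 he (half_pos hρ0)
      (ae_half_le_norm_sub hρ hρ0 hu) (ae_half_le_norm_sub hρ hρ0 hv)).trans ?_
    rw [show ρ / 2 = 1 / 2 * ρ by ring, Real.mul_rpow (by norm_num) hρ0.le, ← mul_assoc]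
    gcongr
  · intro ρ hρ u h0 hu
    have hρ0 : 0 < ρ := by linarith
    have := isProbabilityMeasure_annulusMeasure (d := d) he
    have hfar : ∀ᵐ a ∂(annulusMeasure d e), ρ / 8 ≤ (u - a) 0 ∧ ‖u - a‖ ≤ 3 * ρ := by
      filter_upwards [ae_annulusMeasure e] with a ha
      have h1 := (abs_le.1 (abs_coord_le_norm a 0)).2
      have h2 := norm_sub_le u a
      constructor
      · simp only [PiLp.sub_apply]; linarith [ha.2]
      · linarith [ha.2]
    have hint : Integrable (fun a => rieszCoord d s (u - a)) (annulusMeasure d e) := by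
      apply integrable_rieszCoord_sub hs he (show 0 < ρ / 8 by positivity)
      filter_upwards [hfar] with a ha
      exact ha.1.trans ((le_abs_self _).trans (abs_coord_le_norm (u - a) 0))
    have h2 : ∫ _, 3 ^ (-(s + 1)) / 8 * ρ ^ (-s) ∂(annulusMeasure d e) ≤ avgKernel d s e u := by
      apply integral_mono_ae (integrable_const _) hint
      filter_upwards [hfar] with a ha
      exact le_rieszCoord hs hρ0 ha.1 ha.2
    simpa using h2
  · intro u hu
    have h0 : ‖(0 : EuclideanSpace ℝ (Fin d))‖ ≤ e / 8 := by simp; positivity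
    have h := abs_avgKernel_sub_le_of_ae hs hα hα1 he (show 0 < e / 8 by positivity)
      (ae_eighth_le_norm_sub hu) (ae_eighth_le_norm_sub h0)
    rw [avgKernel_zero, sub_zero, sub_zero] at h
    refine h.trans (le_of_eq ?_)
    rw [show e / 8 = 1 / 8 * e by ring, Real.mul_rpow (by norm_num) he.le, hC₁]
    ring

end Kernel

section Duality

variable {d : ℕ} [NeZero d] {s : ℝ}

lemma norm_rieszKernel_le {ρ : ℝ} (hs : 0 < s) (hρ : 0 < ρ) {u : EuclideanSpace ℝ (Fin d)}
    (hu : ρ ≤ ‖u‖) : ‖rieszKernel d s u‖ ≤ ρ ^ (-s) := by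
  have hu0 : 0 < ‖u‖ := hρ.trans_le hu
  calc ‖rieszKernel d s u‖ = ‖u‖ ^ (-(s + 1)) * ‖u‖ := by
        rw [rieszKernel, norm_smul, Real.norm_of_nonneg (by positivity)]
    _ = ‖u‖ ^ (-s) := by rw [← Real.rpow_add_one hu0.ne']; congr 1; ring
    _ ≤ ρ ^ (-s) := Real.rpow_le_rpow_of_nonpos hρ hu (by linarith)

lemma measurable_rieszKernel : Measurable (rieszKernel d s) := by
  unfold rieszKernel
  fun_prop

/-- Away from the support of the measure the principal value is an absolutely convergent
integral. -/
lemma rieszTransform_eq_integral {ν : Measure (EuclideanSpace ℝ (Fin d))} {δ : ℝ} (hδ : 0 < δ)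
    {x : EuclideanSpace ℝ (Fin d)} (hx : ∀ᵐ y ∂ν, δ ≤ ‖y - x‖) :
    rieszTransform d s ν x = ∫ y, rieszKernel d s (y - x) ∂ν := by
  apply Tendsto.limUnder_eq
  apply tendsto_const_nhds.congr'
  filter_upwards [Ioo_mem_nhdsGT hδ] with ε hε
  unfold truncRiesz
  rw [Measure.restrict_eq_self_of_ae_mem]
  filter_upwards [hx] with y hy
  simp only [dist_eq_norm]
  exact hε.2.trans_le hy

lemma abs_integral_rieszCoord_le {ν : Measure (EuclideanSpace ℝ (Fin d))} [IsFiniteMeasure ν]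
    {δ : ℝ} (hs : 0 < s) (hδ : 0 < δ)
    {x : EuclideanSpace ℝ (Fin d)} (hx : ∀ᵐ y ∂ν, δ ≤ ‖y - x‖)
    (hR : ‖rieszTransform d s ν x‖ ≤ 1) : |∫ y, rieszCoord d s (y - x) ∂ν| ≤ 1 := by
  have hint : Integrable (fun y => rieszKernel d s (y - x)) ν := by
    refine Integrable.of_bound (C := δ ^ (-s)) ?_ ?_
    · exact (measurable_rieszKernel.comp (measurable_id.sub measurable_const)).aestronglyMeasurable
    · filter_upwards [hx] with y hy
      exact norm_rieszKernel_le hs hδ hy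
  have h1 : ∫ y, rieszCoord d s (y - x) ∂ν = (rieszTransform d s ν x) 0 := by
    rw [rieszTransform_eq_integral hδ hx]
    simp only [rieszCoord_eq]
    exact (EuclideanSpace.proj (𝕜 := ℝ) (0 : Fin d)).integral_comp_comm hint
  rw [h1]
  exact (abs_coord_le_norm _ 0).trans hR

lemma integral_avgKernel_le {ν : Measure (EuclideanSpace ℝ (Fin d))} [IsFiniteMeasure ν]
    {δ e : ℝ} (hs : 0 < s) (hδ : 0 < δ) (he : 0 < e) {p : EuclideanSpace ℝ (Fin d)}
    (hsep : ∀ᵐ y ∂ν, ∀ a : EuclideanSpace ℝ (Fin d), e / 4 ≤ ‖a‖ → ‖a‖ ≤ e / 2 → δ ≤ ‖y - p - a‖)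
    (hR : ∀ᵐ x, ‖rieszTransform d s ν x‖ ≤ 1) :
    Integrable (fun y => avgKernel d s e (y - p)) ν ∧
      |∫ y, avgKernel d s e (y - p) ∂ν| ≤ 1 := by
  have := isProbabilityMeasure_annulusMeasure (d := d) he
  have hmeas : Measurable fun z : EuclideanSpace ℝ (Fin d) × EuclideanSpace ℝ (Fin d) =>
      z.1 - p - z.2 := by fun_prop
  have hae : ∀ᵐ z ∂(ν.prod (annulusMeasure d e)), δ ≤ ‖z.1 - p - z.2‖ := by
    rw [Measure.ae_prod_iff_ae_ae (measurableSet_le measurable_const hmeas.norm)]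
    filter_upwards [hsep] with y hy
    filter_upwards [ae_annulusMeasure e] with a ha
    exact hy a ha.1 ha.2
  have hint : Integrable (fun z : EuclideanSpace ℝ (Fin d) × EuclideanSpace ℝ (Fin d) =>
      rieszCoord d s (z.1 - p - z.2)) (ν.prod (annulusMeasure d e)) := by
    refine Integrable.of_bound (C := δ ^ (-s)) ?_ ?_
    · exact (measurable_rieszCoord.comp hmeas).aestronglyMeasurable
    · filter_upwards [hae] with z hz
      exact abs_rieszCoord_le hs hδ hz
  refine ⟨hint.integral_prod_left, ?_⟩
  have hswap : ∫ y, avgKernel d s e (y - p) ∂ν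
      = ∫ a, ∫ y, rieszCoord d s (y - p - a) ∂ν ∂(annulusMeasure d e) := by
    unfold avgKernel
    exact integral_integral_swap hint
  rw [hswap]
  apply abs_integral_le_of_ae
  have hR' : ∀ᵐ a ∂(annulusMeasure d e), ‖rieszTransform d s ν (p + a)‖ ≤ 1 :=
    (annulusMeasure_absolutelyContinuous e).ae_le
      ((measurePreserving_add_left volume p).quasiMeasurePreserving.ae hR)
  filter_upwards [ae_annulusMeasure e, hR'] with a ha hRa
  have hx : ∀ᵐ y ∂ν, δ ≤ ‖y - (p + a)‖ := by
    filter_upwards [hsep] with y hy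
    rw [← sub_sub]
    exact hy a ha.1 ha.2
  simpa only [sub_sub] using abs_integral_rieszCoord_le hs hδ hx hRa

/-- The dual upper bound for the capacity. -/
lemma gammaPlus_le_of_dual {ι : Type*} [Fintype ι] {E : Set (EuclideanSpace ℝ (Fin d))}
    (c : ι → ℝ) (p : ι → EuclideanSpace ℝ (Fin d)) {δ e : ℝ} (hs : 0 < s) (hδ : 0 < δ)
    (he : 0 < e)
    (hsep : ∀ y ∈ E, ∀ i, ∀ a : EuclideanSpace ℝ (Fin d), e / 4 ≤ ‖a‖ → ‖a‖ ≤ e / 2 →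
      δ ≤ ‖y - p i - a‖)
    (hone : ∀ y ∈ E, 1 ≤ ∑ i, c i * avgKernel d s e (y - p i)) :
    gammaPlus d s E ≤ ∑ i, |c i| := by
  apply csSup_le
  · refine ⟨0, 0, inferInstance, by simp, ?_, by simp⟩
    have h0 : ∀ x, Tendsto (fun ε => truncRiesz d s 0 ε x) (𝓝[>] (0 : ℝ)) (𝓝 0) := fun x => by
      simp [truncRiesz]
    refine Eventually.of_forall fun x => ⟨⟨0, h0 x⟩, ?_⟩
    rw [rieszTransform, (h0 x).limUnder_eq]
    simp
  · rintro t ⟨ν, hν, hE, hR, rfl⟩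
    have hmem : ∀ᵐ y ∂ν, y ∈ E := hE
    have h1 : ∀ i, Integrable (fun y => avgKernel d s e (y - p i)) ν ∧
        |∫ y, avgKernel d s e (y - p i) ∂ν| ≤ 1 := fun i =>
      integral_avgKernel_le hs hδ he (hmem.mono fun y hy a => hsep y hy i a)
        (hR.mono fun _ h => h.2)
    calc (ν univ).toReal = ∫ _, (1 : ℝ) ∂ν := by simp [Measure.real]
      _ ≤ ∫ y, ∑ i, c i * avgKernel d s e (y - p i) ∂ν := by
          apply integral_mono_ae (integrable_const _)
            (integrable_finsetSum _ fun i _ => (h1 i).1.const_mul _)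
          filter_upwards [hmem] with y hy using hone y hy
      _ = ∑ i, c i * ∫ y, avgKernel d s e (y - p i) ∂ν := by
          rw [integral_finsetSum _ fun i _ => (h1 i).1.const_mul _]
          simp only [integral_const_mul]
      _ ≤ ∑ i, |c i| := by
          apply Finset.sum_le_sum
          intro i _
          calc _ ≤ |c i * ∫ y, avgKernel d s e (y - p i) ∂ν| := le_abs_self _
            _ ≤ |c i| * 1 := by rw [abs_mul]; gcongr; exact (h1 i).2
            _ = _ := mul_one _

end Duality

section Packing

variable {d : ℕ} [NeZero d]

lemma volume_real_ball_pos : 0 < volume.real (ball (0 : EuclideanSpace ℝ (Fin d)) 1) :=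
  ENNReal.toReal_pos (measure_ball_pos _ _ one_pos).ne' measure_ball_lt_top.ne

lemma volume_real_ball (x : EuclideanSpace ℝ (Fin d)) {r : ℝ} (hr : 0 < r) :
    volume.real (ball x r) = r ^ d * volume.real (ball (0 : EuclideanSpace ℝ (Fin d)) 1) := by
  have := Measure.addHaar_ball_of_pos volume x hr
  rw [finrank_euclideanSpace_fin] at this
  rw [measureReal_def, this, ENNReal.toReal_mul, ENNReal.toReal_ofReal (by positivity),
    measureReal_def]

lemma volume_real_closedBall (x : EuclideanSpace ℝ (Fin d)) {r : ℝ} (hr : 0 ≤ r) :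
    volume.real (closedBall x r) = r ^ d * volume.real (ball (0 : EuclideanSpace ℝ (Fin d)) 1) := by
  have := Measure.addHaar_real_closedBall volume x hr
  rwa [finrank_euclideanSpace_fin] at this

lemma exists_separated_points (M : ℕ) {δ : ℝ} (hδ : 0 < δ) (hM : (M : ℝ) * δ ^ d * 4 ^ d ≤ 1) :
    ∃ x : Fin M → EuclideanSpace ℝ (Fin d), (∀ i, ‖x i‖ ≤ 1 / 4) ∧
      ∀ i j, i ≠ j → δ ≤ ‖x i - x j‖ := by
  induction M with
  | zero => exact ⟨Fin.elim0, fun i => i.elim0, fun i => i.elim0⟩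
  | succ n ih =>
    have hn : (n : ℝ) * δ ^ d * 4 ^ d < 1 := by
      push_cast at hM
      have : 0 < δ ^ d * 4 ^ d := by positivity
      nlinarith
    obtain ⟨x, hx, hsep⟩ := ih hn.le
    have hex : ∃ y : EuclideanSpace ℝ (Fin d), ‖y‖ ≤ 1 / 4 ∧ ∀ i, δ ≤ ‖y - x i‖ := by
      by_contra! hcon
      have hcov : closedBall (0 : EuclideanSpace ℝ (Fin d)) (1 / 4) ⊆ ⋃ i, ball (x i) δ := by
        intro y hy
        obtain ⟨i, hi⟩ := hcon y (by simpa using hy)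
        exact mem_iUnion.2 ⟨i, by simpa [dist_eq_norm] using hi⟩
      have h1 : volume.real (closedBall (0 : EuclideanSpace ℝ (Fin d)) (1 / 4))
          ≤ ∑ i, volume.real (ball (x i) δ) :=
        (measureReal_mono hcov ((measure_iUnion_fintype_le _ _).trans_lt
          (ENNReal.sum_lt_top.2 fun i _ => measure_ball_lt_top)).ne).trans
          (measureReal_iUnion_fintype_le _)
      simp only [volume_real_ball _ hδ] at h1
      rw [volume_real_closedBall _ (by norm_num), Finset.sum_const, Finset.card_univ,
        Fintype.card_fin, nsmul_eq_mul, ← mul_assoc] at h1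
      have h2 := le_of_mul_le_mul_right h1 volume_real_ball_pos
      have h3 : ((1 : ℝ) / 4) ^ d * 4 ^ d = 1 := by rw [← mul_pow]; norm_num
      have h4 : (0 : ℝ) < 4 ^ d := by positivity
      nlinarith
    obtain ⟨y, hy, hyx⟩ := hex
    refine ⟨Fin.snoc x y, ?_, ?_⟩
    · intro i
      refine Fin.lastCases ?_ (fun i => ?_) i
      · simpa using hy
      · simpa using hx i
    · intro i j
      refine Fin.lastCases ?_ (fun i => ?_) i <;> refine Fin.lastCases ?_ (fun j => ?_) j
      · simp
      · intro _; simpa using hyx j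
      · intro _; simpa [norm_sub_rev] using hyx i
      · intro hij
        simpa using hsep i j (fun h => hij (by rw [h]))

lemma pairwiseDisjoint_ball_of_separated {ι : Type*} {x : ι → EuclideanSpace ℝ (Fin d)}
    {δ : ℝ} (hsep : ∀ i j, i ≠ j → δ ≤ ‖x i - x j‖) (t : Set ι) :
    t.PairwiseDisjoint fun i => ball (x i) (δ / 2) := by
  intro i _ j _ hij
  apply ball_disjoint_ball
  rw [dist_eq_norm]
  linarith [hsep i j hij]

lemma card_mul_le_of_separated {ι : Type*} {x : ι → EuclideanSpace ℝ (Fin d)}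
    {δ : ℝ} (hδ : 0 < δ) (hsep : ∀ i j, i ≠ j → δ ≤ ‖x i - x j‖) (t : Finset ι)
    (y : EuclideanSpace ℝ (Fin d)) {R : ℝ} (hR : 0 ≤ R) (ht : ∀ i ∈ t, ‖x i - y‖ ≤ R) :
    (t.card : ℝ) * (δ / 2) ^ d ≤ (R + δ / 2) ^ d := by
  have hsub : ⋃ i ∈ t, ball (x i) (δ / 2) ⊆ closedBall y (R + δ / 2) := by
    intro z hz
    obtain ⟨i, hi, hz⟩ := mem_iUnion₂.1 hz
    rw [mem_closedBall]
    have h1 := dist_triangle z (x i) y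
    have h2 := ht i hi
    rw [← dist_eq_norm] at h2
    linarith [mem_ball.1 hz]
  have h1 := measureReal_mono (μ := volume) hsub measure_closedBall_lt_top.ne
  rw [measureReal_biUnion_finset (pairwiseDisjoint_ball_of_separated hsep t)
    (fun _ _ => measurableSet_ball) (fun _ _ => measure_ball_lt_top.ne)] at h1
  simp only [volume_real_ball _ (half_pos hδ)] at h1
  rw [volume_real_closedBall _ (by positivity), Finset.sum_const, nsmul_eq_mul, ← mul_assoc] at h1
  exact le_of_mul_le_mul_right h1 volume_real_ball_pos

lemma exists_sum_rpow_le_of_separated {β : ℝ} (hβ : 0 ≤ β) (hβd : β < d) :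
    ∃ C : ℝ, 0 < C ∧ ∀ {ι : Type} [Fintype ι] [DecidableEq ι] (x : ι → EuclideanSpace ℝ (Fin d))
      (δ : ℝ), 0 < δ → (∀ i, ‖x i‖ ≤ 1) → (∀ i j, i ≠ j → δ ≤ ‖x i - x j‖) → ∀ i,
      (∑ j ∈ Finset.univ.erase i, ‖x i - x j‖ ^ (-β)) * δ ^ d ≤ C := by
  set I : ℝ := ∫ y in ball (0 : EuclideanSpace ℝ (Fin d)) 3, ‖y‖ ^ (-β) with hI
  have hI0 : 0 ≤ I := integral_nonneg fun y => by positivity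
  have hintg : IntegrableOn (fun y : EuclideanSpace ℝ (Fin d) => ‖y‖ ^ (-β)) (ball 0 3) := by
    refine integrableOn_ball_of_norm_le_rpow (C := 1) (α := β) ?_ ?_ ?_ ?_
    · rw [finrank_euclideanSpace_fin]; exact NeZero.one_le
    · rwa [finrank_euclideanSpace_fin]
    · refine Eventually.of_forall fun y => ?_
      rw [one_mul, Real.norm_of_nonneg (by positivity)]
    · exact (measurable_norm.pow_const _).aestronglyMeasurable
  set v := volume.real (ball (0 : EuclideanSpace ℝ (Fin d)) 1) with hv
  have hv0 : 0 < v := volume_real_ball_pos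
  refine ⟨(2 / 3 : ℝ) ^ (-β) * 2 ^ d * I / v + 1, by positivity, ?_⟩
  intro ι _ _ x δ hδ hx hsep i
  have hint : IntegrableOn (fun y => ‖x i - y‖ ^ (-β)) (ball (x i) 3) ∧
      ∫ y in ball (x i) 3, ‖x i - y‖ ^ (-β) = I := by
    have hmp : MeasurePreserving (fun y => x i - y) volume volume :=
      Measure.measurePreserving_sub_left volume (x i)
    have hemb : MeasurableEmbedding (fun y => x i - y) :=
      (Homeomorph.subLeft (x i)).measurableEmbedding
    have hpre : (fun y => x i - y) ⁻¹' (ball 0 3) = ball (x i) 3 := by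
      ext y; simp [dist_eq_norm, norm_sub_rev]
    constructor
    · rw [← hpre]
      exact (hmp.integrableOn_comp_preimage hemb).2 hintg
    · rw [← hpre]
      exact hmp.setIntegral_preimage_emb hemb (fun z => ‖z‖ ^ (-β)) (ball 0 3)
  by_cases hcard : ∃ j, j ≠ i
  swap
  · have : Finset.univ.erase i = (∅ : Finset ι) := by
      push Not at hcard
      ext j; simp [hcard j]
    rw [this]; simp; positivity
  have hδ2 : δ ≤ 2 := by
    obtain ⟨j, hj⟩ := hcard
    have h1 := hsep j i hj
    have h2 := norm_sub_le (x j) (x i)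
    linarith [hx i, hx j]
  have hsub : ∀ j, ball (x j) (δ / 2) ⊆ ball (x i) 3 := by
    intro j y hy
    have h1 := dist_triangle y (x j) (x i)
    have h2 := norm_sub_le (x j) (x i)
    rw [← dist_eq_norm] at h2
    have := mem_ball.1 hy
    rw [mem_ball]
    linarith [hx i, hx j]
  have hone : ∀ j ∈ Finset.univ.erase i, ‖x i - x j‖ ^ (-β) * ((δ / 2) ^ d * v)
      ≤ (2 / 3 : ℝ) ^ (-β) * ∫ y in ball (x j) (δ / 2), ‖x i - y‖ ^ (-β) := by
    intro j hj
    have hji : i ≠ j := (Finset.ne_of_mem_erase hj).symm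
    have hpos : 0 < ‖x i - x j‖ := hδ.trans_le (hsep i j hji)
    have h1 : ∫ _ in ball (x j) (δ / 2), ‖x i - x j‖ ^ (-β) ≤
        ∫ y in ball (x j) (δ / 2), (2 / 3 : ℝ) ^ (-β) * ‖x i - y‖ ^ (-β) := by
      refine setIntegral_mono_on (integrableOn_const measure_ball_lt_top.ne)
        ((hint.1.mono_set (hsub j)).const_mul _) measurableSet_ball ?_
      intro y hy
      have hy' : ‖x j - y‖ < δ / 2 := by simpa [dist_eq_norm, norm_sub_rev] using hy
      have hij := hsep i j hji
      have htri : ‖x i - y‖ ≤ ‖x i - x j‖ + ‖x j - y‖ := norm_sub_le_norm_sub_add_norm_sub _ _ _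
      have htri2 : ‖x i - x j‖ ≤ ‖x i - y‖ + ‖y - x j‖ := norm_sub_le_norm_sub_add_norm_sub _ _ _
      rw [norm_sub_rev y] at htri2
      rw [← Real.mul_rpow (by norm_num) (norm_nonneg _)]
      apply Real.rpow_le_rpow_of_nonpos
      · linarith
      · linarith
      · linarith
    rw [setIntegral_const, integral_const_mul, volume_real_ball _ (half_pos hδ), smul_eq_mul] at h1
    linarith
  have hsum := Finset.sum_le_sum hone
  rw [← Finset.sum_mul, ← Finset.mul_sum,
    ← integral_biUnion_finset _ (fun _ _ => measurableSet_ball)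
    (pairwiseDisjoint_ball_of_separated hsep _)
    (fun j _ => hint.1.mono_set (hsub j))] at hsum
  have hle : ∫ y in ⋃ j ∈ Finset.univ.erase i, ball (x j) (δ / 2), ‖x i - y‖ ^ (-β) ≤ I := by
    rw [← hint.2]
    refine setIntegral_mono_set hint.1 (Eventually.of_forall fun y => by positivity) ?_
    exact (iUnion₂_subset fun j _ => hsub j).eventuallyLE
  have h2 : (2 / 3 : ℝ) ^ (-β) * 2 ^ d * I / v ≥
      (∑ j ∈ Finset.univ.erase i, ‖x i - x j‖ ^ (-β)) * δ ^ d := by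
    rw [ge_iff_le, le_div_iff₀ hv0]
    calc _ = 2 ^ d * ((∑ j ∈ Finset.univ.erase i, ‖x i - x j‖ ^ (-β)) * ((δ / 2) ^ d * v)) := by
          rw [div_pow]; field_simp
      _ ≤ 2 ^ d * ((2 / 3 : ℝ) ^ (-β) * I) := by
          refine mul_le_mul_of_nonneg_left (hsum.trans ?_) (by positivity)
          gcongr
      _ = _ := by ring
  linarith

end Packing

section Cells

variable {d : ℕ} [NeZero d]

/-- The sign attached to a child cell: `1` on the left cluster and `-1` on the right one. -/
def cellSign {M : ℕ} (v : Bool × Fin M) : ℝ := if v.1 then 1 else -1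

lemma abs_cellSign {M : ℕ} (v : Bool × Fin M) : |cellSign v| = 1 := by
  unfold cellSign; split_ifs <;> simp

lemma cellSign_sq {M : ℕ} (v : Bool × Fin M) : cellSign v ^ 2 = 1 := by
  rw [← sq_abs, abs_cellSign]; norm_num

lemma sum_cellSign (M : ℕ) : ∑ v : Bool × Fin M, cellSign v = 0 := by
  simp [cellSign, Fintype.sum_prod_type]

/-- Two clusters of `M` points each, at unit scale. -/
structure IsCellConfig (β K C : ℝ) {M : ℕ} (v : Bool × Fin M → EuclideanSpace ℝ (Fin d)) :
    Prop where
  norm_le : ∀ i, ‖v i‖ ≤ 3 / 4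
  sep : ∀ τ : ℝ, 0 < τ → 2 * M * K * τ ^ d ≤ 1 → ∀ i j, i ≠ j → 10 * τ ≤ ‖v i - v j‖
  row : ∀ i, ∑ j ∈ Finset.univ.erase i, ‖v i - v j‖ ^ (-β) ≤ C * (2 * M)
  coord : ∀ i j, 1 / 2 ≤ (v (false, i) - v (true, j)) 0
  count : ∀ (t : Finset (Bool × Fin M)) (y : EuclideanSpace ℝ (Fin d)) (R : ℝ), 0 ≤ R →
    (∀ i ∈ t, ‖v i - y‖ ≤ R) → (t.card : ℝ) ≤ C * (1 + 2 * M * R ^ d)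

lemma exists_isCellConfig {β : ℝ} (hβ : 0 ≤ β) (hβd : β < d) :
    ∃ K C : ℝ, 1 ≤ K ∧ 1 ≤ C ∧ ∀ M : ℕ, 1 ≤ M →
      ∃ v : Bool × Fin M → EuclideanSpace ℝ (Fin d), IsCellConfig β K C v := by
  obtain ⟨C', hC', hrow⟩ := exists_sum_rpow_le_of_separated (d := d) hβ hβd
  refine ⟨40 ^ d, C' * 4 ^ d + 16 ^ d, one_le_pow₀ (by norm_num), ?_, ?_⟩
  · have : (1 : ℝ) ≤ 16 ^ d := one_le_pow₀ (by norm_num)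
    have : 0 < C' * 4 ^ d := by positivity
    linarith
  intro M hM
  have hM0 : (0 : ℝ) < M := by exact_mod_cast hM
  set δ : ℝ := (M : ℝ)⁻¹ ^ ((d : ℝ)⁻¹) / 4 with hδ
  have hδ0 : 0 < δ := by positivity
  have hδd : (M : ℝ) * δ ^ d * 4 ^ d = 1 := by
    rw [hδ, div_pow, Real.rpow_inv_natCast_pow (by positivity) (NeZero.ne d)]
    field_simp
  have hδ1 : δ ≤ 1 / 4 := by
    have : (M : ℝ)⁻¹ ^ ((d : ℝ)⁻¹) ≤ 1 :=
      Real.rpow_le_one (by positivity) (inv_le_one_of_one_le₀ (by exact_mod_cast hM))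
        (by positivity)
    rw [hδ]; linarith
  obtain ⟨x, hx, hsep⟩ := exists_separated_points (d := d) M hδ0 hδd.le
  set c : EuclideanSpace ℝ (Fin d) := EuclideanSpace.single 0 (1 / 2) with hc
  have hc0 : c 0 = 1 / 2 := by simp [hc]
  have hcn : ‖c‖ = 1 / 2 := by simp [hc]
  set v : Bool × Fin M → EuclideanSpace ℝ (Fin d) := fun i => x i.2 - cellSign i • c with hv
  have hcoord : ∀ i j, 1 / 2 ≤ (v (false, i) - v (true, j)) 0 := by
    intro i j
    have h1 := (abs_le.1 (abs_coord_le_norm (x i) 0)).1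
    have h2 := (abs_le.1 (abs_coord_le_norm (x j) 0)).2
    simp only [hv, PiLp.sub_apply, PiLp.smul_apply, hc0, cellSign, smul_eq_mul]
    simp only [Bool.false_eq_true, if_false, if_true]
    linarith [hx i, hx j]
  have hcross : ∀ i j, δ ≤ ‖v (false, i) - v (true, j)‖ := fun i j => by
    have h1 := (abs_le.1 (abs_coord_le_norm (v (false, i) - v (true, j)) 0)).2
    linarith [hcoord i j]
  have hnorm : ∀ i, ‖v i‖ ≤ 3 / 4 := by
    intro i
    have h1 := norm_sub_le (x i.2) (cellSign i • c)
    rw [norm_smul, hcn, Real.norm_eq_abs, abs_cellSign] at h1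
    simp only [hv]
    linarith [hx i.2]
  have hvsep : ∀ i j, i ≠ j → δ ≤ ‖v i - v j‖ := by
    rintro ⟨b, i⟩ ⟨b', j⟩ hij
    cases b <;> cases b'
    · have hne : i ≠ j := fun h => hij (by rw [h])
      simpa [hv, cellSign] using hsep i j hne
    · exact hcross i j
    · rw [norm_sub_rev]; exact hcross j i
    · have hne : i ≠ j := fun h => hij (by rw [h])
      simpa [hv, cellSign] using hsep i j hne
  have h4 : (0 : ℝ) < 4 ^ d := by positivity
  have hδinv : δ ^ d = 1 / (M * 4 ^ d) := by
    rw [eq_div_iff (by positivity)]; linarith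
  refine ⟨v, hnorm, ?_, ?_, hcoord, ?_⟩
  · intro τ hτ hτM i j hij
    refine le_trans ?_ (hvsep i j hij)
    refine le_of_pow_le_pow_left₀ (NeZero.ne d) hδ0.le ?_
    rw [hδinv, le_div_iff₀ (by positivity), mul_pow]
    have h5 : (40 : ℝ) ^ d = 10 ^ d * 4 ^ d := by rw [← mul_pow]; norm_num
    rw [h5] at hτM
    have : (0 : ℝ) ≤ 10 ^ d * τ ^ d * (M * 4 ^ d) := by positivity
    nlinarith
  · intro i
    have h1 := hrow v δ hδ0 (fun i => (hnorm i).trans (by norm_num)) hvsep i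
    rw [hδinv, mul_one_div, div_le_iff₀ (by positivity)] at h1
    have : (0 : ℝ) ≤ C' * (M * 4 ^ d) := by positivity
    have : (0 : ℝ) ≤ 16 ^ d * (2 * M) := by positivity
    linarith
  · intro t y R hR ht
    have h1 := card_mul_le_of_separated hδ0 hvsep t y hR ht
    have h2 : (R + δ / 2) ^ d ≤ 2 ^ d * (R ^ d + (δ / 2) ^ d) := by
      refine (add_pow_le hR (by positivity) d).trans ?_
      gcongr
      · norm_num
      · exact Nat.sub_le d 1
    have h3 : (δ / 2) ^ d = 1 / (M * 8 ^ d) := by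
      rw [div_pow, hδinv, show (8 : ℝ) = 4 * 2 by norm_num, mul_pow]
      field_simp
    have h8 : (0 : ℝ) < 8 ^ d := by positivity
    have h5 : (t.card : ℝ) ≤ 2 ^ d * (R ^ d * (M * 8 ^ d) + 1) := by
      have h6 := h1.trans h2
      rw [h3, mul_one_div, div_le_iff₀ (by positivity)] at h6
      calc (t.card : ℝ) ≤ _ := h6
        _ = _ := by field_simp
    have h7 : (16 : ℝ) ^ d = 2 ^ d * 8 ^ d := by rw [← mul_pow]; norm_num
    have h9 : (1 : ℝ) ≤ 8 ^ d := one_le_pow₀ (by norm_num)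
    have h10 : (0 : ℝ) ≤ 2 ^ d * 8 ^ d * (M * R ^ d) := by positivity
    have h11 : (0 : ℝ) ≤ C' * 4 ^ d * (1 + 2 * M * R ^ d) := by positivity
    have h12 : (2 : ℝ) ^ d ≤ 2 ^ d * 8 ^ d := le_mul_of_one_le_right (by positivity) h9
    rw [h7]
    nlinarith

end Cells

section Block

variable {d : ℕ} [NeZero d] {s : ℝ}

/-- The field at `x` generated by the charges `w * f ω` placed at the points `p ω`, with respect
to the averaged kernel. -/
def blockField {Ω : Type} [Fintype Ω] (s e w : ℝ) (p : Ω → EuclideanSpace ℝ (Fin d)) (f : Ω → ℝ)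
    (x : EuclideanSpace ℝ (Fin d)) : ℝ :=
  w * ∑ ω, f ω * avgKernel d s e (x - p ω)

/-- A finite configuration of points `p ω` of equal mass `w` inside the ball of radius `r`, with
total mass `m`, carrying a charge distribution `f` whose field is, on average, comparable with its
energy `S`. The numbers `a`, `X`, `b` are error parameters. -/
structure IsRieszBlock {Ω : Type} [Fintype Ω] [DecidableEq Ω] (s α D c₀ q e : ℝ) (H : ℝ → ℝ)
    (r m : ℝ) (p : Ω → EuclideanSpace ℝ (Fin d)) (f : Ω → ℝ) (w S a X b : ℝ) : Prop where
  e_pos : 0 < e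
  w_pos : 0 < w
  m_pos : 0 < m
  norm_add_le : ∀ ω, ‖p ω‖ + e ≤ r
  sep : ∀ ω ω', ω ≠ ω' → 8 * e ≤ ‖p ω - p ω'‖
  mass : w * Fintype.card Ω = m
  count : ∀ (t : Finset Ω) (x : EuclideanSpace ℝ (Fin d)) (R : ℝ), e ≤ R →
    (∀ ω ∈ t, ‖p ω - x‖ ≤ R) → w * t.card ≤ H R
  S_nonneg : 0 ≤ S
  a_nonneg : 0 ≤ a
  X_nonneg : 0 ≤ X
  b_nonneg : 0 ≤ b
  sum_f : ∑ ω, f ω = 0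
  sum_f_sq : ∑ ω, f ω ^ 2 ≤ Fintype.card Ω * S
  f_test : ∀ (ψ : Ω → ℝ) (L : ℝ), 0 ≤ L → (∀ ω ω', |ψ ω - ψ ω'| ≤ L * ‖p ω - p ω'‖ ^ α) →
    |∑ ω, f ω * ψ ω| ≤ Fintype.card Ω * (2 * L * a * r ^ α)
  unit_test : ∀ (ψ : Ω → ℝ) (L : ℝ), 0 ≤ L → (∀ ω ω', |ψ ω - ψ ω'| ≤ L * ‖p ω - p ω'‖ ^ α) →
    |∑ ω, blockField s e w p 1 (p ω) * ψ ω| ≤ Fintype.card Ω * (2 * D * L * a * r ^ α)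
  unit_sq : ∑ ω, blockField s e w p 1 (p ω) ^ 2 ≤ Fintype.card Ω * (4 * D ^ 2 * (S + X))
  field_sum : Fintype.card Ω * (c₀ * S - D * X) ≤ ∑ ω, blockField s e w p f (p ω)
  field_sq : ∑ ω, blockField s e w p f (p ω) ^ 2 ≤ Fintype.card Ω * (4 * D ^ 2 * (S + X) ^ 2)
  X_le : X + q * a ^ 2 ≤ 2 * q * S
  row : ∀ ω, ∑ ω' ∈ Finset.univ.erase ω, w * ‖p ω - p ω'‖ ^ (-(s + α)) ≤ D * b * e ^ (-α)
  b_sq : b ^ 2 ≤ (1 - (e / r) ^ α) * S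

lemma sum_blockField_one {Ω : Type} [Fintype Ω] (e w : ℝ)
    (p : Ω → EuclideanSpace ℝ (Fin d)) : ∑ ω, blockField s e w p 1 (p ω) = 0 := by
  have h : ∑ ω, blockField s e w p 1 (p ω) = -∑ ω, blockField s e w p 1 (p ω) := by
    conv_lhs => unfold blockField
    conv_rhs => unfold blockField
    simp only [Pi.one_apply, one_mul]
    rw [← Finset.mul_sum, ← mul_neg, ← Finset.sum_neg_distrib]
    congr 1
    conv_lhs => rw [Finset.sum_comm]
    refine Finset.sum_congr rfl fun ω _ => ?_
    rw [← Finset.sum_neg_distrib]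
    refine Finset.sum_congr rfl fun ω' _ => ?_
    rw [← avgKernel_neg, neg_sub]
  linarith

lemma sum_add_sq_le {Ω : Type} [Fintype Ω] {A B : Ω → ℝ} {x y : ℝ} (hx : 0 ≤ x) (hy : 0 ≤ y)
    (hA : ∑ ω, A ω ^ 2 ≤ Fintype.card Ω * x ^ 2) (hB : ∀ ω, |B ω| ≤ y) :
    ∑ ω, (A ω + B ω) ^ 2 ≤ Fintype.card Ω * (x + y) ^ 2 := by
  have h1 : ∑ ω, |A ω| ≤ Fintype.card Ω * x := by
    have h2 := sq_sum_le_card_mul_sum_sq (s := Finset.univ) (f := fun ω => |A ω|)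
    simp only [sq_abs, Finset.card_univ] at h2
    refine le_of_sq_le_sq ?_ (by positivity)
    calc _ ≤ _ := h2
      _ ≤ Fintype.card Ω * (Fintype.card Ω * x ^ 2) := by gcongr
      _ = _ := by ring
  calc ∑ ω, (A ω + B ω) ^ 2 ≤ ∑ ω, (A ω ^ 2 + 2 * y * |A ω| + y ^ 2) := by
        apply Finset.sum_le_sum
        intro ω _
        have h3 : A ω * B ω ≤ |A ω| * y := by
          calc A ω * B ω ≤ |A ω * B ω| := le_abs_self _
            _ = |A ω| * |B ω| := abs_mul _ _
            _ ≤ |A ω| * y := by gcongr; exact hB ω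
        have h4 : B ω ^ 2 ≤ y ^ 2 := by
          rw [← sq_abs (B ω)]; gcongr; exact hB ω
        nlinarith
    _ = ∑ ω, A ω ^ 2 + 2 * y * ∑ ω, |A ω| + Fintype.card Ω * y ^ 2 := by
        rw [Finset.sum_add_distrib, Finset.sum_add_distrib, ← Finset.mul_sum, Finset.sum_const,
          Finset.card_univ, nsmul_eq_mul]
    _ ≤ Fintype.card Ω * x ^ 2 + 2 * y * (Fintype.card Ω * x) + Fintype.card Ω * y ^ 2 := by
        gcongr
    _ = _ := by ring

lemma isRieszBlock_unit {α D c₀ q r m : ℝ} {H : ℝ → ℝ} (hr : 0 < r) (hm : 0 < m)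
    (hH : ∀ R, r ≤ R → m ≤ H R) :
    IsRieszBlock (d := d) (Ω := Unit) s α D c₀ q r H r m (fun _ => 0) (fun _ => 0) m 0 0 0 0 := by
  have hk : ∀ g : Unit → ℝ, blockField (d := d) s r m (fun _ : Unit => 0) g 0 = 0 := by
    intro g; simp [blockField, avgKernel_zero]
  refine ⟨hr, hm, hm, ?_, ?_, by simp, ?_, le_rfl, le_rfl, le_rfl, le_rfl, ?_, ?_, ?_, ?_, ?_, ?_,
    ?_, ?_, ?_, ?_⟩
  · simp
  · intro ω ω' h; exact absurd (Subsingleton.elim _ _) h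
  · intro t x R hR _
    refine le_trans ?_ (hH R hR)
    have : (t.card : ℝ) ≤ 1 := by
      have := Finset.card_le_univ t
      simpa using this
    nlinarith
  all_goals simp [hk]

/-- The hypotheses of the far-field estimates for the averaged kernel. -/
structure KernelBound (d : ℕ) [NeZero d] (s α C c e : ℝ) : Prop where
  C_pos : 0 < C
  size : ∀ ρ, 4 * e ≤ ρ → ∀ u : EuclideanSpace ℝ (Fin d), ρ ≤ ‖u‖ →
    |avgKernel d s e u| ≤ C * ρ ^ (-s)
  holder : ∀ ρ, 4 * e ≤ ρ → ∀ u v : EuclideanSpace ℝ (Fin d), ρ ≤ ‖u‖ → ρ ≤ ‖v‖ →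
    |avgKernel d s e u - avgKernel d s e v| ≤ C * ρ ^ (-s - α) * ‖u - v‖ ^ α
  lower : ∀ ρ, 4 * e ≤ ρ → ∀ u : EuclideanSpace ℝ (Fin d), ρ / 4 ≤ u 0 → ‖u‖ ≤ 2 * ρ →
    c * ρ ^ (-s) ≤ avgKernel d s e u
  near : ∀ u : EuclideanSpace ℝ (Fin d), ‖u‖ ≤ e / 8 →
    |avgKernel d s e u| ≤ C * e ^ (-s - α) * ‖u‖ ^ α

namespace IsRieszBlock

variable {Ω : Type} [Fintype Ω] [DecidableEq Ω] {α D c₀ q e : ℝ} {H : ℝ → ℝ} {r m : ℝ}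
  {p : Ω → EuclideanSpace ℝ (Fin d)} {f : Ω → ℝ} {w S a X b : ℝ}
  (hB : IsRieszBlock s α D c₀ q e H r m p f w S a X b)

include hB

lemma norm_le (ω : Ω) : ‖p ω‖ ≤ r := by linarith [hB.norm_add_le ω, hB.e_pos]

lemma norm_sub_le (ω ω' : Ω) : ‖p ω - p ω'‖ ≤ 2 * r := by
  have := _root_.norm_sub_le (p ω) (p ω')
  linarith [hB.norm_le ω, hB.norm_le ω']

lemma card_pos : 0 < (Fintype.card Ω : ℝ) := by
  have h1 := hB.mass
  have h2 := hB.m_pos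
  have h3 := hB.w_pos
  rw [← h1] at h2
  exact pos_of_mul_pos_right h2 h3.le

lemma nonempty : Nonempty Ω := by
  have := hB.card_pos
  exact Fintype.card_pos_iff.1 (by exact_mod_cast this)

lemma e_le : e ≤ r := by
  obtain ⟨ω⟩ := hB.nonempty
  linarith [hB.norm_add_le ω, norm_nonneg (p ω)]

lemma r_pos : 0 < r := hB.e_pos.trans_le hB.e_le

lemma half_norm_le {y : EuclideanSpace ℝ (Fin d)} (hy : 10 * r ≤ ‖y‖) (ω ω' : Ω) :
    ‖y‖ / 2 ≤ ‖y + p ω - p ω'‖ := by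
  have h1 : ‖y‖ ≤ ‖y + p ω - p ω'‖ + ‖p ω - p ω'‖ := by
    calc ‖y‖ = ‖(y + p ω - p ω') - (p ω - p ω')‖ := by congr 1; abel
      _ ≤ _ := _root_.norm_sub_le _ _
  linarith [hB.norm_sub_le ω ω', norm_nonneg y]

/-- Size of the unit field of a distant block. -/
lemma abs_blockField_one_le {Ck ck : ℝ} (hk : KernelBound d s α Ck ck e)
    {y : EuclideanSpace ℝ (Fin d)} (hy : 10 * r ≤ ‖y‖) (ω : Ω) :
    |blockField s e w p 1 (y + p ω)| ≤ m * (Ck * (‖y‖ / 2) ^ (-s)) := by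
  unfold blockField
  have he := hB.e_le
  rw [abs_mul, abs_of_pos hB.w_pos, ← hB.mass, mul_assoc]
  refine mul_le_mul_of_nonneg_left ?_ hB.w_pos.le
  refine (Finset.abs_sum_le_sum_abs _ _).trans ?_
  rw [← nsmul_eq_mul, ← Finset.card_univ, ← Finset.sum_const]
  refine Finset.sum_le_sum fun ω' _ => ?_
  simp only [Pi.one_apply, one_mul]
  exact hk.size _ (by linarith [hB.r_pos]) _ (hB.half_norm_le hy _ _)

/-- Regularity of the unit field of a distant block. -/
lemma abs_blockField_one_sub_le {Ck ck : ℝ} (hk : KernelBound d s α Ck ck e)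
    {y : EuclideanSpace ℝ (Fin d)} (hy : 10 * r ≤ ‖y‖) (ω₁ ω₂ : Ω) :
    |blockField s e w p 1 (y + p ω₁) - blockField s e w p 1 (y + p ω₂)|
      ≤ m * (Ck * (‖y‖ / 2) ^ (-s - α) * ‖p ω₁ - p ω₂‖ ^ α) := by
  unfold blockField
  have he := hB.e_le
  rw [← mul_sub, ← Finset.sum_sub_distrib, abs_mul, abs_of_pos hB.w_pos, ← hB.mass, mul_assoc]
  refine mul_le_mul_of_nonneg_left ?_ hB.w_pos.le
  refine (Finset.abs_sum_le_sum_abs _ _).trans ?_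
  rw [← nsmul_eq_mul, ← Finset.card_univ, ← Finset.sum_const]
  refine Finset.sum_le_sum fun ω' _ => ?_
  simp only [Pi.one_apply, one_mul]
  have := hk.holder (‖y‖ / 2) (by linarith [hB.r_pos]) _ _ (hB.half_norm_le hy ω₁ ω')
    (hB.half_norm_le hy ω₂ ω')
  rwa [show y + p ω₁ - p ω' - (y + p ω₂ - p ω') = p ω₁ - p ω₂ by abel] at this

/-- Size of the signed field of a distant block. -/
lemma abs_blockField_le {Ck ck : ℝ} (hk : KernelBound d s α Ck ck e)
    {y : EuclideanSpace ℝ (Fin d)} (hy : 10 * r ≤ ‖y‖) (ω : Ω) :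
    |blockField s e w p f (y + p ω)| ≤ m * (2 * (Ck * (‖y‖ / 2) ^ (-s - α)) * a * r ^ α) := by
  unfold blockField
  have he := hB.e_le
  rw [abs_mul, abs_of_pos hB.w_pos, ← hB.mass, mul_assoc]
  refine mul_le_mul_of_nonneg_left ?_ hB.w_pos.le
  refine hB.f_test _ _ (by have := hk.C_pos; positivity) fun ω₁ ω₂ => ?_
  have := hk.holder (‖y‖ / 2) (by linarith [hB.r_pos]) _ _ (hB.half_norm_le hy ω ω₁)
    (hB.half_norm_le hy ω ω₂)
  rwa [show y + p ω - p ω₁ - (y + p ω - p ω₂) = p ω₂ - p ω₁ by abel, norm_sub_rev (p ω₂)] at this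

end IsRieszBlock

end Block

section Extension

variable {d : ℕ} [NeZero d] {s : ℝ}

/-- Two clusters of `M` disjoint cells of radius `r'` inside the ball of radius `r`. -/
structure IsCellLayout (β C r r' : ℝ) {M : ℕ} (u : Bool × Fin M → EuclideanSpace ℝ (Fin d)) :
    Prop where
  norm_add_le : ∀ i, ‖u i‖ + r' ≤ r
  le_eighth : r' ≤ r / 8
  gap : ∀ i j, i ≠ j → 10 * r' ≤ ‖u i - u j‖
  row : ∀ i, ∑ j ∈ Finset.univ.erase i, ‖u i - u j‖ ^ (-β) ≤ C * (2 * M) * r ^ (-β)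
  coord : ∀ i j, r / 2 ≤ (u (false, i) - u (true, j)) 0
  count : ∀ (t : Finset (Bool × Fin M)) (y : EuclideanSpace ℝ (Fin d)) (R : ℝ), 0 ≤ R →
    (∀ i ∈ t, ‖u i - y‖ ≤ R) → (t.card : ℝ) ≤ C * (1 + 2 * M * (R / r) ^ d)

lemma IsCellConfig.isCellLayout {β K C r r' : ℝ} {M : ℕ}
    {v : Bool × Fin M → EuclideanSpace ℝ (Fin d)} (hv : IsCellConfig β K C v) (hr : 0 < r)
    (hr' : 0 < r') (h8 : r' ≤ r / 8) (hM : 2 * M * K * r' ^ d ≤ r ^ d) :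
    IsCellLayout β C r r' (fun i => r • v i) := by
  have hsub : ∀ i j, ‖r • v i - r • v j‖ = r * ‖v i - v j‖ := fun i j => by
    rw [← smul_sub, norm_smul, Real.norm_of_nonneg hr.le]
  refine ⟨?_, h8, ?_, ?_, ?_, ?_⟩
  · intro i
    rw [norm_smul, Real.norm_of_nonneg hr.le]
    nlinarith [hv.norm_le i]
  · intro i j hij
    have h1 := hv.sep (r' / r) (by positivity) (by
      rw [div_pow, ← mul_div_assoc, div_le_one (by positivity)]; exact hM) i j hij
    rw [hsub]
    calc 10 * r' = r * (10 * (r' / r)) := by field_simp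
      _ ≤ _ := by gcongr
  · intro i
    simp only [hsub]
    simp only [Real.mul_rpow hr.le (norm_nonneg _)]
    rw [← Finset.mul_sum, mul_comm]
    exact mul_le_mul_of_nonneg_right (hv.row i) (by positivity)
  · intro i j
    have := hv.coord i j
    rw [← smul_sub, PiLp.smul_apply, smul_eq_mul]
    nlinarith
  · intro t y R hR ht
    refine hv.count t (r⁻¹ • y) (R / r) (by positivity) fun i hi => ?_
    have h1 : r • v i - y = r • (v i - r⁻¹ • y) := by
      rw [smul_sub, smul_inv_smul₀ hr.ne']
    have h2 := ht i hi
    rw [h1, norm_smul, Real.norm_of_nonneg hr.le] at h2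
    rwa [le_div_iff₀ hr, mul_comm]

/-- The points of a configuration made of translated copies of `p`. -/
def extPoint {M : ℕ} {Ω : Type} (u : Bool × Fin M → EuclideanSpace ℝ (Fin d))
    (p : Ω → EuclideanSpace ℝ (Fin d)) (z : (Bool × Fin M) × Ω) : EuclideanSpace ℝ (Fin d) :=
  u z.1 + p z.2

/-- The charge of a configuration made of copies of `f`. -/
def extCharge {M : ℕ} {Ω : Type} (θ : ℝ) (f : Ω → ℝ) (z : (Bool × Fin M) × Ω) : ℝ :=
  θ * cellSign z.1 + f z.2

lemma blockField_extPoint {M : ℕ} {Ω : Type} [Fintype Ω] (e w : ℝ)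
    (u : Bool × Fin M → EuclideanSpace ℝ (Fin d)) (p : Ω → EuclideanSpace ℝ (Fin d))
    (g : (Bool × Fin M) × Ω → ℝ) (v : Bool × Fin M) (ω : Ω) :
    blockField s e w (extPoint u p) g (extPoint u p (v, ω))
      = blockField s e w p (fun ω' => g (v, ω')) (p ω) + ∑ v' ∈ Finset.univ.erase v,
        blockField s e w p (fun ω' => g (v', ω')) (u v - u v' + p ω) := by
  have h : blockField s e w (extPoint u p) g (extPoint u p (v, ω))
      = ∑ v', blockField s e w p (fun ω' => g (v', ω')) (u v - u v' + p ω) := by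
    unfold blockField extPoint
    rw [Fintype.sum_prod_type, Finset.mul_sum]
    refine Finset.sum_congr rfl fun v' _ => ?_
    congr 1
    refine Finset.sum_congr rfl fun ω' _ => ?_
    congr 2
    abel
  rw [h, ← Finset.add_sum_erase _ _ (Finset.mem_univ v), sub_self, zero_add]

lemma blockField_const_add {Ω : Type} [Fintype Ω] (e w c : ℝ) (p : Ω → EuclideanSpace ℝ (Fin d))
    (f : Ω → ℝ) (x : EuclideanSpace ℝ (Fin d)) :
    blockField s e w p (fun ω => c + f ω) x
      = c * blockField s e w p 1 x + blockField s e w p f x := by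
  unfold blockField
  simp only [Pi.one_apply, one_mul, add_mul, Finset.sum_add_distrib, ← Finset.mul_sum]
  ring

lemma card_cells {M : ℕ} {Ω : Type} [Fintype Ω] :
    (Fintype.card ((Bool × Fin M) × Ω) : ℝ) = 2 * M * Fintype.card Ω := by
  simp

namespace IsCellLayout

variable {α C r r' : ℝ} {M : ℕ} {u : Bool × Fin M → EuclideanSpace ℝ (Fin d)}
  (hu : IsCellLayout (s + α) C r r' u)

include hu

lemma norm_sub_le (hr' : 0 < r') (i j : Bool × Fin M) : ‖u i - u j‖ ≤ 2 * r := by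
  have := _root_.norm_sub_le (u i) (u j)
  linarith [hu.norm_add_le i, hu.norm_add_le j]

lemma row_half (hr' : 0 < r') {m : ℝ} (hm : 0 < m) (hM : 0 < M) (i : Bool × Fin M) :
    ∑ j ∈ Finset.univ.erase i, m / (2 * M) * (‖u i - u j‖ / 2) ^ (-s - α)
      ≤ 2 ^ (s + α) * C * (m * r ^ (-s)) * r ^ (-α) := by
  have hr : 0 < r := by linarith [hu.le_eighth]
  have hM0 : (0 : ℝ) < M := by exact_mod_cast hM
  have h1 : ∀ j, (‖u i - u j‖ / 2) ^ (-s - α) = 2 ^ (s + α) * ‖u i - u j‖ ^ (-(s + α)) := by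
    intro j
    rw [Real.div_rpow (norm_nonneg _) (by norm_num), show -s - α = -(s + α) by ring,
      Real.rpow_neg (by norm_num : (0 : ℝ) ≤ 2)]
    field_simp
  simp only [h1]
  rw [← Finset.mul_sum, ← Finset.mul_sum]
  have h2 : r ^ (-(s + α)) = r ^ (-s) * r ^ (-α) := by
    rw [← Real.rpow_add hr]; congr 1; ring
  calc _ ≤ m / (2 * M) * (2 ^ (s + α) * (C * (2 * M) * r ^ (-(s + α)))) := by
        gcongr; exact hu.row i
    _ = _ := by rw [h2]; field_simp

lemma row_half' (hr' : 0 < r') (hα : 0 ≤ α) {m : ℝ} (hm : 0 < m) (hM : 0 < M)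
    (i : Bool × Fin M) :
    ∑ j ∈ Finset.univ.erase i, m / (2 * M) * (‖u i - u j‖ / 2) ^ (-s)
      ≤ 2 ^ (s + α) * C * (m * r ^ (-s)) := by
  have hr : 0 < r := by linarith [hu.le_eighth]
  have hM0 : (0 : ℝ) < M := by exact_mod_cast hM
  calc _ ≤ ∑ j ∈ Finset.univ.erase i, m / (2 * M) * (‖u i - u j‖ / 2) ^ (-s - α) * r ^ α := by
        refine Finset.sum_le_sum fun j hj => ?_
        have hgap := hu.gap i j (Finset.ne_of_mem_erase hj).symm
        have h0 : 0 < ‖u i - u j‖ / 2 := by linarith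
        have h1 : (‖u i - u j‖ / 2) ^ (-s)
            = (‖u i - u j‖ / 2) ^ (-s - α) * (‖u i - u j‖ / 2) ^ α := by
          rw [← Real.rpow_add h0]; congr 1; ring
        rw [h1, ← mul_assoc]
        gcongr
        linarith [hu.norm_sub_le hr' i j]
    _ ≤ 2 ^ (s + α) * C * (m * r ^ (-s)) * r ^ (-α) * r ^ α := by
        rw [← Finset.sum_mul]
        exact mul_le_mul_of_nonneg_right (hu.row_half hr' hm hM i) (by positivity)
    _ = _ := by
        rw [mul_assoc, ← Real.rpow_add hr]; simp

end IsCellLayout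

section

variable {Ω : Type} [Fintype Ω] [DecidableEq Ω] {α D c₀ q e : ℝ} {H : ℝ → ℝ} {r r' m : ℝ}
  {p : Ω → EuclideanSpace ℝ (Fin d)} {f : Ω → ℝ} {w S a X b C Ck ck : ℝ} {M : ℕ}
  {u : Bool × Fin M → EuclideanSpace ℝ (Fin d)}

/-- The unit field generated in the cell `v` by the other cells. -/
def outerUnit (s e w : ℝ) (u : Bool × Fin M → EuclideanSpace ℝ (Fin d))
    (p : Ω → EuclideanSpace ℝ (Fin d)) (v : Bool × Fin M) (ω : Ω) : ℝ :=
  ∑ z ∈ Finset.univ.erase v, blockField s e w p 1 (u v - u z + p ω)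

/-- The signed unit field generated in the cell `v` by the other cells. -/
def outerSigned (s e w : ℝ) (u : Bool × Fin M → EuclideanSpace ℝ (Fin d))
    (p : Ω → EuclideanSpace ℝ (Fin d)) (v : Bool × Fin M) (ω : Ω) : ℝ :=
  ∑ z ∈ Finset.univ.erase v, cellSign z * blockField s e w p 1 (u v - u z + p ω)

/-- The field generated in the cell `v` by the inner charges of the other cells. -/
def outerField (s e w : ℝ) (u : Bool × Fin M → EuclideanSpace ℝ (Fin d))
    (p : Ω → EuclideanSpace ℝ (Fin d)) (f : Ω → ℝ) (v : Bool × Fin M) (ω : Ω) : ℝ :=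
  ∑ v' ∈ Finset.univ.erase v, blockField s e w p f (u v - u v' + p ω)

lemma blockField_ext_one (v : Bool × Fin M) (ω : Ω) :
    blockField s e w (extPoint u p) 1 (extPoint u p (v, ω))
      = blockField s e w p 1 (p ω) + outerUnit s e w u p v ω :=
  blockField_extPoint e w u p 1 v ω

lemma blockField_extCharge (θ : ℝ) (v : Bool × Fin M) (ω : Ω) :
    blockField s e w (extPoint u p) (extCharge θ f) (extPoint u p (v, ω))
      = blockField s e w p f (p ω) + θ * cellSign v * blockField s e w p 1 (p ω)
        + (θ * outerSigned s e w u p v ω + outerField s e w u p f v ω) := by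
  rw [blockField_extPoint]
  simp only [extCharge, blockField_const_add, Finset.sum_add_distrib, mul_assoc]
  rw [← Finset.mul_sum, outerSigned, outerField]
  ring

variable (hB : IsRieszBlock s α D c₀ q e H r' (m / (2 * M)) p f w S a X b)
  (hu : IsCellLayout (s + α) C r r' u) (hk : KernelBound d s α Ck ck e)
  (hM : 0 < M) (hm : 0 < m) (hα : 0 < α) (hD : 2 * (Ck * (2 ^ (s + α) * C)) ≤ D)

include hB hu hk hM hm hα hD

lemma outer_row (v : Bool × Fin M) :
    ∑ v' ∈ Finset.univ.erase v, m / (2 * M) * (Ck * (‖u v - u v'‖ / 2) ^ (-s))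
      ≤ D / 2 * (m * r ^ (-s)) := by
  have hr : 0 < r := by linarith [hu.le_eighth, hB.r_pos]
  calc _ = Ck * ∑ v' ∈ Finset.univ.erase v, m / (2 * M) * (‖u v - u v'‖ / 2) ^ (-s) := by
        rw [Finset.mul_sum]; exact Finset.sum_congr rfl fun _ _ => by ring
    _ ≤ Ck * (2 ^ (s + α) * C * (m * r ^ (-s))) :=
        mul_le_mul_of_nonneg_left (hu.row_half' hB.r_pos hα.le hm hM v) hk.C_pos.le
    _ = (Ck * (2 ^ (s + α) * C)) * (m * r ^ (-s)) := by ring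
    _ ≤ _ := by gcongr; linarith

lemma outer_row_holder (v : Bool × Fin M) :
    ∑ v' ∈ Finset.univ.erase v, m / (2 * M) * (Ck * (‖u v - u v'‖ / 2) ^ (-s - α))
      ≤ D / 2 * (m * r ^ (-s)) * r ^ (-α) := by
  have hr : 0 < r := by linarith [hu.le_eighth, hB.r_pos]
  calc _ = Ck * ∑ v' ∈ Finset.univ.erase v, m / (2 * M) * (‖u v - u v'‖ / 2) ^ (-s - α) := by
        rw [Finset.mul_sum]; exact Finset.sum_congr rfl fun _ _ => by ring
    _ ≤ Ck * (2 ^ (s + α) * C * (m * r ^ (-s)) * r ^ (-α)) :=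
        mul_le_mul_of_nonneg_left (hu.row_half hB.r_pos hm hM v) hk.C_pos.le
    _ = (Ck * (2 ^ (s + α) * C)) * (m * r ^ (-s)) * r ^ (-α) := by ring
    _ ≤ _ := by gcongr; linarith

lemma D_pos_of_outer : 0 ≤ D := by
  have hr : 0 < r := by linarith [hu.le_eighth, hB.r_pos]
  have h1 := outer_row hB hu hk hM hm hα hD (true, ⟨0, hM⟩)
  have h2 : 0 ≤ D / 2 * (m * r ^ (-s)) := by
    refine le_trans (Finset.sum_nonneg fun v' _ => ?_) h1
    have := hk.C_pos
    positivity
  have h3 : 0 < m * r ^ (-s) := by positivity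
  have := nonneg_of_mul_nonneg_left h2 h3
  linarith

lemma abs_outerUnit_le (v : Bool × Fin M) (ω : Ω) :
    |outerUnit s e w u p v ω| ≤ D * (m * r ^ (-s)) := by
  have hr : 0 < r := by linarith [hu.le_eighth, hB.r_pos]
  have hD0 := D_pos_of_outer hB hu hk hM hm hα hD
  refine (Finset.abs_sum_le_sum_abs _ _).trans ?_
  refine (Finset.sum_le_sum fun v' hv' => hB.abs_blockField_one_le hk
    (hu.gap v v' (Finset.ne_of_mem_erase hv').symm) ω).trans ?_
  refine (outer_row hB hu hk hM hm hα hD v).trans ?_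
  gcongr
  linarith

lemma abs_outerSigned_le (v : Bool × Fin M) (ω : Ω) :
    |outerSigned s e w u p v ω| ≤ D * (m * r ^ (-s)) := by
  have hr : 0 < r := by linarith [hu.le_eighth, hB.r_pos]
  have hD0 := D_pos_of_outer hB hu hk hM hm hα hD
  refine (Finset.abs_sum_le_sum_abs _ _).trans ?_
  simp only [abs_mul, abs_cellSign, one_mul]
  refine (Finset.sum_le_sum fun v' hv' => hB.abs_blockField_one_le hk
    (hu.gap v v' (Finset.ne_of_mem_erase hv').symm) ω).trans ?_
  refine (outer_row hB hu hk hM hm hα hD v).trans ?_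
  gcongr
  linarith

lemma abs_outerUnit_sub_le (v : Bool × Fin M) (ω₁ ω₂ : Ω) :
    |outerUnit s e w u p v ω₁ - outerUnit s e w u p v ω₂|
      ≤ D * (m * r ^ (-s)) * r ^ (-α) * ‖p ω₁ - p ω₂‖ ^ α := by
  have hr : 0 < r := by linarith [hu.le_eighth, hB.r_pos]
  have hD0 := D_pos_of_outer hB hu hk hM hm hα hD
  unfold outerUnit
  rw [← Finset.sum_sub_distrib]
  refine (Finset.abs_sum_le_sum_abs _ _).trans ?_
  refine (Finset.sum_le_sum fun v' hv' => hB.abs_blockField_one_sub_le hk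
    (hu.gap v v' (Finset.ne_of_mem_erase hv').symm) ω₁ ω₂).trans ?_
  simp only [← mul_assoc]
  rw [← Finset.sum_mul]
  gcongr
  have := outer_row_holder hB hu hk hM hm hα hD v
  simp only [← mul_assoc] at this
  refine this.trans ?_
  gcongr
  linarith

lemma abs_outerField_le (v : Bool × Fin M) (ω : Ω) :
    |outerField s e w u p f v ω| ≤ D * (m * r ^ (-s)) * ((r' / r) ^ α * a) := by
  have hr' := hB.r_pos
  have hr : 0 < r := by linarith [hu.le_eighth]
  have ha := hB.a_nonneg
  refine (Finset.abs_sum_le_sum_abs _ _).trans ?_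
  refine (Finset.sum_le_sum fun v' hv' => hB.abs_blockField_le hk
    (hu.gap v v' (Finset.ne_of_mem_erase hv').symm) ω).trans ?_
  calc _ = (2 * a * r' ^ α) * ∑ v' ∈ Finset.univ.erase v,
        m / (2 * M) * (Ck * (‖u v - u v'‖ / 2) ^ (-s - α)) := by
        rw [Finset.mul_sum]; exact Finset.sum_congr rfl fun _ _ => by ring
    _ ≤ (2 * a * r' ^ α) * (D / 2 * (m * r ^ (-s)) * r ^ (-α)) :=
        mul_le_mul_of_nonneg_left (outer_row_holder hB hu hk hM hm hα hD v) (by positivity)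
    _ = _ := by
        rw [Real.div_rpow hr'.le hr.le, Real.rpow_neg hr.le α]; field_simp

end

end Extension

section ExtensionStep

variable {d : ℕ} [NeZero d] {s : ℝ}

lemma sum_one_add_sq {Ω : Type} [Fintype Ω] {M : ℕ} (A : Ω → ℝ) (B : Bool × Fin M → Ω → ℝ) :
    ∑ z : (Bool × Fin M) × Ω, (A z.2 + B z.1 z.2) ^ 2
      = 2 * M * ∑ ω, A ω ^ 2 + 2 * ∑ v, ∑ ω, A ω * B v ω + ∑ v, ∑ ω, B v ω ^ 2 := by
  rw [Fintype.sum_prod_type]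
  simp only [add_sq, Finset.sum_add_distrib, Finset.sum_const, Finset.card_univ,
    Fintype.card_prod, Fintype.card_bool, Fintype.card_fin, nsmul_eq_mul, Nat.cast_mul,
    Finset.mul_sum, mul_assoc]
  norm_num

/-- Testing a bounded function of mean zero against a function of small oscillation. -/
lemma abs_sum_mul_le_of_sum_eq_zero {ι : Type*} [Fintype ι] {Y ψ : ι → ℝ} {y o : ℝ}
    (hY0 : ∑ z, Y z = 0) (hY : ∀ z, |Y z| ≤ y) (hψ : ∀ z z', |ψ z - ψ z'| ≤ o) :
    |∑ z, Y z * ψ z| ≤ Fintype.card ι * (y * o) := by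
  rcases isEmpty_or_nonempty ι with h | ⟨⟨z₀⟩⟩
  · simp
  have h1 : ∑ z, Y z * ψ z = ∑ z, Y z * (ψ z - ψ z₀) := by
    simp only [mul_sub, Finset.sum_sub_distrib, ← Finset.sum_mul, hY0, zero_mul, sub_zero]
  rw [h1]
  refine (Finset.abs_sum_le_sum_abs _ _).trans ?_
  rw [← nsmul_eq_mul, ← Finset.card_univ, ← Finset.sum_const]
  refine Finset.sum_le_sum fun z _ => ?_
  rw [abs_mul]
  exact mul_le_mul (hY z) (hψ z z₀) (abs_nonneg _) ((abs_nonneg _).trans (hY z))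

section

variable {Ω : Type} [Fintype Ω] [DecidableEq Ω] {α D c₀ q e : ℝ} {H : ℝ → ℝ} {r r' m : ℝ}
  {p : Ω → EuclideanSpace ℝ (Fin d)} {f : Ω → ℝ} {w S a X b C Ck ck : ℝ} {M : ℕ}
  {u : Bool × Fin M → EuclideanSpace ℝ (Fin d)}

/-- The total unit field generated by one cell on another one. -/
def cellForce (s e w : ℝ) (u : Bool × Fin M → EuclideanSpace ℝ (Fin d))
    (p : Ω → EuclideanSpace ℝ (Fin d)) (v v' : Bool × Fin M) : ℝ :=
  ∑ ω, blockField s e w p 1 (u v - u v' + p ω)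

lemma cellForce_swap (v v' : Bool × Fin M) :
    cellForce s e w u p v v' = -cellForce s e w u p v' v := by
  unfold cellForce blockField
  simp only [Pi.one_apply, one_mul]
  rw [← Finset.mul_sum, ← Finset.mul_sum, ← mul_neg, ← Finset.sum_neg_distrib]
  congr 1
  rw [Finset.sum_comm]
  refine Finset.sum_congr rfl fun ω _ => ?_
  rw [← Finset.sum_neg_distrib]
  refine Finset.sum_congr rfl fun ω' _ => ?_
  rw [← avgKernel_neg]
  congr 1
  abel

lemma cellForce_self (v : Bool × Fin M) : cellForce s e w u p v v = 0 := by
  have := cellForce_swap (s := s) (e := e) (w := w) (u := u) (p := p) v v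
  linarith

lemma sum_outerSigned :
    ∑ v, ∑ ω, outerSigned s e w u p v ω
      = 2 * ∑ i, ∑ j, cellForce s e w u p (false, i) (true, j) := by
  have h1 : ∑ v, ∑ ω, outerSigned s e w u p v ω
      = ∑ v, ∑ v', cellSign v' * cellForce s e w u p v v' := by
    refine Finset.sum_congr rfl fun v _ => ?_
    unfold outerSigned
    rw [Finset.sum_comm, ← Finset.add_sum_erase _ _ (Finset.mem_univ v), cellForce_self, mul_zero,
      zero_add]
    exact Finset.sum_congr rfl fun v' _ => by rw [cellForce, Finset.mul_sum]
  have h2 : ∀ b : Bool, ∑ i : Fin M, ∑ j : Fin M, cellForce s e w u p (b, i) (b, j) = 0 := by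
    intro b
    have : ∑ i : Fin M, ∑ j : Fin M, cellForce s e w u p (b, i) (b, j)
        = -∑ i : Fin M, ∑ j : Fin M, cellForce s e w u p (b, i) (b, j) := by
      conv_lhs => rw [Finset.sum_comm]
      simp only [← Finset.sum_neg_distrib]
      exact Finset.sum_congr rfl fun i _ => Finset.sum_congr rfl fun j _ => cellForce_swap _ _
    linarith
  have h3 : ∑ i : Fin M, ∑ j : Fin M, cellForce s e w u p (true, i) (false, j)
      = -∑ i : Fin M, ∑ j : Fin M, cellForce s e w u p (false, i) (true, j) := by
    rw [Finset.sum_comm]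
    simp only [← Finset.sum_neg_distrib]
    exact Finset.sum_congr rfl fun i _ => Finset.sum_congr rfl fun j _ => cellForce_swap _ _
  rw [h1, Fintype.sum_prod_type]
  simp only [Fintype.sum_prod_type, Fintype.sum_bool, cellSign, Finset.sum_add_distrib]
  simp only [if_true, Bool.false_eq_true, if_false, one_mul, neg_mul,
    Finset.sum_neg_distrib, h2, h3]
  ring

variable (hB : IsRieszBlock s α D c₀ q e H r' (m / (2 * M)) p f w S a X b)
  (hu : IsCellLayout (s + α) C r r' u)

include hB hu

lemma norm_extPoint_le (z : (Bool × Fin M) × Ω) : ‖extPoint u p z‖ + e ≤ r := by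
  have h1 := norm_add_le (u z.1) (p z.2)
  unfold extPoint
  linarith [hu.norm_add_le z.1, hB.norm_add_le z.2]

lemma norm_extPoint_sub_le (z z' : (Bool × Fin M) × Ω) :
    ‖extPoint u p z - extPoint u p z'‖ ≤ 2 * r := by
  have := norm_sub_le (extPoint u p z) (extPoint u p z')
  linarith [norm_extPoint_le hB hu z, norm_extPoint_le hB hu z', hB.e_pos]

lemma extPoint_sep (z z' : (Bool × Fin M) × Ω) (h : z ≠ z') :
    8 * e ≤ ‖extPoint u p z - extPoint u p z'‖ := by
  obtain ⟨v, ω⟩ := z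
  obtain ⟨v', ω'⟩ := z'
  by_cases hv : v = v'
  · subst hv
    have : ω ≠ ω' := fun h' => h (by rw [h'])
    simpa [extPoint] using hB.sep ω ω' this
  · have h1 := hu.gap v v' hv
    have h2 : ‖u v - u v'‖ ≤ ‖extPoint u p (v, ω) - extPoint u p (v', ω')‖ + ‖p ω - p ω'‖ := by
      calc ‖u v - u v'‖ = ‖(extPoint u p (v, ω) - extPoint u p (v', ω')) - (p ω - p ω')‖ := by
            unfold extPoint; congr 1; abel
        _ ≤ _ := norm_sub_le _ _
    linarith [hB.norm_sub_le ω ω', hB.e_le]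

lemma extPoint_count (hM : 0 < M)
    (hH : ∀ R, r' ≤ R → R ≤ r → C * (m / (2 * M) + 2 ^ d * m * (R / r) ^ d) ≤ H R)
    (hH' : ∀ R, r ≤ R → m ≤ H R) (t : Finset ((Bool × Fin M) × Ω))
    (x : EuclideanSpace ℝ (Fin d)) (R : ℝ) (hR : e ≤ R)
    (ht : ∀ z ∈ t, ‖extPoint u p z - x‖ ≤ R) : w * t.card ≤ H R := by
  have hr' := hB.r_pos
  have hr : 0 < r := by linarith [hu.le_eighth]
  have hM0 : (0 : ℝ) < M := by exact_mod_cast hM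
  have hw := hB.w_pos
  have hmass : w * (2 * M * Fintype.card Ω) = m := by
    have := hB.mass
    field_simp at this
    linarith
  have hcell : ∀ z ∈ t, ‖u z.1 - x‖ ≤ R + r' := by
    intro z hz
    have h1 : ‖u z.1 - x‖ ≤ ‖extPoint u p z - x‖ + ‖p z.2‖ := by
      calc ‖u z.1 - x‖ = ‖(extPoint u p z - x) - p z.2‖ := by unfold extPoint; congr 1; abel
        _ ≤ _ := norm_sub_le _ _
    linarith [ht z hz, hB.norm_le z.2]
  rcases lt_or_ge R r' with h1 | h1
  · rcases t.eq_empty_or_nonempty with rfl | ⟨z₀, hz₀⟩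
    · have := hB.count ∅ 0 R hR (by simp)
      simpa using this
    have hfst : ∀ z ∈ t, z.1 = z₀.1 := by
      intro z hz
      by_contra hne
      have h2 := hu.gap _ _ hne
      have h3 := norm_sub_le (u z.1 - x) (u z₀.1 - x)
      rw [sub_sub_sub_cancel_right] at h3
      linarith [hcell z hz, hcell z₀ hz₀]
    have hinj : Set.InjOn Prod.snd (t : Set ((Bool × Fin M) × Ω)) := by
      intro z hz z' hz' h
      exact Prod.ext ((hfst z hz).trans (hfst z' hz').symm) h
    have h4 := hB.count (t.image Prod.snd) (x - u z₀.1) R hR (by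
      intro ω hω
      obtain ⟨z, hz, rfl⟩ := Finset.mem_image.1 hω
      have h5 := ht z hz
      rw [extPoint, hfst z hz] at h5
      rwa [show p z.2 - (x - u z₀.1) = u z₀.1 + p z.2 - x by abel])
    rwa [Finset.card_image_of_injOn hinj] at h4
  rcases le_or_gt R r with h2 | h2
  · refine le_trans ?_ (hH R h1 h2)
    have h3 := hu.count (t.image Prod.fst) x (2 * R) (by linarith) (by
      intro v hv
      obtain ⟨z, hz, rfl⟩ := Finset.mem_image.1 hv
      linarith [hcell z hz])
    have h4 : (t.card : ℝ) ≤ (t.image Prod.fst).card * Fintype.card Ω := by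
      have : t ⊆ (t.image Prod.fst) ×ˢ Finset.univ := fun z hz =>
        Finset.mem_product.2 ⟨Finset.mem_image_of_mem _ hz, Finset.mem_univ _⟩
      have := Finset.card_le_card this
      rw [Finset.card_product, Finset.card_univ] at this
      exact_mod_cast this
    calc w * t.card ≤ w * ((C * (1 + 2 * M * (2 * R / r) ^ d)) * Fintype.card Ω) := by
          gcongr
          exact h4.trans (by gcongr)
      _ = C * (m / (2 * M) + 2 ^ d * m * (R / r) ^ d) := by
          rw [← hmass, mul_div_assoc, mul_pow]; field_simp
  · refine le_trans ?_ (hH' R h2.le)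
    have h3 : (t.card : ℝ) ≤ 2 * M * Fintype.card Ω := by
      rw [← card_cells (M := M) (Ω := Ω)]
      exact_mod_cast Finset.card_le_univ t
    rw [← hmass]
    gcongr

lemma sum_outerSigned_ge (hk : KernelBound d s α Ck ck e) (hM : 0 < M) (hm : 0 < m) :
    2 * M * Fintype.card Ω * (ck / 2 * (m * r ^ (-s))) ≤ ∑ v, ∑ ω, outerSigned s e w u p v ω := by
  have hr' := hB.r_pos
  have h8 := hu.le_eighth
  have hr : 0 < r := by linarith
  have hM0 : (0 : ℝ) < M := by exact_mod_cast hM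
  have hw := hB.w_pos
  have he := hB.e_le
  rw [sum_outerSigned]
  have h1 : ∀ i j, Fintype.card Ω * (m / (2 * M) * (ck * r ^ (-s)))
      ≤ cellForce s e w u p (false, i) (true, j) := by
    intro i j
    unfold cellForce blockField
    rw [← nsmul_eq_mul, ← Finset.card_univ, ← Finset.sum_const]
    refine Finset.sum_le_sum fun ω _ => ?_
    rw [← hB.mass, mul_assoc]
    refine mul_le_mul_of_nonneg_left ?_ hw.le
    rw [← nsmul_eq_mul, ← Finset.card_univ, ← Finset.sum_const]
    refine Finset.sum_le_sum fun ω' _ => ?_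
    rw [Pi.one_apply, one_mul]
    apply hk.lower r (by linarith)
    · have h2 := hu.coord i j
      have h3 := abs_le.1 ((abs_coord_le_norm (p ω - p ω') 0).trans (hB.norm_sub_le ω ω'))
      simp only [PiLp.sub_apply, PiLp.add_apply] at h2 h3 ⊢
      linarith
    · have := norm_extPoint_sub_le hB hu ((false, i), ω) ((true, j), ω')
      unfold extPoint at this
      rwa [show u (false, i) + p ω - (u (true, j) + p ω') = u (false, i) - u (true, j) + p ω - p ω'
        by abel] at this
  calc _ = 2 * ∑ i : Fin M, ∑ j : Fin M, Fintype.card Ω * (m / (2 * M) * (ck * r ^ (-s))) := by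
        simp only [Finset.sum_const, Finset.card_univ, Fintype.card_fin, nsmul_eq_mul]
        field_simp
    _ ≤ _ := by
        gcongr with i _ j _
        exact h1 i j

lemma extPoint_row (hm : 0 < m) (hM : 0 < M) (hD : 2 ^ (s + α) * C ≤ D) (hs : 0 < s) (hα : 0 < α)
    (z : (Bool × Fin M) × Ω) :
    ∑ z' ∈ Finset.univ.erase z, w * ‖extPoint u p z - extPoint u p z'‖ ^ (-(s + α))
      ≤ D * (b + m * r ^ (-s) * (e / r) ^ α) * e ^ (-α) := by
  have hr' := hB.r_pos
  have h8 := hu.le_eighth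
  have hr : 0 < r := by linarith
  have he := hB.e_pos
  have hw := hB.w_pos
  obtain ⟨v, ω⟩ := z
  set g : (Bool × Fin M) → Ω → ℝ := fun v' ω' =>
    w * ‖extPoint u p (v, ω) - extPoint u p (v', ω')‖ ^ (-(s + α)) with hg
  have h0 : g v ω = 0 := by
    simp only [hg, sub_self, norm_zero]
    rw [Real.zero_rpow (by linarith), mul_zero]
  have h1 : ∑ z' ∈ Finset.univ.erase (v, ω), g z'.1 z'.2
      = ∑ ω' ∈ Finset.univ.erase ω, g v ω' + ∑ v' ∈ Finset.univ.erase v, ∑ ω', g v' ω' := by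
    have h2 : ∑ z' ∈ Finset.univ.erase (v, ω), g z'.1 z'.2 =
        ∑ z' : (Bool × Fin M) × Ω, g z'.1 z'.2 := by
      rw [← Finset.add_sum_erase _ _ (Finset.mem_univ (v, ω)), h0, zero_add]
    rw [h2, Fintype.sum_prod_type, ← Finset.add_sum_erase _ _ (Finset.mem_univ v),
      ← Finset.add_sum_erase _ _ (Finset.mem_univ ω), h0, zero_add]
  have h3 : ∑ ω' ∈ Finset.univ.erase ω, g v ω' ≤ D * b * e ^ (-α) := by
    have := hB.row ω
    simpa [hg, extPoint] using this
  have h4 : ∑ v' ∈ Finset.univ.erase v, ∑ ω', g v' ω' ≤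
      2 ^ (s + α) * C * (m * r ^ (-s)) * r ^ (-α) := by
    refine le_trans (Finset.sum_le_sum fun v' hv' => ?_) (hu.row_half hr' hm hM v)
    have hgap := hu.gap v v' (Finset.ne_of_mem_erase hv').symm
    rw [← hB.mass, mul_comm w, mul_assoc, ← nsmul_eq_mul, ← Finset.card_univ, ← Finset.sum_const]
    refine Finset.sum_le_sum fun ω' _ => ?_
    have h5 := hB.half_norm_le hgap ω ω'
    simp only [hg, extPoint]
    rw [show u v + p ω - (u v' + p ω') = u v - u v' + p ω - p ω' by abel,
      show -s - α = -(s + α) by ring]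
    exact mul_le_mul_of_nonneg_left
      (Real.rpow_le_rpow_of_nonpos (by linarith) h5 (by linarith)) hw.le
  have h6 : r ^ (-α) = (e / r) ^ α * e ^ (-α) := by
    rw [Real.div_rpow he.le hr.le, Real.rpow_neg he.le, Real.rpow_neg hr.le]
    have : e ^ α ≠ 0 := by positivity
    field_simp
  calc _ = ∑ z' ∈ Finset.univ.erase (v, ω), g z'.1 z'.2 := rfl
    _ ≤ D * b * e ^ (-α) + 2 ^ (s + α) * C * (m * r ^ (-s)) * r ^ (-α) := by rw [h1]; gcongr
    _ ≤ D * b * e ^ (-α) + D * (m * r ^ (-s)) * r ^ (-α) := by gcongr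
    _ = _ := by rw [h6]; ring

end

end ExtensionStep

section ExtensionBlock

variable {d : ℕ} [NeZero d] {s : ℝ} {Ω : Type} [Fintype Ω] [DecidableEq Ω] {α D c₀ q e : ℝ}
  {H : ℝ → ℝ} {r r' m : ℝ} {p : Ω → EuclideanSpace ℝ (Fin d)} {f : Ω → ℝ}
  {w S a X b C Ck ck : ℝ} {M : ℕ} {u : Bool × Fin M → EuclideanSpace ℝ (Fin d)}

lemma sum_extCharge_sq (θ : ℝ) (hf : ∑ ω, f ω = 0) :
    ∑ z, extCharge (M := M) θ f z ^ 2 = 2 * M * (Fintype.card Ω * θ ^ 2 + ∑ ω, f ω ^ 2) := by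
  have h := sum_one_add_sq f (fun (v : Bool × Fin M) (_ : Ω) => θ * cellSign v)
  simp only [← Finset.sum_mul, hf, zero_mul, mul_pow, cellSign_sq, Finset.sum_const,
    Finset.card_univ, Fintype.card_prod, Fintype.card_bool, Fintype.card_fin, nsmul_eq_mul] at h
  unfold extCharge
  simp only [add_comm (θ * _)]
  rw [h]
  push_cast
  ring

lemma sum_sign_mul (θ : ℝ) (g : Ω → ℝ) :
    ∑ z : (Bool × Fin M) × Ω, θ * cellSign z.1 * g z.2 = 0 := by
  rw [Fintype.sum_prod_type]
  simp only [← Finset.mul_sum]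
  rw [← Finset.sum_mul, ← Finset.mul_sum, sum_cellSign, mul_zero, zero_mul]

lemma sum_extCharge (θ : ℝ) (hf : ∑ ω, f ω = 0) : ∑ z, extCharge (M := M) θ f z = 0 := by
  have h1 := sum_sign_mul (M := M) θ (fun _ : Ω => (1 : ℝ))
  simp only [mul_one] at h1
  unfold extCharge
  rw [Finset.sum_add_distrib, h1, Fintype.sum_prod_type]
  simp [hf]

variable (hB : IsRieszBlock s α D c₀ q e H r' (m / (2 * M)) p f w S a X b)
  (hu : IsCellLayout (s + α) C r r' u) (hk : KernelBound d s α Ck ck e)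
  (hM : 0 < M) (hm : 0 < m) (hα : 0 < α) (hα1 : α ≤ 1)
  (hD : 2 * (Ck * (2 ^ (s + α) * C)) ≤ D)

include hB hu in
lemma osc_le_of_holder (hα : 0 < α) (hα1 : α ≤ 1) {ψ : (Bool × Fin M) × Ω → ℝ} {L : ℝ}
    (hL : 0 ≤ L)
    (hψ : ∀ z z', |ψ z - ψ z'| ≤ L * ‖extPoint u p z - extPoint u p z'‖ ^ α) (z z') :
    |ψ z - ψ z'| ≤ 2 * L * r ^ α := by
  have hr : 0 < r := by linarith [hu.le_eighth, hB.r_pos]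
  calc _ ≤ _ := hψ z z'
    _ ≤ L * (2 * r) ^ α := by
        gcongr
        exact norm_extPoint_sub_le hB hu z z'
    _ = L * (2 ^ α * r ^ α) := by rw [Real.mul_rpow (by norm_num) hr.le]
    _ ≤ L * (2 * r ^ α) := by
        gcongr
        calc (2 : ℝ) ^ α ≤ 2 ^ (1 : ℝ) := Real.rpow_le_rpow_of_exponent_le (by norm_num) hα1
          _ = 2 := Real.rpow_one 2
    _ = _ := by ring

include hB hu in
lemma extCharge_test (hα : 0 < α) (hα1 : α ≤ 1) {θ : ℝ} (hθ : 0 ≤ θ) (ψ : (Bool × Fin M) × Ω → ℝ)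
    (L : ℝ) (hL : 0 ≤ L)
    (hψ : ∀ z z', |ψ z - ψ z'| ≤ L * ‖extPoint u p z - extPoint u p z'‖ ^ α) :
    |∑ z, extCharge θ f z * ψ z|
      ≤ Fintype.card ((Bool × Fin M) × Ω) * (2 * L * (θ + (r' / r) ^ α * a) * r ^ α) := by
  have hr : 0 < r := by linarith [hu.le_eighth, hB.r_pos]
  have hr' := hB.r_pos
  have h1 : |∑ z : (Bool × Fin M) × Ω, θ * cellSign z.1 * ψ z|
      ≤ Fintype.card ((Bool × Fin M) × Ω) * (θ * (2 * L * r ^ α)) := by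
    refine abs_sum_mul_le_of_sum_eq_zero ?_ ?_ (osc_le_of_holder hB hu hα hα1 hL hψ)
    · simpa using sum_sign_mul (M := M) θ (fun _ : Ω => (1 : ℝ))
    · intro z
      rw [abs_mul, abs_cellSign, abs_of_nonneg hθ, mul_one]
  have h2 : |∑ z : (Bool × Fin M) × Ω, f z.2 * ψ z|
      ≤ Fintype.card ((Bool × Fin M) × Ω) * (2 * L * a * r' ^ α) := by
    rw [Fintype.sum_prod_type]
    refine (Finset.abs_sum_le_sum_abs _ _).trans ?_
    calc _ ≤ ∑ v : Bool × Fin M, Fintype.card Ω * (2 * L * a * r' ^ α) := by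
          refine Finset.sum_le_sum fun v _ => hB.f_test _ L hL fun ω ω' => ?_
          simpa [extPoint] using hψ (v, ω) (v, ω')
      _ = _ := by
          rw [card_cells, Finset.sum_const, Finset.card_univ, nsmul_eq_mul]
          simp only [Fintype.card_prod, Fintype.card_bool, Fintype.card_fin]
          push_cast; ring
  have h3 : ∑ z, extCharge θ f z * ψ z = ∑ z : (Bool × Fin M) × Ω, θ * cellSign z.1 * ψ z
      + ∑ z : (Bool × Fin M) × Ω, f z.2 * ψ z := by
    rw [← Finset.sum_add_distrib]
    exact Finset.sum_congr rfl fun z _ => by rw [extCharge, add_mul]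
  rw [h3]
  refine (abs_add_le _ _).trans ((add_le_add h1 h2).trans (le_of_eq ?_))
  rw [Real.div_rpow hr'.le hr.le]
  field_simp

include hB hu hk hM hm hα hα1 hD

lemma extUnit_test (ψ : (Bool × Fin M) × Ω → ℝ) (L : ℝ) (hL : 0 ≤ L)
    (hψ : ∀ z z', |ψ z - ψ z'| ≤ L * ‖extPoint u p z - extPoint u p z'‖ ^ α) :
    |∑ z, blockField s e w (extPoint u p) 1 (extPoint u p z) * ψ z|
      ≤ Fintype.card ((Bool × Fin M) × Ω)
        * (2 * D * L * (m * r ^ (-s) + (r' / r) ^ α * a) * r ^ α) := by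
  have hr : 0 < r := by linarith [hu.le_eighth, hB.r_pos]
  have hr' := hB.r_pos
  have hZ0 := sum_blockField_one (s := s) e w p
  have hY0 : ∑ z : (Bool × Fin M) × Ω, outerUnit s e w u p z.1 z.2 = 0 := by
    have h := sum_blockField_one (s := s) e w (extPoint u p)
    rw [Fintype.sum_prod_type] at h ⊢
    simp only [blockField_ext_one, Finset.sum_add_distrib, hZ0,
      zero_add] at h
    exact h
  have h1 : |∑ z : (Bool × Fin M) × Ω, outerUnit s e w u p z.1 z.2 * ψ z|
      ≤ Fintype.card ((Bool × Fin M) × Ω) * (D * (m * r ^ (-s)) * (2 * L * r ^ α)) :=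
    abs_sum_mul_le_of_sum_eq_zero hY0
      (fun z => abs_outerUnit_le hB hu hk hM hm hα hD z.1 z.2)
      (osc_le_of_holder hB hu hα hα1 hL hψ)
  have h2 : |∑ z : (Bool × Fin M) × Ω, blockField s e w p 1 (p z.2) * ψ z|
      ≤ Fintype.card ((Bool × Fin M) × Ω) * (2 * D * L * a * r' ^ α) := by
    rw [Fintype.sum_prod_type]
    refine (Finset.abs_sum_le_sum_abs _ _).trans ?_
    calc _ ≤ ∑ v : Bool × Fin M, Fintype.card Ω * (2 * D * L * a * r' ^ α) := by
          refine Finset.sum_le_sum fun v _ => hB.unit_test _ L hL fun ω ω' => ?_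
          simpa [extPoint] using hψ (v, ω) (v, ω')
      _ = _ := by
          rw [card_cells, Finset.sum_const, Finset.card_univ, nsmul_eq_mul]
          simp only [Fintype.card_prod, Fintype.card_bool, Fintype.card_fin]
          push_cast; ring
  have h3 : ∑ z, blockField s e w (extPoint u p) 1 (extPoint u p z) * ψ z
      = ∑ z : (Bool × Fin M) × Ω, blockField s e w p 1 (p z.2) * ψ z
      + ∑ z : (Bool × Fin M) × Ω, outerUnit s e w u p z.1 z.2 * ψ z := by
    rw [← Finset.sum_add_distrib]
    exact Finset.sum_congr rfl fun z _ => by rw [← add_mul, ← blockField_ext_one]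
  rw [h3]
  refine (abs_add_le _ _).trans ((add_le_add h2 h1).trans (le_of_eq ?_))
  rw [Real.div_rpow hr'.le hr.le]
  field_simp
  ring

lemma extUnit_sq :
    ∑ z, blockField s e w (extPoint u p) 1 (extPoint u p z) ^ 2
      ≤ Fintype.card ((Bool × Fin M) × Ω) * (4 * D ^ 2 * (((m * r ^ (-s)) ^ 2 + S)
        + (X + m * r ^ (-s) * (r' / r) ^ α * a))) := by
  have hr : 0 < r := by linarith [hu.le_eighth, hB.r_pos]
  have hr' := hB.r_pos
  have hD0 := D_pos_of_outer hB hu hk hM hm hα hD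
  have hM0 : (0 : ℝ) < M := by exact_mod_cast hM
  have hX := hB.X_nonneg
  have ha := hB.a_nonneg
  set θ := m * r ^ (-s) with hθ
  have hθ0 : 0 ≤ θ := by positivity
  have h0 : ∀ z : (Bool × Fin M) × Ω, blockField s e w (extPoint u p) 1 (extPoint u p z)
      = blockField s e w p 1 (p z.2) + outerUnit s e w u p z.1 z.2 := fun z =>
    blockField_ext_one z.1 z.2
  simp only [h0]
  rw [sum_one_add_sq (fun ω => blockField s e w p 1 (p ω)) (outerUnit s e w u p), card_cells]
  have h1 : ∑ v, ∑ ω, blockField s e w p 1 (p ω) * outerUnit s e w u p v ω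
      ≤ 2 * M * (Fintype.card Ω * (2 * D * (D * θ * r ^ (-α)) * a * r' ^ α)) := by
    calc _ ≤ ∑ v : Bool × Fin M, Fintype.card Ω * (2 * D * (D * θ * r ^ (-α)) * a * r' ^ α) :=
          Finset.sum_le_sum fun v _ => (le_abs_self _).trans (hB.unit_test _ _ (by positivity)
            (abs_outerUnit_sub_le hB hu hk hM hm hα hD v))
      _ = _ := by
          rw [Finset.sum_const, Finset.card_univ, nsmul_eq_mul]
          simp only [Fintype.card_prod, Fintype.card_bool, Fintype.card_fin]
          push_cast; ring
  have h2 : ∑ v, ∑ ω, outerUnit s e w u p v ω ^ 2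
      ≤ 2 * M * (Fintype.card Ω * (D * θ) ^ 2) := by
    calc _ ≤ ∑ v : Bool × Fin M, ∑ ω : Ω, (D * θ) ^ 2 := by
          refine Finset.sum_le_sum fun v _ => Finset.sum_le_sum fun ω _ => ?_
          rw [← sq_abs]
          have := abs_outerUnit_le hB hu hk hM hm hα hD v ω
          gcongr
      _ = _ := by
          simp only [Finset.sum_const, Finset.card_univ, nsmul_eq_mul,
            Fintype.card_prod, Fintype.card_bool, Fintype.card_fin]
          push_cast; ring
  have h3 := hB.unit_sq
  have h4 : r ^ (-α) * r' ^ α = (r' / r) ^ α := by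
    rw [Real.div_rpow hr'.le hr.le, Real.rpow_neg hr.le]; field_simp
  calc _ ≤ 2 * M * (Fintype.card Ω * (4 * D ^ 2 * (S + X)))
      + 2 * (2 * M * (Fintype.card Ω * (2 * D * (D * θ * r ^ (-α)) * a * r' ^ α)))
      + 2 * M * (Fintype.card Ω * (D * θ) ^ 2) := by gcongr
    _ = 2 * M * Fintype.card Ω * (4 * D ^ 2 * (S + X) + 4 * D ^ 2 * θ * (r ^ (-α) * r' ^ α) * a
        + D ^ 2 * θ ^ 2) := by ring
    _ ≤ _ := by
        rw [h4]
        gcongr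
        nlinarith [sq_nonneg (D * θ)]

lemma extField_sum (hc : c₀ ≤ ck / 2) :
    Fintype.card ((Bool × Fin M) × Ω) * (c₀ * ((m * r ^ (-s)) ^ 2 + S)
        - D * (X + m * r ^ (-s) * (r' / r) ^ α * a))
      ≤ ∑ z, blockField s e w (extPoint u p) (extCharge (m * r ^ (-s)) f) (extPoint u p z) := by
  have hr : 0 < r := by linarith [hu.le_eighth, hB.r_pos]
  have hM0 : (0 : ℝ) < M := by exact_mod_cast hM
  set θ := m * r ^ (-s) with hθ
  have hθ0 : 0 ≤ θ := by positivity
  have h0 : ∑ z, blockField s e w (extPoint u p) (extCharge θ f) (extPoint u p z)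
      = 2 * M * ∑ ω, blockField s e w p f (p ω) + θ * ∑ v, ∑ ω, outerSigned s e w u p v ω
        + ∑ v, ∑ ω, outerField s e w u p f v ω := by
    rw [Fintype.sum_prod_type]
    simp only [blockField_extCharge, Finset.sum_add_distrib, Finset.sum_const,
      Finset.card_univ, nsmul_eq_mul, Fintype.card_prod, Fintype.card_bool, Fintype.card_fin,
      ← Finset.mul_sum, sum_blockField_one, mul_zero]
    push_cast
    ring
  have h2 := sum_outerSigned_ge hB hu hk hM hm
  have h3 : -(2 * M * Fintype.card Ω * (D * θ * ((r' / r) ^ α * a)))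
      ≤ ∑ v, ∑ ω, outerField s e w u p f v ω := by
    calc _ = ∑ v : Bool × Fin M, ∑ ω : Ω, -(D * θ * ((r' / r) ^ α * a)) := by
          simp only [Finset.sum_const, Finset.card_univ, nsmul_eq_mul,
            Fintype.card_prod, Fintype.card_bool, Fintype.card_fin]
          push_cast; ring
      _ ≤ _ := Finset.sum_le_sum fun v _ => Finset.sum_le_sum fun ω _ =>
          (abs_le.1 (abs_outerField_le hB hu hk hM hm hα hD v ω)).1
  have h4 : 2 * M * Fintype.card Ω * (c₀ * θ) ≤ ∑ v, ∑ ω, outerSigned s e w u p v ω := by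
    refine le_trans ?_ h2
    gcongr
  rw [h0, card_cells]
  calc _ = 2 * M * (Fintype.card Ω * (c₀ * S - D * X)) + θ * (2 * M * Fintype.card Ω * (c₀ * θ))
      + -(2 * M * Fintype.card Ω * (D * θ * ((r' / r) ^ α * a))) := by ring
    _ ≤ _ := by
        gcongr
        exact hB.field_sum

lemma extField_sq :
    ∑ z, blockField s e w (extPoint u p) (extCharge (m * r ^ (-s)) f) (extPoint u p z) ^ 2
      ≤ Fintype.card ((Bool × Fin M) × Ω) * (4 * D ^ 2 * (((m * r ^ (-s)) ^ 2 + S)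
        + (X + m * r ^ (-s) * (r' / r) ^ α * a)) ^ 2) := by
  have hr : 0 < r := by linarith [hu.le_eighth, hB.r_pos]
  have hr' := hB.r_pos
  have hD0 := D_pos_of_outer hB hu hk hM hm hα hD
  have hM0 : (0 : ℝ) < M := by exact_mod_cast hM
  have hX := hB.X_nonneg
  have hS := hB.S_nonneg
  have ha := hB.a_nonneg
  set θ := m * r ^ (-s) with hθ
  have hθ0 : 0 ≤ θ := by positivity
  have h0 : ∀ z : (Bool × Fin M) × Ω,
      blockField s e w (extPoint u p) (extCharge θ f) (extPoint u p z)
      = (blockField s e w p f (p z.2) + θ * cellSign z.1 * blockField s e w p 1 (p z.2))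
        + (θ * outerSigned s e w u p z.1 z.2 + outerField s e w u p f z.1 z.2) := fun z =>
    blockField_extCharge θ z.1 z.2
  have h1 : ∑ z : (Bool × Fin M) × Ω,
      (blockField s e w p f (p z.2) + θ * cellSign z.1 * blockField s e w p 1 (p z.2)) ^ 2
      ≤ Fintype.card ((Bool × Fin M) × Ω) * (2 * D * (S + X + θ ^ 2 / 2)) ^ 2 := by
    have h2 : ∑ z : (Bool × Fin M) × Ω,
        (blockField s e w p f (p z.2) + θ * cellSign z.1 * blockField s e w p 1 (p z.2)) ^ 2
        = ∑ z : (Bool × Fin M) × Ω, (blockField s e w p f (p z.2) ^ 2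
            + θ ^ 2 * blockField s e w p 1 (p z.2) ^ 2) := by
      have h3 := sum_sign_mul (M := M) (2 * θ)
        (fun ω => blockField s e w p f (p ω) * blockField s e w p 1 (p ω))
      rw [← sub_eq_zero, ← Finset.sum_sub_distrib, ← h3]
      refine Finset.sum_congr rfl fun z _ => ?_
      have h4 := cellSign_sq z.1
      linear_combination (θ ^ 2 * blockField s e w p 1 (p z.2) ^ 2) * h4
    rw [h2, Fintype.sum_prod_type, card_cells]
    simp only [Finset.sum_add_distrib, ← Finset.mul_sum, Finset.sum_const,
      Finset.card_univ, nsmul_eq_mul, Fintype.card_prod, Fintype.card_bool, Fintype.card_fin]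
    have h5 := hB.field_sq
    have h6 := hB.unit_sq
    push_cast
    calc _ ≤ 2 * M * (Fintype.card Ω * (4 * D ^ 2 * (S + X) ^ 2))
        + θ ^ 2 * (2 * M * (Fintype.card Ω * (4 * D ^ 2 * (S + X)))) := by
          gcongr
      _ ≤ _ := by
          have : 0 ≤ 2 * M * Fintype.card Ω * D ^ 2 * θ ^ 4 := by positivity
          nlinarith
  have h7 := sum_add_sq_le (y := D * θ ^ 2 + D * θ * ((r' / r) ^ α * a)) (by positivity)
    (by positivity) h1
    (B := fun z => θ * outerSigned s e w u p z.1 z.2 + outerField s e w u p f z.1 z.2) (by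
      intro z
      refine (abs_add_le _ _).trans ?_
      rw [abs_mul, abs_of_nonneg hθ0]
      have h8 := abs_outerSigned_le hB hu hk hM hm hα hD z.1 z.2
      have h9 := abs_outerField_le hB hu hk hM hm hα hD z.1 z.2
      have : θ * |outerSigned s e w u p z.1 z.2| ≤ θ * (D * θ) := by gcongr
      linarith)
  simp only [h0]
  refine h7.trans ?_
  gcongr
  rw [show 4 * D ^ 2 * (θ ^ 2 + S + (X + θ * (r' / r) ^ α * a)) ^ 2
    = (2 * D * (θ ^ 2 + S + (X + θ * (r' / r) ^ α * a))) ^ 2 by ring]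
  gcongr
  have : 0 ≤ D * (θ * ((r' / r) ^ α * a)) := by positivity
  linarith

/-- Replacing each cell of a layout by a copy of a block produces a block. -/
theorem IsRieszBlock.extend (hs : 0 < s) (hD' : 2 ^ (s + α) * C ≤ D) (hc : c₀ ≤ ck / 2)
    (hq0 : 0 < q) (hq : q ≤ 1 / 8) (hqr : (r' / r) ^ α ≤ q)
    (hH : ∀ R, r' ≤ R → R ≤ r → C * (m / (2 * M) + 2 ^ d * m * (R / r) ^ d) ≤ H R)
    (hH' : ∀ R, r ≤ R → m ≤ H R) :
    IsRieszBlock s α D c₀ q e H r m (extPoint u p) (extCharge (m * r ^ (-s)) f) w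
      ((m * r ^ (-s)) ^ 2 + S) (m * r ^ (-s) + (r' / r) ^ α * a)
      (X + m * r ^ (-s) * (r' / r) ^ α * a) (b + m * r ^ (-s) * (e / r) ^ α) := by
  have hr : 0 < r := by linarith [hu.le_eighth, hB.r_pos]
  have hr' := hB.r_pos
  have he := hB.e_pos
  have hM0 : (0 : ℝ) < M := by exact_mod_cast hM
  have hX := hB.X_nonneg
  have hS := hB.S_nonneg
  have ha := hB.a_nonneg
  have hb := hB.b_nonneg
  set θ := m * r ^ (-s) with hθ
  have hθ0 : 0 ≤ θ := by positivity
  have hq1 : 0 ≤ (r' / r) ^ α := by positivity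
  refine ⟨he, hB.w_pos, hm, norm_extPoint_le hB hu, extPoint_sep hB hu, ?_,
    extPoint_count hB hu hM hH hH', by positivity, by positivity, by positivity, by positivity,
    sum_extCharge θ hB.sum_f, ?_, extCharge_test hB hu hα hα1 hθ0,
    extUnit_test hB hu hk hM hm hα hα1 hD, extUnit_sq hB hu hk hM hm hα hα1 hD,
    extField_sum hB hu hk hM hm hα hα1 hD hc, extField_sq hB hu hk hM hm hα hα1 hD, ?_,
    extPoint_row hB hu hm hM hD' hs hα, ?_⟩
  · have := hB.mass
    rw [card_cells]
    field_simp at this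
    linarith
  · rw [sum_extCharge_sq θ hB.sum_f, card_cells]
    have := hB.sum_f_sq
    calc _ ≤ 2 * M * (Fintype.card Ω * θ ^ 2 + Fintype.card Ω * S) := by gcongr
      _ = _ := by ring
  · have h1 := hB.X_le
    have h2 : θ * (r' / r) ^ α * a ≤ q * (θ * a) := by
      rw [mul_assoc, mul_left_comm]
      gcongr
    have h3 : (θ + (r' / r) ^ α * a) ^ 2 ≤ (θ + 1 / 8 * a) ^ 2 := by
      gcongr
      linarith
    have h4 : θ * a + (θ + 1 / 8 * a) ^ 2 ≤ a ^ 2 + 2 * θ ^ 2 := by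
      nlinarith [sq_nonneg (a - θ)]
    have h5 := mul_le_mul_of_nonneg_left h3 hq0.le
    have h6 := mul_le_mul_of_nonneg_left h4 hq0.le
    linarith
  · set x := (e / r) ^ α with hx
    set x' := (e / r') ^ α with hx'
    have hx0 : 0 ≤ x := by positivity
    have hx1 : x' ≤ 1 := Real.rpow_le_one (by positivity)
      ((div_le_one hr').2 hB.e_le) hα.le
    have hx2 : x = x' * (r' / r) ^ α := by
      rw [hx, hx', ← Real.mul_rpow (by positivity) (by positivity)]
      congr 1
      field_simp
    have hx3 : x ≤ x' / 8 := by
      rw [hx2]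
      have : 0 ≤ x' := by positivity
      nlinarith
    have h1 := hB.b_sq
    have h2 : 2 * b * θ * x ≤ (1 - x') * θ ^ 2 + x ^ 2 * S := by
      refine le_of_sq_le_sq ?_ (by
        have : 0 ≤ 1 - x' := by linarith
        positivity)
      calc (2 * b * θ * x) ^ 2 = 4 * (θ * x) ^ 2 * b ^ 2 := by ring
        _ ≤ 4 * (θ * x) ^ 2 * ((1 - x') * S) := by gcongr
        _ ≤ _ := by nlinarith [sq_nonneg ((1 - x') * θ ^ 2 - x ^ 2 * S)]
    have h3 : (1 - x') + x ^ 2 ≤ 1 - x := by nlinarith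
    calc (b + θ * x) ^ 2 = b ^ 2 + 2 * b * θ * x + θ ^ 2 * x ^ 2 := by ring
      _ ≤ (1 - x') * S + ((1 - x') * θ ^ 2 + x ^ 2 * S) + θ ^ 2 * x ^ 2 := by gcongr
      _ = ((1 - x') + x ^ 2) * (θ ^ 2 + S) := by ring
      _ ≤ _ := by gcongr

end ExtensionBlock

section MeasureFunction

/-- A measure function `h` on the line such that `h r / r ^ d` is nonincreasing. -/
structure IsMeasureFunction (d : ℕ) (h : ℝ → ℝ) : Prop where
  cont : ContinuousOn h (Ici 0)
  mono : StrictMonoOn h (Ici 0)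
  zero : h 0 = 0
  tends : Tendsto h atTop atTop
  div_anti : ∀ r₁ r₂, 0 < r₁ → r₁ ≤ r₂ → h r₂ / r₂ ^ d ≤ h r₁ / r₁ ^ d

namespace IsMeasureFunction

variable {d : ℕ} {h : ℝ → ℝ} (hh : IsMeasureFunction d h)

include hh

lemma pos {r : ℝ} (hr : 0 < r) : 0 < h r := by
  have := hh.mono (mem_Ici.2 le_rfl) (mem_Ici.2 hr.le) hr
  rwa [hh.zero] at this

lemma nonneg {r : ℝ} (hr : 0 ≤ r) : 0 ≤ h r := by
  rcases hr.eq_or_lt with rfl | hr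
  · exact hh.zero.ge
  · exact (hh.pos hr).le

lemma le_of_le {r R : ℝ} (hr : 0 ≤ r) (hR : r ≤ R) : h r ≤ h R :=
  hh.mono.monotoneOn (mem_Ici.2 hr) (mem_Ici.2 (hr.trans hR)) hR

lemma lt_of_lt {r R : ℝ} (hR : 0 ≤ R) (hlt : h r < h R) : r < R := by
  by_contra hc
  exact absurd (hh.le_of_le hR (not_lt.1 hc)) (not_le.2 hlt)

lemma mul_div_pow_le {r R : ℝ} (hr : 0 < r) (hR : r ≤ R) : h R * (r / R) ^ d ≤ h r := by
  have h1 := hh.div_anti r R hr hR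
  have hR0 : 0 < R := hr.trans_le hR
  rw [div_le_div_iff₀ (by positivity) (by positivity)] at h1
  rw [div_pow, ← mul_div_assoc, div_le_iff₀ (by positivity)]
  exact h1

lemma apply_mul_le {r c : ℝ} (hr : 0 < r) (hc : 1 ≤ c) : h (c * r) ≤ c ^ d * h r := by
  have hc0 : 0 < c := by linarith
  have h1 := hh.mul_div_pow_le hr (le_mul_of_one_le_left hr.le hc)
  rw [div_pow, mul_pow, ← mul_div_assoc, div_le_iff₀ (by positivity)] at h1
  have : 0 < r ^ d := by positivity
  refine le_of_mul_le_mul_right ?_ this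
  linarith

lemma exists_eq {y : ℝ} (hy : 0 < y) : ∃ r, 0 < r ∧ h r = y := by
  obtain ⟨R, hR, hR0⟩ := ((hh.tends.eventually_ge_atTop y).and (eventually_ge_atTop 0)).exists
  obtain ⟨r, hr, hry⟩ := intermediate_value_Icc hR0 (hh.cont.mono Icc_subset_Ici_self)
    (show y ∈ Icc (h 0) (h R) by rw [hh.zero]; exact ⟨hy.le, hR⟩)
  refine ⟨r, hr.1.lt_of_ne ?_, hry⟩
  rintro rfl
  rw [hh.zero] at hry
  exact hy.ne hry

lemma const_mul {c : ℝ} (hc : 0 < c) : IsMeasureFunction d fun r => c * h r where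
  cont := continuousOn_const.mul hh.cont
  mono := fun _ hx _ hy hxy => mul_lt_mul_of_pos_left (hh.mono hx hy hxy) hc
  zero := by rw [hh.zero, mul_zero]
  tends := hh.tends.const_mul_atTop hc
  div_anti := fun r₁ r₂ h1 h2 => by
    rw [mul_div_assoc, mul_div_assoc]
    exact mul_le_mul_of_nonneg_left (hh.div_anti r₁ r₂ h1 h2) hc.le

/-- Either `h` is comparable with a `d`-dimensional gauge below `r`, or there is a first scale
`r'` at which `h` is large compared with such a gauge. -/
lemma exists_scale {r K : ℝ} (hr : 0 < r) :
    (∀ t, 0 < t → t ≤ r → h t ≤ 2 * K * h r * (t / r) ^ d) ∨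
    ∃ (M : ℕ) (r' : ℝ), 0 < M ∧ 0 < r' ∧ h r' = h r / (2 * M) ∧ 2 * M * K * r' ^ d ≤ r ^ d ∧
      ∀ t, r' ≤ t → t ≤ r → h t ≤ 2 * K * h r * (t / r) ^ d ∨ h t ≤ 2 * h r' := by
  have hm := hh.pos hr
  choose ρ hρ0 hρ using fun i : ℕ => hh.exists_eq (show 0 < h r / 2 ^ i by positivity)
  have key : ∀ t, 0 < t → t ≤ r → ∃ j : ℕ, h r / 2 ^ (j + 1) < h t ∧
      (¬ 2 ^ (j + 1) * K * ρ (j + 1) ^ d ≤ r ^ d → 0 ≤ K → h t ≤ 2 * K * h r * (t / r) ^ d) ∧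
      h t ≤ h r / 2 ^ j := by
    intro t ht htr
    have hht := hh.pos ht
    obtain ⟨j, hj1, hj2⟩ := exists_nat_pow_near (x := h r / h t) (y := 2)
      ((one_le_div hht).2 (hh.le_of_le ht.le htr)) (by norm_num)
    rw [le_div_iff₀ hht] at hj1
    rw [div_lt_iff₀ hht] at hj2
    have h1 : h r / 2 ^ (j + 1) < h t := by rw [div_lt_iff₀ (by positivity)]; linarith
    have h2 : h t ≤ h r / 2 ^ j := by rw [le_div_iff₀ (by positivity)]; linarith
    refine ⟨j, h1, fun hn hK => ?_, h2⟩
    rw [not_le] at hn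
    have h3 : ρ (j + 1) < t := hh.lt_of_lt ht.le (by rw [hρ]; exact h1)
    have h4 : ρ (j + 1) ^ d ≤ t ^ d := pow_le_pow_left₀ (hρ0 _).le h3.le d
    have h5 : r ^ d ≤ 2 ^ (j + 1) * K * t ^ d := hn.le.trans (by gcongr)
    rw [div_pow, ← mul_div_assoc, le_div_iff₀ (by positivity)]
    calc h t * r ^ d ≤ h t * (2 ^ (j + 1) * K * t ^ d) := by gcongr
      _ = (2 ^ j * h t) * (2 * K * t ^ d) := by ring
      _ ≤ h r * (2 * K * t ^ d) := by gcongr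
      _ = _ := by ring
  by_cases hex : ∃ i : ℕ, 1 ≤ i ∧ 2 ^ i * K * ρ i ^ d ≤ r ^ d
  · classical
    right
    obtain ⟨hi1, hi2⟩ := Nat.find_spec hex
    set i := Nat.find hex with hi
    obtain ⟨k, hk⟩ : ∃ k, i = k + 1 := ⟨i - 1, by omega⟩
    have hpow : (2 : ℝ) * ((2 ^ k : ℕ) : ℝ) = 2 ^ i := by rw [hk]; push_cast; ring
    refine ⟨2 ^ k, ρ i, by positivity, hρ0 i, by rw [hρ, hpow], by rw [hpow]; exact hi2, ?_⟩
    intro t ht htr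
    obtain ⟨j, hj1, hj2, hj3⟩ := key t ((hρ0 i).trans_le ht) htr
    by_cases hlt : h t ≤ 2 * h (ρ i)
    · exact Or.inr hlt
    left
    rw [not_le, hρ] at hlt
    have h6 : 2 * (h r / 2 ^ i) = h r / 2 ^ k := by rw [hk, pow_succ]; field_simp
    rw [h6] at hlt
    have h7 : j < k := by
      by_contra hjk
      have : h r / 2 ^ j ≤ h r / 2 ^ k :=
        div_le_div_of_nonneg_left hm.le (by positivity)
          (pow_le_pow_right₀ (by norm_num) (not_lt.1 hjk))
      linarith
    have h8 := Nat.find_min hex (m := j + 1) (by omega)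
    have hK : 0 ≤ K := by
      by_contra hK
      refine h8 ⟨by omega, ?_⟩
      have : 0 ≤ 2 ^ (j + 1) * (-K) * ρ (j + 1) ^ d := by
        have := hρ0 (j + 1)
        have : 0 ≤ -K := by linarith
        positivity
      have : 0 < r ^ d := by positivity
      linarith
    exact hj2 (fun h9 => h8 ⟨by omega, h9⟩) hK
  · left
    intro t ht htr
    obtain ⟨j, -, hj2, -⟩ := key t ht htr
    have h8 : ¬ 2 ^ (j + 1) * K * ρ (j + 1) ^ d ≤ r ^ d := fun h9 => hex ⟨j + 1, by omega, h9⟩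
    refine hj2 h8 ?_
    by_contra hK
    refine h8 ?_
    have : 0 ≤ 2 ^ (j + 1) * (-K) * ρ (j + 1) ^ d := by
      have := hρ0 (j + 1)
      have : 0 ≤ -K := by linarith
      positivity
    have : 0 < r ^ d := by positivity
    linarith

lemma intervalIntegrable {s δ r : ℝ} (hδ : 0 < δ) (hr : 0 < r) :
    IntervalIntegrable (fun t => (h t / t ^ s) ^ 2 / t) volume δ r := by
  have hsub : ∀ t ∈ uIcc δ r, 0 < t := fun t ht => (lt_min hδ hr).trans_le ht.1
  refine ContinuousOn.intervalIntegrable ?_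
  refine ContinuousOn.div (ContinuousOn.pow (ContinuousOn.div (hh.cont.mono fun t ht =>
    (hsub t ht).le) (ContinuousOn.rpow_const continuousOn_id fun t ht => Or.inl (hsub t ht).ne')
    fun t ht => ?_) 2) continuousOn_id fun t ht => (hsub t ht).ne'
  have := hsub t ht
  positivity

end IsMeasureFunction

end MeasureFunction

section Integral

lemma integral_rpow_sub_one_le {c δ r : ℝ} (hc : 0 < c) (hδ : 0 < δ) :
    ∫ t in δ..r, t ^ (c - 1) ≤ r ^ c / c := by
  rw [integral_rpow (Or.inl (by linarith)), sub_add_cancel]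
  gcongr
  linarith [Real.rpow_nonneg hδ.le c]

lemma integral_rpow_neg_sub_one_le {c δ r : ℝ} (hc : 0 < c) (hδ : 0 < δ) (hr : δ ≤ r) :
    ∫ t in δ..r, t ^ (-c - 1) ≤ δ ^ (-c) / c := by
  have h0 : (0 : ℝ) ∉ uIcc δ r := by
    rw [uIcc_of_le hr]
    exact fun h => absurd h.1 (not_le.2 hδ)
  rw [integral_rpow (Or.inr ⟨by linarith, h0⟩), sub_add_cancel, div_neg, ← neg_div]
  gcongr
  linarith [Real.rpow_nonneg (hδ.le.trans hr) (-c)]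

/-- The square function integral over a range of scales on which `h` is bounded either by a
`d`-dimensional gauge or by a constant. -/
lemma IsMeasureFunction.integral_le {d : ℕ} {h : ℝ → ℝ} (hh : IsMeasureFunction d h)
    {s A B δ r : ℝ} (hs : 0 < s) (hsd : s < d) (hδ : 0 < δ) (hr : δ ≤ r)
    (hb : ∀ t, δ ≤ t → t ≤ r → h t ≤ A * (t / r) ^ d ∨ h t ≤ B) :
    ∫ t in δ..r, (h t / t ^ s) ^ 2 / t
      ≤ (A * r ^ (-s)) ^ 2 / (2 * (d - s)) + (B * δ ^ (-s)) ^ 2 / (2 * s) := by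
  have hr0 : 0 < r := hδ.trans_le hr
  have h1 : ∀ c : ℝ, IntervalIntegrable (fun t : ℝ => t ^ c) volume δ r := by
    intro c
    refine intervalIntegral.intervalIntegrable_rpow (Or.inr ?_)
    rw [uIcc_of_le hr]
    exact fun h => absurd h.1 (not_le.2 hδ)
  have h2 : ∀ t ∈ Icc δ r, (h t / t ^ s) ^ 2 / t
      ≤ (A * r ^ (-(d : ℝ))) ^ 2 * t ^ (2 * (d - s) - 1) + B ^ 2 * t ^ (-(2 * s) - 1) := by
    intro t ht
    have ht0 : 0 < t := hδ.trans_le ht.1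
    have e1 : t ^ (2 * ((d : ℝ) - s) - 1) = (t ^ d) ^ 2 / (t ^ s) ^ 2 / t := by
      rw [show 2 * ((d : ℝ) - s) - 1 = (d : ℝ) + d - s - s - 1 by ring, Real.rpow_sub ht0,
        Real.rpow_sub ht0, Real.rpow_sub ht0, Real.rpow_add ht0, Real.rpow_one,
        Real.rpow_natCast]
      field_simp
    have e2 : t ^ (-(2 * s) - 1) = 1 / (t ^ s) ^ 2 / t := by
      rw [show -(2 * s) - 1 = -(s + s) - 1 by ring, Real.rpow_sub ht0, Real.rpow_neg ht0.le,
        Real.rpow_add ht0, Real.rpow_one]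
      field_simp
    have e3 : r ^ (-(d : ℝ)) = (r ^ d)⁻¹ := by rw [Real.rpow_neg hr0.le, Real.rpow_natCast]
    have hts : 0 < t ^ s := by positivity
    have hnn := hh.nonneg ht0.le
    rw [e1, e2, e3, div_pow]
    rcases hb t ht.1 ht.2 with h3 | h3
    · have h4 : h t ^ 2 ≤ (A * (r ^ d)⁻¹) ^ 2 * (t ^ d) ^ 2 := by
        rw [← mul_pow]
        refine pow_le_pow_left₀ hnn (h3.trans (le_of_eq ?_)) 2
        rw [div_pow]; ring
      calc h t ^ 2 / (t ^ s) ^ 2 / t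
          ≤ (A * (r ^ d)⁻¹) ^ 2 * (t ^ d) ^ 2 / (t ^ s) ^ 2 / t := by gcongr
        _ = (A * (r ^ d)⁻¹) ^ 2 * ((t ^ d) ^ 2 / (t ^ s) ^ 2 / t) := by ring
        _ ≤ _ := le_add_of_nonneg_right (by positivity)
    · have h4 : h t ^ 2 ≤ B ^ 2 := pow_le_pow_left₀ hnn h3 2
      calc h t ^ 2 / (t ^ s) ^ 2 / t ≤ B ^ 2 / (t ^ s) ^ 2 / t := by gcongr
        _ = B ^ 2 * (1 / (t ^ s) ^ 2 / t) := by ring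
        _ ≤ _ := le_add_of_nonneg_left (by positivity)
  have h3 := intervalIntegral.integral_mono_on hr (hh.intervalIntegrable (s := s) hδ hr0)
    (((h1 (2 * (d - s) - 1)).const_mul ((A * r ^ (-(d : ℝ))) ^ 2)).add
      ((h1 (-(2 * s) - 1)).const_mul (B ^ 2))) h2
  refine h3.trans ?_
  rw [intervalIntegral.integral_add ((h1 _).const_mul _) ((h1 _).const_mul _),
    intervalIntegral.integral_const_mul, intervalIntegral.integral_const_mul]
  have hds : 0 < 2 * ((d : ℝ) - s) := by linarith
  have h4 := integral_rpow_sub_one_le (r := r) hds hδ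
  have h5 := integral_rpow_neg_sub_one_le (c := 2 * s) (by linarith) hδ hr
  have e4 : (A * r ^ (-(d : ℝ))) ^ 2 * r ^ (2 * ((d : ℝ) - s)) = (A * r ^ (-s)) ^ 2 := by
    rw [mul_pow, mul_pow, mul_assoc]
    congr 1
    rw [← Real.rpow_natCast, ← Real.rpow_natCast, ← Real.rpow_mul hr0.le, ← Real.rpow_mul hr0.le,
      ← Real.rpow_add hr0]
    congr 1
    push_cast; ring
  have e5 : B ^ 2 * δ ^ (-(2 * s)) = (B * δ ^ (-s)) ^ 2 := by
    rw [mul_pow]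
    congr 1
    rw [← Real.rpow_natCast, ← Real.rpow_mul hδ.le]
    congr 1
    push_cast; ring
  rw [← e4, ← e5, mul_div_assoc, mul_div_assoc]
  gcongr

end Integral

section Chain

variable {d : ℕ} [NeZero d] {s α Ck ck C K D c₀ q : ℝ}

lemma IsCellConfig.mono {β K K' C : ℝ} {M : ℕ} {v : Bool × Fin M → EuclideanSpace ℝ (Fin d)}
    (hv : IsCellConfig β K C v) (hK : K ≤ K') : IsCellConfig β K' C v where
  norm_le := hv.norm_le
  sep := fun τ hτ h i j hij => hv.sep τ hτ (le_trans (by gcongr) h) i j hij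
  row := hv.row
  coord := hv.coord
  count := hv.count

/-- A compatible choice of the parameters of the block construction. -/
structure IsBlockConst (d : ℕ) [NeZero d] (s α Ck ck C K D c₀ q : ℝ) : Prop where
  s_pos : 0 < s
  s_lt : s < d
  α_pos : 0 < α
  α_le : α ≤ 1
  kernel : ∀ e, 0 < e → KernelBound d s α Ck ck e
  config : ∀ M : ℕ, 1 ≤ M →
    ∃ v : Bool × Fin M → EuclideanSpace ℝ (Fin d), IsCellConfig (s + α) K C v
  one_le_C : 1 ≤ C
  one_le_K : 1 ≤ K
  D_ge : 2 * (Ck * (2 ^ (s + α) * C)) ≤ D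
  D_ge' : 2 ^ (s + α) * C ≤ D
  c₀_pos : 0 < c₀
  c₀_le : c₀ ≤ ck / 2
  q_pos : 0 < q
  q_le : q ≤ 1 / 8
  q_D_le : 4 * q * D ≤ c₀
  ratio : ∀ τ, 0 ≤ τ → 2 * K * τ ^ d ≤ 1 → τ ^ α ≤ q

lemma exists_isBlockConst (hs : 0 < s) (hsd : s < d) :
    ∃ α Ck ck C K D c₀ q, IsBlockConst d s α Ck ck C K D c₀ q := by
  set α := min 1 (d - s) / 2 with hα
  have hds : 0 < (d : ℝ) - s := by linarith
  have hα0 : 0 < α := by positivity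
  have hα1 : α ≤ 1 := by
    have := min_le_left 1 ((d : ℝ) - s)
    linarith
  have hαd : s + α < d := by
    have := min_le_right 1 ((d : ℝ) - s)
    linarith
  obtain ⟨Ck, ck, hCk, hck, hker⟩ := exists_avgKernel_bounds (d := d) hs hα0 hα1
  obtain ⟨K, C, hK, hC, hconf⟩ := exists_isCellConfig (d := d) (β := s + α) (by linarith) hαd
  set D := max (2 * (Ck * (2 ^ (s + α) * C))) (2 ^ (s + α) * C) with hD
  have hD0 : 0 < D := lt_of_lt_of_le (by positivity) (le_max_right _ _)
  set q := min (1 / 8) (ck / 2 / (4 * D)) with hq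
  have hq0 : 0 < q := by positivity
  have hd : 0 < (d : ℝ) := hs.trans hsd
  refine ⟨α, Ck, ck, C, max K (q ^ (-(d / α))), D, ck / 2, q, hs, hsd, hα0, hα1, ?_, ?_, hC,
    hK.trans (le_max_left _ _), le_max_left _ _, le_max_right _ _, by positivity, le_rfl, hq0,
    min_le_left _ _, ?_, ?_⟩
  · intro e he
    obtain ⟨h1, h2, h3, h4⟩ := hker e he
    exact ⟨hCk, h1, h2, h3, h4⟩
  · intro M hM
    obtain ⟨v, hv⟩ := hconf M hM
    exact ⟨v, hv.mono (le_max_left _ _)⟩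
  · have := min_le_right (1 / 8) (ck / 2 / (4 * D))
    rw [← hq, le_div_iff₀ (by positivity)] at this
    linarith
  · intro τ hτ h
    have h1 : τ ^ d ≤ q ^ ((d : ℝ) / α) := by
      have h2 : q ^ (-((d : ℝ) / α)) * τ ^ d ≤ 1 := by
        refine le_trans ?_ h
        have h3 := le_max_right K (q ^ (-((d : ℝ) / α)))
        have h4 : 0 < q ^ (-((d : ℝ) / α)) := by positivity
        gcongr
        linarith
      rw [Real.rpow_neg hq0.le] at h2
      rwa [inv_mul_le_iff₀ (by positivity), mul_one] at h2
    calc τ ^ α = (τ ^ d) ^ (α / d) := by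
          rw [← Real.rpow_natCast, ← Real.rpow_mul hτ]; congr 1; field_simp
      _ ≤ (q ^ ((d : ℝ) / α)) ^ (α / d) := by gcongr
      _ = q := by
          rw [← Real.rpow_mul hq0.le]
          have : (d : ℝ) / α * (α / d) = 1 := by field_simp
          rw [this, Real.rpow_one]

namespace IsBlockConst

variable (hc : IsBlockConst d s α Ck ck C K D c₀ q)

include hc

lemma D_pos : 0 < D := by
  have := hc.one_le_C
  exact lt_of_lt_of_le (by positivity) hc.D_ge'

lemma radius_le {r r' : ℝ} {M : ℕ} (hr : 0 < r) (hr0 : 0 < r') (hM : 0 < M)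
    (hr' : 2 * M * K * r' ^ d ≤ r ^ d) : (r' / r) ^ α ≤ q ∧ r' ≤ r / 8 := by
  have hK := hc.one_le_K
  have hM1 : (1 : ℝ) ≤ M := by exact_mod_cast hM
  have hq : (r' / r) ^ α ≤ q := by
    refine hc.ratio _ (by positivity) ?_
    rw [div_pow, ← mul_div_assoc, div_le_one (by positivity)]
    refine le_trans ?_ hr'
    have : 2 * 1 * K * r' ^ d ≤ 2 * M * K * r' ^ d := by gcongr
    linarith
  have h1 : r' / r < 1 := by
    by_contra h
    have := Real.one_le_rpow (not_lt.1 h) hc.α_pos.le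
    linarith [hc.q_le]
  have h2 : r' / r ≤ 1 / 8 := by
    calc r' / r = (r' / r) ^ (1 : ℝ) := (Real.rpow_one _).symm
      _ ≤ (r' / r) ^ α := Real.rpow_le_rpow_of_exponent_ge (by positivity) h1.le hc.α_le
      _ ≤ _ := hq.trans hc.q_le
  rw [div_le_iff₀ hr] at h2
  exact ⟨hq, by linarith⟩

/-- Extending a block across one gap between scales. -/
lemma exists_extend {Ω : Type} [Fintype Ω] [DecidableEq Ω] {e : ℝ} {H : ℝ → ℝ} {r r' m : ℝ}
    {p : Ω → EuclideanSpace ℝ (Fin d)} {f : Ω → ℝ} {w S a X b : ℝ} {M : ℕ}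
    (hB : IsRieszBlock s α D c₀ q e H r' (m / (2 * M)) p f w S a X b) (hr : 0 < r) (hm : 0 < m)
    (hM : 0 < M) (hr' : 2 * M * K * r' ^ d ≤ r ^ d)
    (hH : ∀ R, r' ≤ R → R ≤ r → C * (m / (2 * M) + 2 ^ d * m * (R / r) ^ d) ≤ H R)
    (hH' : ∀ R, r ≤ R → m ≤ H R) :
    ∃ u : Bool × Fin M → EuclideanSpace ℝ (Fin d),
      IsRieszBlock s α D c₀ q e H r m (extPoint u p) (extCharge (m * r ^ (-s)) f) w
      ((m * r ^ (-s)) ^ 2 + S) (m * r ^ (-s) + (r' / r) ^ α * a)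
      (X + m * r ^ (-s) * (r' / r) ^ α * a) (b + m * r ^ (-s) * (e / r) ^ α) := by
  obtain ⟨v, hv⟩ := hc.config M hM
  have hr0 := hB.r_pos
  obtain ⟨hq, h8⟩ := hc.radius_le hr hr0 hM hr'
  exact ⟨_, hB.extend (hv.isCellLayout hr hr0 h8 hr') (hc.kernel e hB.e_pos) hM hm hc.α_pos
    hc.α_le hc.D_ge hc.s_pos hc.D_ge' hc.c₀_le hc.q_pos hc.q_le hq hH fun R hR => hH' R hR⟩

/-- A pair of points at distance comparable with the radius. -/
lemma exists_pair {h : ℝ → ℝ} (hh : IsMeasureFunction d h) {r : ℝ} (hr : 0 < r) :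
    ∃ (Ω : Type) (_ : Fintype Ω) (_ : DecidableEq Ω) (e : ℝ)
      (p : Ω → EuclideanSpace ℝ (Fin d)) (f : Ω → ℝ) (w a X b : ℝ),
      IsRieszBlock s α D c₀ q e (fun R => C * (K + 2 ^ d) * h R) r (h r) p f w
        ((h r * r ^ (-s)) ^ 2) a X b ∧ w ≤ K * h e ∧
      (w * e ^ (-s)) ^ 2 ≤ (2 * K) ^ (2 * s) * (h r * r ^ (-s)) ^ 2 := by
  have hK := hc.one_le_K
  have hC := hc.one_le_C
  have hm := hh.pos hr
  have hd1 : 1 ≤ d := Nat.one_le_iff_ne_zero.2 (NeZero.ne d)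
  set τ : ℝ := (2 * K)⁻¹ ^ ((d : ℝ)⁻¹) with hτ
  have hτ0 : 0 < τ := by positivity
  have hτd : τ ^ d = (2 * K)⁻¹ := Real.rpow_inv_natCast_pow (by positivity) (NeZero.ne d)
  have hτ1 : τ ≤ 1 := Real.rpow_le_one (by positivity) (inv_le_one_of_one_le₀ (by linarith))
    (by positivity)
  have hτ2 : (2 * K)⁻¹ ≤ τ := by
    rw [← hτd]
    exact pow_le_of_le_one hτ0.le hτ1 (NeZero.ne d)
  have hhe : h r / 2 ≤ K * h (τ * r) := by
    have h1 := hh.mul_div_pow_le (show 0 < τ * r by positivity)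
      (mul_le_of_le_one_left hr.le hτ1)
    rw [mul_div_assoc, div_self hr.ne', mul_one, hτd] at h1
    calc h r / 2 = K * (h r * (2 * K)⁻¹) := by field_simp
      _ ≤ _ := by gcongr
  have hle : ∀ R, τ * r ≤ R → h r / 2 ≤ K * h R := fun R hR =>
    hhe.trans (by
      gcongr
      exact hh.le_of_le (by positivity) hR)
  have h2d : (0 : ℝ) < 2 ^ d := by positivity
  have hB := isRieszBlock_unit (d := d) (s := s) (α := α) (D := D) (c₀ := c₀) (q := q)
    (H := fun R => C * (K + 2 ^ d) * h R) (show 0 < τ * r by positivity) (half_pos hm) (by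
      intro R hR
      have h2 : 0 ≤ h R := hh.nonneg (le_trans (by positivity) hR)
      calc h r / 2 ≤ 1 * (K + 0) * h R := by linarith [hle R hR]
        _ ≤ C * (K + 2 ^ d) * h R := by gcongr)
  have hB' : IsRieszBlock (d := d) (Ω := Unit) s α D c₀ q (τ * r) (fun R => C * (K + 2 ^ d) * h R)
      (τ * r) (h r / (2 * (1 : ℕ))) (fun _ => 0) (fun _ => 0) (h r / 2) 0 0 0 0 := by
    simpa using hB
  obtain ⟨u, hu⟩ := hc.exists_extend hB' hr hm one_pos (by
      rw [mul_pow, hτd]; push_cast; field_simp; linarith) (by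
      intro R hR hRr
      have hR0 : 0 < R := lt_of_lt_of_le (by positivity) hR
      have h2 := hh.mul_div_pow_le hR0 hRr
      have h3 := hle R hR
      push_cast
      calc C * (h r / (2 * 1) + 2 ^ d * h r * (R / r) ^ d)
          = C * (h r / 2 + 2 ^ d * (h r * (R / r) ^ d)) := by ring
        _ ≤ C * (K * h R + 2 ^ d * h R) := by gcongr
        _ = _ := by ring) (by
      intro R hR
      have h2 := hh.le_of_le hr.le hR
      have h3 : 0 ≤ h R := hh.nonneg (hr.le.trans hR)
      calc h r ≤ 1 * (1 + 0) * h R := by linarith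
        _ ≤ C * (K + 2 ^ d) * h R := by gcongr)
  refine ⟨_, inferInstance, inferInstance, _, _, _, _, _, _, _, by simpa using hu, hhe, ?_⟩
  have h4 : (τ * r) ^ (-s) ≤ (2 * K) ^ s * r ^ (-s) := by
    rw [Real.mul_rpow hτ0.le hr.le]
    gcongr
    calc τ ^ (-s) ≤ ((2 * K)⁻¹) ^ (-s) :=
          Real.rpow_le_rpow_of_nonpos (by positivity) hτ2 (by linarith [hc.s_pos])
      _ = (2 * K) ^ s := by
          rw [Real.inv_rpow (by positivity), Real.rpow_neg (by positivity), inv_inv]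
  calc (h r / 2 * (τ * r) ^ (-s)) ^ 2 ≤ (h r * ((2 * K) ^ s * r ^ (-s))) ^ 2 := by
        gcongr
        linarith
    _ = ((2 * K) ^ s) ^ 2 * (h r * r ^ (-s)) ^ 2 := by ring
    _ = _ := by
        rw [← Real.rpow_natCast ((2 * K) ^ s), ← Real.rpow_mul (by positivity)]
        congr 2
        push_cast; ring

/-- Blocks whose energy controls the square function of `h` down to a given scale. -/
theorem exists_block {h : ℝ → ℝ} (hh : IsMeasureFunction d h) {δ : ℝ} (hδ : 0 < δ) {r : ℝ}
    (hr : 0 < r) :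
    ∃ (Ω : Type) (_ : Fintype Ω) (_ : DecidableEq Ω) (e : ℝ)
      (p : Ω → EuclideanSpace ℝ (Fin d)) (f : Ω → ℝ) (w S a X b : ℝ),
      IsRieszBlock s α D c₀ q e (fun R => C * (K + 2 ^ d) * h R) r (h r) p f w S a X b ∧
      w ≤ K * h e ∧ (w * e ^ (-s)) ^ 2 ≤ (2 * K) ^ (2 * s) * S ∧ (h r * r ^ (-s)) ^ 2 ≤ S ∧
      ∫ t in δ..r, (h t / t ^ s) ^ 2 / t
        ≤ (2 * K ^ 2 / (d - s) + 2 / s) * (2 * S - (h r * r ^ (-s)) ^ 2) := by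
  have hK := hc.one_le_K
  have hC := hc.one_le_C
  have hs := hc.s_pos
  have hds : 0 < (d : ℝ) - s := by linarith [hc.s_lt]
  obtain ⟨k, hk⟩ : ∃ k : ℕ, r ≤ 2 ^ k * δ := by
    obtain ⟨k, hk⟩ := pow_unbounded_of_one_lt (r / δ) (one_lt_two)
    exact ⟨k, by rw [div_lt_iff₀ hδ] at hk; exact hk.le⟩
  induction k generalizing r with
  | zero =>
    obtain ⟨Ω, i1, i2, e, p, f, w, a, X, b, hB, hw, hwe⟩ := hc.exists_pair hh hr
    refine ⟨Ω, i1, i2, e, p, f, w, _, a, X, b, hB, hw, hwe, le_rfl, ?_⟩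
    have h1 : ∫ t in δ..r, (h t / t ^ s) ^ 2 / t ≤ 0 := by
      rw [intervalIntegral.integral_symm, neg_nonpos]
      refine intervalIntegral.integral_nonneg (by simpa using hk) fun t ht => ?_
      have : 0 < t := hr.trans_le ht.1
      positivity
    refine h1.trans ?_
    have : 0 ≤ 2 * (h r * r ^ (-s)) ^ 2 - (h r * r ^ (-s)) ^ 2 := by
      linarith [sq_nonneg (h r * r ^ (-s))]
    positivity
  | succ k ih =>
    by_cases hrk : r ≤ 2 ^ k * δ
    · exact ih hr hrk
    have hδr : δ ≤ r := by
      have : (1 : ℝ) ≤ 2 ^ k := one_le_pow₀ (by norm_num)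
      nlinarith
    have hm := hh.pos hr
    rcases hh.exists_scale (K := K) hr with hsc | ⟨M, r', hM, hr'0, hhr', hr', hsc⟩
    · obtain ⟨Ω, i1, i2, e, p, f, w, a, X, b, hB, hw, hwe⟩ := hc.exists_pair hh hr
      refine ⟨Ω, i1, i2, e, p, f, w, _, a, X, b, hB, hw, hwe, le_rfl, ?_⟩
      have h1 := hh.integral_le (A := 2 * K * h r) (B := 0) hs hc.s_lt hδ hδr
        fun t ht htr => Or.inl (hsc t (hδ.trans_le ht) htr)
      refine h1.trans ?_
      have h2 : 0 ≤ 2 / s * (h r * r ^ (-s)) ^ 2 := by positivity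
      have h3 : (2 * K * h r * r ^ (-s)) ^ 2 / (2 * (d - s))
          = 2 * K ^ 2 / (d - s) * (h r * r ^ (-s)) ^ 2 := by
        field_simp
      rw [h3]
      simp only [zero_mul, ne_eq, OfNat.ofNat_ne_zero, not_false_eq_true, zero_pow, zero_div]
      linarith
    · have h8 := (hc.radius_le hr hr'0 hM hr').2
      obtain ⟨Ω, i1, i2, e, p, f, w, S, a, X, b, hB, hw, hwe, hS, hint⟩ := ih hr'0 (by
        rw [pow_succ] at hk; linarith)
      rw [hhr'] at hB
      have h2d : (0 : ℝ) < 2 ^ d := by positivity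
      obtain ⟨u, hu⟩ := hc.exists_extend hB hr hm hM hr' (by
        intro R hR hRr
        have hR0 : 0 < R := hr'0.trans_le hR
        have h2 := hh.mul_div_pow_le hR0 hRr
        have h3 := hh.le_of_le hr'0.le hR
        have h4 := hh.nonneg hR0.le
        rw [hhr'] at h3
        calc C * (h r / (2 * M) + 2 ^ d * h r * (R / r) ^ d)
            = C * (h r / (2 * M) + 2 ^ d * (h r * (R / r) ^ d)) := by ring
          _ ≤ C * (K * h R + 2 ^ d * h R) := by
              gcongr
              exact h3.trans (le_mul_of_one_le_left h4 hK)
          _ = _ := by ring) (by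
        intro R hR
        have h2 := hh.le_of_le hr.le hR
        have h3 : 0 ≤ h R := hh.nonneg (hr.le.trans hR)
        calc h r ≤ 1 * (1 + 0) * h R := by linarith
          _ ≤ C * (K + 2 ^ d) * h R := by gcongr)
      have hS0 := hB.S_nonneg
      refine ⟨_, inferInstance, inferInstance, e, _, _, w, _, _, _, _, hu, hw, ?_, ?_, ?_⟩
      · refine hwe.trans ?_
        have h1 : 0 ≤ (h r * r ^ (-s)) ^ 2 := by positivity
        have : S ≤ (h r * r ^ (-s)) ^ 2 + S := by linarith
        gcongr
      · linarith
      · have h1 := hh.integral_le (A := 2 * K * h r) (B := 2 * h r') hs hc.s_lt hr'0 (by linarith)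
          fun t ht htr => hsc t ht htr
        rw [← intervalIntegral.integral_add_adjacent_intervals
          (hh.intervalIntegrable (s := s) hδ hr'0) (hh.intervalIntegrable (s := s) hr'0 hr)]
        have h3 : (2 * K * h r * r ^ (-s)) ^ 2 / (2 * (d - s))
            = 2 * K ^ 2 / (d - s) * (h r * r ^ (-s)) ^ 2 := by
          field_simp
        have h4 : (2 * h r' * r' ^ (-s)) ^ 2 / (2 * s) = 2 / s * (h r' * r' ^ (-s)) ^ 2 := by
          field_simp
        rw [h3, h4] at h1
        have h5 : 0 ≤ 2 * K ^ 2 / (d - s) * (h r' * r' ^ (-s)) ^ 2 := by positivity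
        have h6 : 0 ≤ 2 / s * (h r * r ^ (-s)) ^ 2 := by positivity
        linarith

end IsBlockConst

end Chain

section GoodPoints

lemma exists_finset_card_ge {Ω : Type} [Fintype Ω] {T : Ω → ℝ} {A B : ℝ} (hA : 0 < A) (hB : 0 < B)
    (h1 : Fintype.card Ω * A ≤ ∑ ω, T ω) (h2 : ∑ ω, T ω ^ 2 ≤ Fintype.card Ω * B) :
    ∃ P : Finset Ω, A ^ 2 / (4 * B) * Fintype.card Ω ≤ P.card ∧ ∀ ω ∈ P, A / 2 ≤ T ω := by
  classical
  set P := Finset.univ.filter fun ω => A / 2 ≤ T ω with hP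
  refine ⟨P, ?_, fun ω hω => (Finset.mem_filter.1 hω).2⟩
  set n : ℝ := (Fintype.card Ω : ℝ) with hn
  have hn0 : 0 ≤ n := by positivity
  have h3 : n * (A / 2) ≤ ∑ ω ∈ P, T ω := by
    have h4 := Finset.sum_filter_add_sum_filter_not Finset.univ (fun ω => A / 2 ≤ T ω) T
    have h5 : ∑ ω ∈ Finset.univ.filter (fun ω => ¬ A / 2 ≤ T ω), T ω ≤ n * (A / 2) := by
      calc _ ≤ ∑ ω ∈ Finset.univ.filter (fun ω => ¬ A / 2 ≤ T ω), A / 2 :=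
            Finset.sum_le_sum fun ω hω => (not_le.1 (Finset.mem_filter.1 hω).2).le
        _ ≤ ∑ _ω : Ω, A / 2 := Finset.sum_le_sum_of_subset_of_nonneg (Finset.filter_subset _ _)
            fun _ _ _ => by positivity
        _ = _ := by rw [Finset.sum_const, Finset.card_univ, nsmul_eq_mul]
    linarith
  have h6 := sq_sum_le_card_mul_sum_sq (s := P) (f := T)
  have h7 : ∑ ω ∈ P, T ω ^ 2 ≤ n * B := le_trans
    (Finset.sum_le_sum_of_subset_of_nonneg (Finset.subset_univ P) fun _ _ _ => sq_nonneg _) h2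
  have h8 : (n * (A / 2)) ^ 2 ≤ P.card * (n * B) := by
    calc _ ≤ (∑ ω ∈ P, T ω) ^ 2 := by gcongr
      _ ≤ _ := h6
      _ ≤ _ := by gcongr
  rcases hn0.eq_or_lt with h0 | h0
  · rw [← h0, mul_zero]; positivity
  rw [div_mul_eq_mul_div, div_le_iff₀ (by positivity)]
  have : n * (A ^ 2 * n) ≤ n * (P.card * (4 * B)) := by nlinarith
  exact le_of_mul_le_mul_left this h0

/-- Schur's test for a symmetric nonnegative matrix. -/
lemma sum_sq_sum_mul_le {Ω : Type} [Fintype Ω] {A : Ω → Ω → ℝ} {g : Ω → ℝ} {R : ℝ}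
    (hA : ∀ i j, 0 ≤ A i j) (hsymm : ∀ i j, A i j = A j i) (hrow : ∀ i, ∑ j, A i j ≤ R) :
    ∑ i, (∑ j, A i j * g j) ^ 2 ≤ R ^ 2 * ∑ j, g j ^ 2 := by
  have h1 : ∀ i, (∑ j, A i j * g j) ^ 2 ≤ R * ∑ j, A i j * g j ^ 2 := by
    intro i
    have h2 := Finset.sum_sq_le_sum_mul_sum_of_sq_le_mul Finset.univ (r := fun j => A i j * g j)
      (f := fun j => A i j) (g := fun j => A i j * g j ^ 2) (fun j _ => hA i j)
      (fun j _ => mul_nonneg (hA i j) (sq_nonneg _)) (fun j _ => by apply le_of_eq; ring)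
    refine h2.trans (mul_le_mul_of_nonneg_right (hrow i) ?_)
    exact Finset.sum_nonneg fun j _ => mul_nonneg (hA i j) (sq_nonneg _)
  have hR : ∀ _ : Ω, 0 ≤ R := fun i => (Finset.sum_nonneg fun j _ => hA i j).trans (hrow i)
  calc _ ≤ ∑ i, R * ∑ j, A i j * g j ^ 2 := Finset.sum_le_sum fun i _ => h1 i
    _ = ∑ j, R * ((∑ i, A j i) * g j ^ 2) := by
        simp only [← Finset.mul_sum]
        rw [Finset.sum_comm]
        congr 1
        refine Finset.sum_congr rfl fun j _ => ?_
        rw [Finset.sum_mul]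
        exact Finset.sum_congr rfl fun i _ => by rw [hsymm]
    _ ≤ ∑ j, R * (R * g j ^ 2) := by
        refine Finset.sum_le_sum fun j _ => ?_
        have := hR j
        have := hrow j
        gcongr
    _ = _ := by
        rw [Finset.mul_sum]
        exact Finset.sum_congr rfl fun j _ => by ring

variable {d : ℕ} [NeZero d] {s : ℝ} {Ω : Type} [Fintype Ω] [DecidableEq Ω] {α D c₀ q e : ℝ}
  {H : ℝ → ℝ} {r m : ℝ} {p : Ω → EuclideanSpace ℝ (Fin d)} {f : Ω → ℝ} {w S a X b : ℝ}
  {Ck ck : ℝ}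

/-- The interaction weights controlling the oscillation of the field near the points. -/
def oscWeight (s α e w : ℝ) (p : Ω → EuclideanSpace ℝ (Fin d)) (ω ω' : Ω) : ℝ :=
  if ω' = ω then 0 else w * ‖p ω - p ω'‖ ^ (-(s + α)) * e ^ α

/-- A bound for the oscillation of the field near the point `p ω`. -/
def oscBound (s α e w : ℝ) (p : Ω → EuclideanSpace ℝ (Fin d)) (f : Ω → ℝ) (ω : Ω) : ℝ :=
  ∑ ω', oscWeight s α e w p ω ω' * |f ω'| + w * e ^ (-s) * |f ω|

namespace IsRieszBlock

variable (hB : IsRieszBlock s α D c₀ q e H r m p f w S a X b)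

include hB

lemma sum_oscBound_sq_le {C₂ : ℝ} (hw : (w * e ^ (-s)) ^ 2 ≤ C₂ * S) :
    ∑ ω, oscBound s α e w p f ω ^ 2 ≤ Fintype.card Ω * (2 * (D ^ 2 + C₂) * S ^ 2) := by
  have he := hB.e_pos
  have hw0 := hB.w_pos
  have hr := hB.r_pos
  have hb : b ^ 2 ≤ S := by
    have h1 := hB.b_sq
    have h2 : 0 ≤ (e / r) ^ α * S := by
      have := hB.S_nonneg
      positivity
    linarith
  have h1 : ∑ ω, (∑ ω', oscWeight s α e w p ω ω' * |f ω'|) ^ 2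
      ≤ (D * b) ^ 2 * ∑ ω, |f ω| ^ 2 := by
    refine sum_sq_sum_mul_le ?_ ?_ ?_
    · intro i j
      unfold oscWeight
      split_ifs
      · exact le_rfl
      · positivity
    · intro i j
      unfold oscWeight
      simp only [eq_comm (a := i), norm_sub_rev (p i)]
    · intro ω
      have h2 := hB.row ω
      calc ∑ ω', oscWeight s α e w p ω ω'
          = ∑ ω' ∈ Finset.univ.erase ω, oscWeight s α e w p ω ω' := by
            rw [← Finset.add_sum_erase _ _ (Finset.mem_univ ω)]
            simp [oscWeight]
        _ = (∑ ω' ∈ Finset.univ.erase ω, w * ‖p ω - p ω'‖ ^ (-(s + α))) * e ^ α := by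
            rw [Finset.sum_mul]
            refine Finset.sum_congr rfl fun ω' hω' => ?_
            rw [oscWeight, if_neg (Finset.ne_of_mem_erase hω')]
        _ ≤ D * b * e ^ (-α) * e ^ α := by gcongr
        _ = D * b := by rw [mul_assoc, ← Real.rpow_add he]; simp
  have h3 := hB.sum_f_sq
  simp only [sq_abs] at h1
  have hf0 : 0 ≤ ∑ ω, f ω ^ 2 := Finset.sum_nonneg fun _ _ => sq_nonneg _
  calc ∑ ω, oscBound s α e w p f ω ^ 2
      ≤ ∑ ω, (2 * (∑ ω', oscWeight s α e w p ω ω' * |f ω'|) ^ 2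
          + 2 * (w * e ^ (-s)) ^ 2 * f ω ^ 2) := by
        refine Finset.sum_le_sum fun ω _ => ?_
        refine (add_sq_le).trans (le_of_eq ?_)
        rw [mul_pow _ |f ω|, sq_abs]; ring
    _ = 2 * ∑ ω, (∑ ω', oscWeight s α e w p ω ω' * |f ω'|) ^ 2
          + 2 * (w * e ^ (-s)) ^ 2 * ∑ ω, f ω ^ 2 := by
        rw [Finset.sum_add_distrib, Finset.mul_sum, Finset.mul_sum]
    _ ≤ 2 * ((D * b) ^ 2 * ∑ ω, f ω ^ 2) + 2 * (C₂ * S) * ∑ ω, f ω ^ 2 := by gcongr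
    _ = 2 * (D ^ 2 * b ^ 2 + C₂ * S) * ∑ ω, f ω ^ 2 := by ring
    _ ≤ 2 * (D ^ 2 * S + C₂ * S) * (Fintype.card Ω * S) := by
        have : 0 ≤ C₂ * S := le_trans (sq_nonneg _) hw
        have := hB.S_nonneg
        gcongr
    _ = _ := by ring

lemma abs_blockField_sub_le (hk : KernelBound d s α Ck ck e) (hs : 0 < s) (hα : 0 < α) {ε : ℝ}
    (hε0 : 0 ≤ ε) (hε : ε ≤ 1 / 8) (ω : Ω) {y : EuclideanSpace ℝ (Fin d)}
    (hy : ‖y - p ω‖ ≤ ε * e) :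
    |blockField s e w p f y - blockField s e w p f (p ω)|
      ≤ Ck * 2 ^ (s + α) * ε ^ α * oscBound s α e w p f ω := by
  have he := hB.e_pos
  have hw0 := hB.w_pos
  have hCk := hk.C_pos
  have h2 : (1 : ℝ) ≤ 2 ^ (s + α) := Real.one_le_rpow (by norm_num) (by linarith)
  have key : ∀ ω', w * |f ω' * avgKernel d s e (y - p ω') - f ω' * avgKernel d s e (p ω - p ω')|
      ≤ Ck * 2 ^ (s + α) * ε ^ α * (oscWeight s α e w p ω ω' * |f ω'|
        + if ω' = ω then w * e ^ (-s) * |f ω| else 0) := by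
    intro ω'
    rw [← mul_sub, abs_mul]
    by_cases h : ω' = ω
    · subst h
      have h3 := hk.near (y - p ω') (by nlinarith)
      rw [sub_self, avgKernel_zero, sub_zero, oscWeight, if_pos rfl, if_pos rfl, zero_mul, zero_add]
      have h4 : e ^ (-s - α) * (ε * e) ^ α = ε ^ α * e ^ (-s) := by
        rw [Real.mul_rpow hε0 he.le, Real.rpow_sub he]
        field_simp
      calc w * (|f ω'| * |avgKernel d s e (y - p ω')|)
          ≤ w * (|f ω'| * (Ck * e ^ (-s - α) * (ε * e) ^ α)) := by
            gcongr
            exact h3.trans (by gcongr)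
        _ = Ck * 1 * ε ^ α * (w * e ^ (-s) * |f ω'|) := by rw [mul_assoc Ck, h4]; ring
        _ ≤ _ := by gcongr
    · have hsep := hB.sep ω ω' (Ne.symm h)
      set ρ := ‖p ω - p ω'‖ with hρ
      have hρ0 : 0 < ρ := by linarith
      have h5 : ρ ≤ ‖y - p ω'‖ + ‖y - p ω‖ := by
        calc ρ = ‖(y - p ω') - (y - p ω)‖ := by rw [hρ]; congr 1; abel
          _ ≤ _ := _root_.norm_sub_le _ _
      have h6 := hk.holder (ρ / 2) (by linarith) (y - p ω') (p ω - p ω') (by nlinarith)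
        (by linarith)
      rw [sub_sub_sub_cancel_right] at h6
      rw [oscWeight, if_neg h, if_neg h, add_zero, ← hρ]
      have h7 : (ρ / 2) ^ (-s - α) = 2 ^ (s + α) * ρ ^ (-(s + α)) := by
        rw [Real.div_rpow hρ0.le (by norm_num), show -s - α = -(s + α) by ring,
          Real.rpow_neg (by norm_num : (0 : ℝ) ≤ 2)]
        field_simp
      calc w * (|f ω'| * |avgKernel d s e (y - p ω') - avgKernel d s e (p ω - p ω')|)
          ≤ w * (|f ω'| * (Ck * (ρ / 2) ^ (-s - α) * (ε * e) ^ α)) := by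
            gcongr
            exact h6.trans (by gcongr)
        _ = _ := by rw [h7, Real.mul_rpow hε0 he.le]; ring
  unfold blockField
  rw [← mul_sub, ← Finset.sum_sub_distrib, abs_mul, abs_of_pos hw0]
  calc _ ≤ w * ∑ ω', |f ω' * avgKernel d s e (y - p ω') - f ω' * avgKernel d s e (p ω - p ω')| := by
        gcongr
        exact Finset.abs_sum_le_sum_abs _ _
    _ = ∑ ω', w * |f ω' * avgKernel d s e (y - p ω') - f ω' * avgKernel d s e (p ω - p ω')| :=
        Finset.mul_sum _ _ _
    _ ≤ _ := Finset.sum_le_sum fun ω' _ => key ω'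
    _ = _ := by
        rw [← Finset.mul_sum, Finset.sum_add_distrib, Finset.sum_ite_eq' Finset.univ ω,
          if_pos (Finset.mem_univ ω), oscBound]

lemma sum_abs_le : ∑ ω, w * |f ω| ≤ m * √S := by
  have hw0 := hB.w_pos
  have hS := hB.S_nonneg
  rw [← Finset.mul_sum, ← hB.mass, mul_assoc]
  refine mul_le_mul_of_nonneg_left ?_ hw0.le
  have h2 := sq_sum_le_card_mul_sum_sq (s := Finset.univ) (f := fun ω => |f ω|)
  simp only [sq_abs, Finset.card_univ] at h2
  refine le_of_sq_le_sq ?_ (by positivity)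
  calc _ ≤ _ := h2
    _ ≤ Fintype.card Ω * (Fintype.card Ω * S) := by
        gcongr
        exact hB.sum_f_sq
    _ = _ := by rw [mul_pow, Real.sq_sqrt hS]; ring

end IsRieszBlock

/-- A fixed proportion of the points of a block have a neighbourhood on which the field is
comparable with the energy. -/
theorem IsBlockConst.exists_good_points {C K : ℝ} (hc : IsBlockConst d s α Ck ck C K D c₀ q)
    (C₂ : ℝ) (hC₂ : 0 ≤ C₂) : ∃ ε c' : ℝ, 0 < ε ∧ ε ≤ 1 / 8 ∧ 0 < c' ∧
      ∀ (Ω : Type) (_ : Fintype Ω) (_ : DecidableEq Ω) (e : ℝ) (H : ℝ → ℝ) (r m : ℝ)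
        (p : Ω → EuclideanSpace ℝ (Fin d)) (f : Ω → ℝ) (w S a X b : ℝ),
        IsRieszBlock s α D c₀ q e H r m p f w S a X b → 0 < S → (w * e ^ (-s)) ^ 2 ≤ C₂ * S →
        ∃ P : Finset Ω, c' * Fintype.card Ω ≤ P.card ∧ ∀ ω ∈ P, ∀ y, ‖y - p ω‖ ≤ ε * e →
          c₀ / 8 * S ≤ blockField s e w p f y := by
  have hD := hc.D_pos
  have hα := hc.α_pos
  have hc₀ := hc.c₀_pos
  have hCk : 0 < Ck := (hc.kernel 1 one_pos).C_pos
  set V := 2 * (D ^ 2 + C₂) with hV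
  have hV0 : 0 < V := by positivity
  set γ := min 1 (c₀ / (4 * (V + 1))) with hγ
  have hγ0 : 0 < γ := by positivity
  have hγ1 : γ ≤ 1 := min_le_left _ _
  have hγ2 : γ * (V + 1) ≤ c₀ / 4 := by
    have : γ ≤ c₀ / (4 * (V + 1)) := min_le_right _ _
    rw [le_div_iff₀ (by positivity)] at this
    linarith
  set ε := min (1 / 8) ((γ / (Ck * 2 ^ (s + α))) ^ α⁻¹) with hε
  have hε0 : 0 < ε := by positivity
  have hεα : Ck * 2 ^ (s + α) * ε ^ α ≤ γ := by
    have h1 : ε ^ α ≤ γ / (Ck * 2 ^ (s + α)) := by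
      calc ε ^ α ≤ ((γ / (Ck * 2 ^ (s + α))) ^ α⁻¹) ^ α := by
            gcongr
            exact min_le_right _ _
        _ = _ := Real.rpow_inv_rpow (by positivity) hα.ne'
    rw [le_div_iff₀ (by positivity)] at h1
    linarith
  set B := 2 * (3 * D) ^ 2 + 2 * V with hBdef
  have hB0 : 0 < B := by positivity
  refine ⟨ε, (c₀ / 4) ^ 2 / (4 * B), hε0, min_le_left _ _, by positivity, ?_⟩
  intro Ω i1 i2 e H r m p f w S a X b hB hS hw
  have hn := hB.card_pos
  have hV2 : ∑ ω, oscBound s α e w p f ω ^ 2 ≤ Fintype.card Ω * (V * S ^ 2) :=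
    hB.sum_oscBound_sq_le hw
  have hX : X ≤ 2 * q * S := by
    have h1 := hB.X_le
    have h2 : 0 ≤ q * a ^ 2 := by
      have := hc.q_pos
      positivity
    linarith
  have hX' : D * X ≤ c₀ / 2 * S := by
    have h1 := hc.q_D_le
    calc D * X ≤ D * (2 * q * S) := by gcongr
      _ = (4 * q * D) / 2 * S := by ring
      _ ≤ _ := by gcongr
  have hX'' : X ≤ S / 2 := by
    have := hc.q_le
    nlinarith
  have hV1 : ∑ ω, oscBound s α e w p f ω ≤ Fintype.card Ω * ((V + 1) * S) := by
    have h2 := sq_sum_le_card_mul_sum_sq (s := Finset.univ) (f := oscBound s α e w p f)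
    rw [Finset.card_univ] at h2
    refine le_of_sq_le_sq ?_ (by positivity)
    calc _ ≤ _ := h2
      _ ≤ Fintype.card Ω * (Fintype.card Ω * (V * S ^ 2)) := by gcongr
      _ = (Fintype.card Ω * S) ^ 2 * V := by ring
      _ ≤ (Fintype.card Ω * S) ^ 2 * (V + 1) ^ 2 := by gcongr; nlinarith
      _ = _ := by ring
  have h1 : Fintype.card Ω * (c₀ / 4 * S)
      ≤ ∑ ω, (blockField s e w p f (p ω) - γ * oscBound s α e w p f ω) := by
    rw [Finset.sum_sub_distrib, ← Finset.mul_sum]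
    have h3 := hB.field_sum
    have h4 : γ * ∑ ω, oscBound s α e w p f ω ≤ Fintype.card Ω * (c₀ / 4 * S) := by
      calc _ ≤ γ * (Fintype.card Ω * ((V + 1) * S)) := by gcongr
        _ = Fintype.card Ω * (γ * (V + 1) * S) := by ring
        _ ≤ _ := by gcongr
    have h5 : Fintype.card Ω * (c₀ / 2 * S) ≤ Fintype.card Ω * (c₀ * S - D * X) := by
      gcongr
      linarith
    linarith
  have h2 : ∑ ω, (blockField s e w p f (p ω) - γ * oscBound s α e w p f ω) ^ 2
      ≤ Fintype.card Ω * (B * S ^ 2) := by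
    calc _ ≤ ∑ ω, (2 * blockField s e w p f (p ω) ^ 2 + 2 * oscBound s α e w p f ω ^ 2) := by
          refine Finset.sum_le_sum fun ω _ => ?_
          have h6 : (γ * oscBound s α e w p f ω) ^ 2 ≤ oscBound s α e w p f ω ^ 2 := by
            rw [mul_pow]
            exact mul_le_of_le_one_left (sq_nonneg _) (pow_le_one₀ hγ0.le hγ1)
          nlinarith [sq_nonneg (blockField s e w p f (p ω) + γ * oscBound s α e w p f ω)]
      _ = 2 * ∑ ω, blockField s e w p f (p ω) ^ 2 + 2 * ∑ ω, oscBound s α e w p f ω ^ 2 := by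
          rw [Finset.sum_add_distrib, Finset.mul_sum, Finset.mul_sum]
      _ ≤ 2 * (Fintype.card Ω * (4 * D ^ 2 * (S + S / 2) ^ 2))
          + 2 * (Fintype.card Ω * (V * S ^ 2)) := by
          have h7 := hB.field_sq
          have h8 := hB.X_nonneg
          gcongr
          refine h7.trans ?_
          gcongr
      _ = _ := by rw [hBdef]; ring
  obtain ⟨P, hP1, hP2⟩ := exists_finset_card_ge (by positivity) (by positivity) h1 h2
  refine ⟨P, le_trans (le_of_eq ?_) hP1, fun ω hω y hy => ?_⟩
  · field_simp
  · have h3 := hB.abs_blockField_sub_le (hc.kernel e hB.e_pos) hc.s_pos hα hε0.le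
      (min_le_left _ _) ω hy
    have h4 := hP2 ω hω
    have h5 : 0 ≤ oscBound s α e w p f ω := by
      have := hB.e_pos
      have := hB.w_pos
      refine add_nonneg (Finset.sum_nonneg fun ω' _ => ?_) (by positivity)
      unfold oscWeight
      split_ifs
      · simp
      · positivity
    have h6 := mul_le_mul_of_nonneg_right hεα h5
    have h7 := (abs_le.1 h3).1
    linarith

end GoodPoints

section Stage

variable {d : ℕ} [NeZero d] {s : ℝ}

/-- The union of the closed balls of radius `ρ` about the points of `C`. -/
def stageSet (C : Finset (EuclideanSpace ℝ (Fin d))) (ρ : ℝ) : Set (EuclideanSpace ℝ (Fin d)) :=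
  ⋃ c ∈ C, closedBall c ρ

lemma mem_stageSet {C : Finset (EuclideanSpace ℝ (Fin d))} {ρ : ℝ}
    {y : EuclideanSpace ℝ (Fin d)} : y ∈ stageSet C ρ ↔ ∃ c ∈ C, ‖y - c‖ ≤ ρ := by
  simp [stageSet, mem_closedBall, dist_eq_norm]

lemma isCompact_stageSet (C : Finset (EuclideanSpace ℝ (Fin d))) (ρ : ℝ) :
    IsCompact (stageSet C ρ) :=
  C.isCompact_biUnion fun _ _ => isCompact_closedBall _ _

/-- A finite family of balls of radius `ρ` whose normalized counting measure is controlled by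
the gauge `h`. -/
structure IsStage (h : ℝ → ℝ) (h₀ A : ℝ) (C : Finset (EuclideanSpace ℝ (Fin d))) (ρ : ℝ) :
    Prop where
  nonempty : C.Nonempty
  ρ_pos : 0 < ρ
  h₀_pos : 0 < h₀
  one_le_A : 1 ≤ A
  sep : ∀ x ∈ C, ∀ y ∈ C, x ≠ y → 6 * ρ ≤ ‖x - y‖
  mass : h₀ ≤ C.card * h ρ
  count : ∀ t, ρ ≤ t → ∀ x, ∀ T ⊆ C, (∀ c ∈ T, ‖c - x‖ ≤ t + ρ) →
    h₀ * T.card ≤ A * h t * C.card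

namespace IsBlockConst

variable {α Ck ck Cc K D c₀ q : ℝ} (hc : IsBlockConst d s α Ck ck Cc K D c₀ q)

include hc

lemma abs_blockField_le {Ω : Type} [Fintype Ω] [DecidableEq Ω] {e : ℝ} {H : ℝ → ℝ} {ρ m : ℝ}
    {p : Ω → EuclideanSpace ℝ (Fin d)} {f : Ω → ℝ} {w S a X b : ℝ}
    (hB : IsRieszBlock s α D c₀ q e H ρ m p f w S a X b) {y : EuclideanSpace ℝ (Fin d)}
    (hy : 5 * ρ ≤ ‖y‖) : |blockField s e w p f y| ≤ Ck * (4 * ρ) ^ (-s) * (m * √S) := by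
  have hw0 := hB.w_pos
  have hρ := hB.r_pos
  have hCk := (hc.kernel e hB.e_pos).C_pos
  unfold blockField
  rw [abs_mul, abs_of_pos hw0]
  calc w * |∑ ω, f ω * avgKernel d s e (y - p ω)|
      ≤ w * ∑ ω, |f ω| * (Ck * (4 * ρ) ^ (-s)) := by
        gcongr
        refine (Finset.abs_sum_le_sum_abs _ _).trans (Finset.sum_le_sum fun ω _ => ?_)
        rw [abs_mul]
        gcongr
        refine (hc.kernel e hB.e_pos).size (4 * ρ) (by linarith [hB.e_le]) _ ?_
        have h1 := norm_sub_norm_le y (p ω)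
        linarith [hB.norm_le ω]
    _ = Ck * (4 * ρ) ^ (-s) * ∑ ω, w * |f ω| := by
        rw [← Finset.sum_mul, ← Finset.mul_sum]
        ring
    _ ≤ _ := by
        gcongr
        exact hB.sum_abs_le

/-- The capacity bound obtained by placing a copy of a block at each point of a separated set. -/
lemma gammaPlus_le_of_block {Ω : Type} [Fintype Ω] [DecidableEq Ω] {e : ℝ} {H : ℝ → ℝ} {ρ m : ℝ}
    {p : Ω → EuclideanSpace ℝ (Fin d)} {f : Ω → ℝ} {w S a X b : ℝ}
    (hB : IsRieszBlock s α D c₀ q e H ρ m p f w S a X b) (hS : 0 < S) {P : Finset Ω} {ε : ℝ}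
    (hε : ε ≤ 1 / 8)
    (hP : ∀ ω ∈ P, ∀ y, ‖y - p ω‖ ≤ ε * e → c₀ / 8 * S ≤ blockField s e w p f y)
    {C : Finset (EuclideanSpace ℝ (Fin d))}
    (hsep : ∀ x ∈ C, ∀ y ∈ C, x ≠ y → 6 * ρ ≤ ‖x - y‖)
    (hfar : (C.card - 1) * (Ck * (4 * ρ) ^ (-s) * (m * √S)) ≤ c₀ / 16 * S)
    {F : Set (EuclideanSpace ℝ (Fin d))}
    (hF : ∀ y ∈ F, ∃ c ∈ C, ∃ ω ∈ P, ‖y - (c + p ω)‖ ≤ ε * e) :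
    gammaPlus d s F ≤ C.card * (16 / (c₀ * S) * (m * √S)) := by
  classical
  have hw0 := hB.w_pos
  have hρ := hB.r_pos
  have he := hB.e_pos
  have heρ := hB.e_le
  have hc₀ := hc.c₀_pos
  have hεe : ε * e ≤ e / 8 := by nlinarith
  have hdist : ∀ c ∈ C, ∀ ω, ∀ y, ‖y - (c + p ω)‖ ≤ ε * e → ∀ c' ∈ C, c ≠ c' →
      5 * ρ ≤ ‖y - c'‖ := by
    intro c hcC ω y hy c' hc' hne
    have h1 := hsep c hcC c' hc' hne
    have h2 := hB.norm_add_le ω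
    have h3 : ‖c - c'‖ ≤ ‖y - c'‖ + ‖y - (c + p ω)‖ + ‖p ω‖ := by
      have h4 : c - c' = (y - c') - (y - (c + p ω)) - p ω := by abel
      rw [h4]
      exact (norm_sub_le _ _).trans (by gcongr; exact norm_sub_le _ _)
    linarith
  refine (gammaPlus_le_of_dual (ι := C × Ω) (fun z => 16 / (c₀ * S) * (w * f z.2))
    (fun z => (z.1 : EuclideanSpace ℝ (Fin d)) + p z.2) (δ := e / 8) (e := e)
    hc.s_pos (by positivity) he ?_ ?_).trans
    (le_of_eq_of_le (b := C.card * (16 / (c₀ * S) * ∑ ω, w * |f ω|)) ?_ ?_)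
  · rintro y hy ⟨⟨c', hc'⟩, ω'⟩ a ha1 ha2
    obtain ⟨c, hcC, ω, hω, hyω⟩ := hF y hy
    have key : ‖y - (c' + p ω')‖ ≤ e / 8 ∨ e ≤ ‖y - (c' + p ω')‖ := by
      by_cases hne : c = c'
      · subst hne
        by_cases hne' : ω = ω'
        · subst hne'
          exact Or.inl (hyω.trans hεe)
        · right
          have h1 := hB.sep ω ω' hne'
          have h2 : ‖p ω - p ω'‖ ≤ ‖y - (c + p ω')‖ + ‖y - (c + p ω)‖ := by
            have h4 : p ω - p ω' = (y - (c + p ω')) - (y - (c + p ω)) := by abel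
            rw [h4]
            exact norm_sub_le _ _
          linarith
      · right
        have h1 := hdist c hcC ω y hyω c' hc' hne
        have h2 : ‖y - c'‖ - ‖p ω'‖ ≤ ‖y - (c' + p ω')‖ := by
          rw [← sub_sub]
          exact norm_sub_norm_le _ _
        linarith [hB.norm_le ω']
    rcases key with h1 | h1
    · have h2 := norm_sub_norm_le a (y - (c' + p ω'))
      rw [norm_sub_rev a] at h2
      linarith
    · have h2 := norm_sub_norm_le (y - (c' + p ω')) a
      linarith
  · intro y hy
    obtain ⟨c, hcC, ω, hω, hyω⟩ := hF y hy
    have h1 : ∑ z : C × Ω, 16 / (c₀ * S) * (w * f z.2) *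
          avgKernel d s e (y - ((z.1 : EuclideanSpace ℝ (Fin d)) + p z.2))
        = 16 / (c₀ * S) * ∑ c' ∈ C, blockField s e w p f (y - c') := by
      rw [Fintype.sum_prod_type, ← Finset.sum_coe_sort C, Finset.mul_sum]
      refine Finset.sum_congr rfl fun c' _ => ?_
      unfold blockField
      rw [Finset.mul_sum, Finset.mul_sum]
      refine Finset.sum_congr rfl fun ω' _ => ?_
      rw [sub_sub]
      ring
    rw [h1, ← Finset.add_sum_erase _ _ hcC]
    have h2 : c₀ / 8 * S ≤ blockField s e w p f (y - c) := hP ω hω _ (by rwa [sub_sub])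
    have h3 : |∑ c' ∈ C.erase c, blockField s e w p f (y - c')| ≤ c₀ / 16 * S := by
      calc _ ≤ ∑ c' ∈ C.erase c, |blockField s e w p f (y - c')| :=
            Finset.abs_sum_le_sum_abs _ _
        _ ≤ ∑ c' ∈ C.erase c, Ck * (4 * ρ) ^ (-s) * (m * √S) := by
            refine Finset.sum_le_sum fun c' hc' => ?_
            exact hc.abs_blockField_le hB (hdist c hcC ω y hyω c' (Finset.mem_of_mem_erase hc')
              (Finset.ne_of_mem_erase hc').symm)
        _ = (C.card - 1) * (Ck * (4 * ρ) ^ (-s) * (m * √S)) := by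
            rw [Finset.sum_const, Finset.card_erase_of_mem hcC, nsmul_eq_mul,
              Nat.cast_sub (Finset.card_pos.2 ⟨c, hcC⟩), Nat.cast_one]
        _ ≤ _ := hfar
    have h4 := (abs_le.1 h3).1
    calc (1 : ℝ) = 16 / (c₀ * S) * (c₀ / 16 * S) := by field_simp
      _ ≤ _ := by
        gcongr
        linarith
  · rw [Fintype.sum_prod_type]
    simp only [Finset.sum_const, Finset.card_univ, Fintype.card_coe, nsmul_eq_mul]
    rw [← Finset.mul_sum, ← mul_assoc _ w]
    congr 1
    rw [Finset.mul_sum]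
    refine Finset.sum_congr rfl fun ω _ => ?_
    rw [abs_mul, abs_mul, abs_of_pos hw0, abs_of_pos (by positivity), mul_assoc]
  · gcongr
    exact hB.sum_abs_le

end IsBlockConst

end Stage

section Content

variable {d : ℕ} [NeZero d] {h : ℝ → ℝ} {h₀ A : ℝ} {C : Finset (EuclideanSpace ℝ (Fin d))} {ρ : ℝ}

lemma volume_closedBall_eq (x : EuclideanSpace ℝ (Fin d)) {r : ℝ} (hr : 0 ≤ r) :
    volume (closedBall x r)
      = ENNReal.ofReal (r ^ d * volume.real (ball (0 : EuclideanSpace ℝ (Fin d)) 1)) := by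
  rw [← volume_real_closedBall x hr, ofReal_measureReal measure_closedBall_lt_top.ne]

namespace IsStage

variable (hC : IsStage h h₀ A C ρ)

include hC

lemma volume_stageSet : volume (stageSet C ρ)
    = ENNReal.ofReal (C.card * (ρ ^ d * volume.real (ball (0 : EuclideanSpace ℝ (Fin d)) 1))) := by
  unfold stageSet
  rw [measure_biUnion_finset _ fun _ _ => measurableSet_closedBall]
  · simp only [volume_closedBall_eq _ hC.ρ_pos.le, Finset.sum_const, nsmul_eq_mul]
    rw [ENNReal.ofReal_mul (Nat.cast_nonneg _), ENNReal.ofReal_natCast]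
  · intro x hx y hy hxy
    refine closedBall_disjoint_closedBall ?_
    rw [dist_eq_norm]
    linarith [hC.sep x hx y hy hxy, hC.ρ_pos]

lemma volume_inter_le (hh : IsMeasureFunction d h) (x : EuclideanSpace ℝ (Fin d)) {t : ℝ}
    (ht : 0 < t) : volume (stageSet C ρ ∩ closedBall x t) ≤ ENNReal.ofReal (h t * (A / h₀ *
      (C.card * (ρ ^ d * volume.real (ball (0 : EuclideanSpace ℝ (Fin d)) 1))))) := by
  classical
  have hρ := hC.ρ_pos
  have h0 := hC.h₀_pos
  have hA := hC.one_le_A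
  have hht := hh.pos ht
  set v := volume.real (ball (0 : EuclideanSpace ℝ (Fin d)) 1) with hv
  have hv0 : 0 < v := volume_real_ball_pos
  rcases le_or_gt ρ t with hρt | hρt
  · set T := C.filter fun c => ‖c - x‖ ≤ t + ρ with hT
    have h1 : stageSet C ρ ∩ closedBall x t ⊆ ⋃ c ∈ T, closedBall c ρ := by
      rintro y ⟨hy, hyx⟩
      obtain ⟨c, hc, hyc⟩ := mem_stageSet.1 hy
      rw [mem_closedBall, dist_eq_norm] at hyx
      refine mem_iUnion₂.2 ⟨c, Finset.mem_filter.2 ⟨hc, ?_⟩, by rwa [mem_closedBall, dist_eq_norm]⟩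
      have h2 : c - x = (y - x) - (y - c) := by abel
      rw [h2]
      exact (norm_sub_le _ _).trans (by gcongr)
    have h2 := hC.count t hρt x T (Finset.filter_subset _ _)
      fun c hc => (Finset.mem_filter.1 hc).2
    calc _ ≤ volume (⋃ c ∈ T, closedBall c ρ) := measure_mono h1
      _ ≤ ∑ c ∈ T, volume (closedBall c ρ) := measure_biUnion_finset_le _ _
      _ = ENNReal.ofReal (T.card * (ρ ^ d * v)) := by
          simp only [volume_closedBall_eq _ hρ.le, Finset.sum_const, nsmul_eq_mul]
          rw [ENNReal.ofReal_mul (Nat.cast_nonneg _), ENNReal.ofReal_natCast]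
      _ ≤ _ := by
          refine ENNReal.ofReal_le_ofReal ?_
          have h3 : (T.card : ℝ) ≤ A * h t * C.card / h₀ := by
            rw [le_div_iff₀ h0]
            linarith
          calc _ ≤ A * h t * C.card / h₀ * (ρ ^ d * v) := by gcongr
            _ = _ := by ring
  · calc _ ≤ volume (closedBall x t) := measure_mono inter_subset_right
      _ = ENNReal.ofReal (t ^ d * v) := volume_closedBall_eq _ ht.le
      _ ≤ _ := by
          refine ENNReal.ofReal_le_ofReal ?_
          have h1 := hh.mul_div_pow_le ht hρt.le
          have h2 : h₀ * (t / ρ) ^ d ≤ A * (h t * C.card) := by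
            calc h₀ * (t / ρ) ^ d ≤ C.card * h ρ * (t / ρ) ^ d := by
                  gcongr
                  exact hC.mass
              _ = C.card * (h ρ * (t / ρ) ^ d) := by ring
              _ ≤ C.card * h t := by gcongr
              _ = 1 * (h t * C.card) := by ring
              _ ≤ _ := by gcongr
          calc t ^ d * v = h₀ * (t / ρ) ^ d / h₀ * (ρ ^ d * v) := by
                rw [div_pow]; field_simp
            _ ≤ A * (h t * C.card) / h₀ * (ρ ^ d * v) := by gcongr
            _ = _ := by ring

/-- Any covering of a stage by balls has total gauge at least a fixed amount. -/
lemma le_tsum (hh : IsMeasureFunction d h) {x : ℕ → EuclideanSpace ℝ (Fin d)} {r : ℕ → ℝ}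
    (hr : ∀ j, 0 < r j) (hcov : stageSet C ρ ⊆ ⋃ j, closedBall (x j) (r j)) :
    ENNReal.ofReal (h₀ / A) ≤ ∑' j, ENNReal.ofReal (h (r j)) := by
  have h0 := hC.h₀_pos
  have hA : 0 < A := by linarith [hC.one_le_A]
  have hρ := hC.ρ_pos
  have hv0 : 0 < volume.real (ball (0 : EuclideanSpace ℝ (Fin d)) 1) := volume_real_ball_pos
  have hn : 0 < (C.card : ℝ) := Nat.cast_pos.2 hC.nonempty.card_pos
  set V := C.card * (ρ ^ d * volume.real (ball (0 : EuclideanSpace ℝ (Fin d)) 1)) with hV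
  have hV0 : 0 < V := by positivity
  have h1 : ENNReal.ofReal V ≤ (∑' j, ENNReal.ofReal (h (r j))) * ENNReal.ofReal (A / h₀ * V) := by
    rw [← hC.volume_stageSet, ← ENNReal.tsum_mul_right]
    calc volume (stageSet C ρ) ≤ volume (⋃ j, stageSet C ρ ∩ closedBall (x j) (r j)) := by
          refine measure_mono ?_
          rw [← inter_iUnion]
          exact subset_inter le_rfl hcov
      _ ≤ ∑' j, volume (stageSet C ρ ∩ closedBall (x j) (r j)) := measure_iUnion_le _
      _ ≤ _ := by
          refine ENNReal.tsum_le_tsum fun j => ?_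
          rw [← ENNReal.ofReal_mul (hh.pos (hr j)).le]
          exact hC.volume_inter_le hh (x j) (hr j)
  have h2 : ENNReal.ofReal V = ENNReal.ofReal (h₀ / A) * ENNReal.ofReal (A / h₀ * V) := by
    rw [← ENNReal.ofReal_mul (by positivity)]
    congr 1
    field_simp
  rw [h2] at h1
  exact (ENNReal.mul_le_mul_iff_left (by simp; positivity) ENNReal.ofReal_ne_top).1 h1

lemma le_hContent (hh : IsMeasureFunction d h) :
    ENNReal.ofReal (h₀ / A) ≤ hContent d h (stageSet C ρ) :=
  le_iInf₂ fun _ _ => le_iInf₂ fun hr hcov => hC.le_tsum hh hr hcov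

end IsStage

/-- A summable family of small gauges. -/
lemma exists_pos_seq {η : ℝ≥0∞} (hη : η ≠ 0) :
    ∃ y : ℕ → ℝ, (∀ j, 0 < y j) ∧ ∑' j, ENNReal.ofReal (y j) ≤ η := by
  obtain ⟨y, hy, hsum⟩ := ENNReal.exists_pos_sum_of_countable hη ℕ
  refine ⟨fun j => y j, fun j => NNReal.coe_pos.2 (hy j), ?_⟩
  simpa only [ENNReal.ofReal_coe_nnreal] using hsum.le

/-- A set contained in the unit ball has content at most `h 1`. -/
lemma hContent_le_of_subset (hh : IsMeasureFunction d h) {E : Set (EuclideanSpace ℝ (Fin d))}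
    (hE : E ⊆ closedBall 0 1) : hContent d h E ≤ ENNReal.ofReal (h 1) := by
  refine ENNReal.le_of_forall_pos_le_add fun η hη _ => ?_
  obtain ⟨y, hy0, hy⟩ := exists_pos_seq (ENNReal.coe_ne_zero.2 hη.ne')
  choose ρ hρ0 hρ using fun j => hh.exists_eq (hy0 j)
  set r : ℕ → ℝ := fun j => Nat.casesOn j 1 ρ with hr
  calc hContent d h E ≤ ∑' j, ENNReal.ofReal (h (r j)) := by
        refine iInf₂_le_of_le (fun _ => 0) r (iInf₂_le (Nat.rec one_pos fun j _ => hρ0 j) ?_)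
        exact hE.trans (subset_iUnion (fun j => closedBall 0 (r j)) 0)
    _ = ENNReal.ofReal (h 1) + ∑' j, ENNReal.ofReal (y j) := by
        rw [tsum_eq_zero_add' ENNReal.summable]
        congr 1
        simp only [hr, hρ]
    _ ≤ _ := by gcongr

/-- The content lower bound passes to decreasing intersections of compact sets. -/
lemma le_hContent_iInter (hh : IsMeasureFunction d h) {E : ℕ → Set (EuclideanSpace ℝ (Fin d))}
    (hE : ∀ i, IsCompact (E i)) (hanti : ∀ i, E (i + 1) ⊆ E i) {a : ℝ≥0∞}
    (ha : ∀ i, ∀ (x : ℕ → EuclideanSpace ℝ (Fin d)) (r : ℕ → ℝ), (∀ j, 0 < r j) →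
      E i ⊆ ⋃ j, closedBall (x j) (r j) → a ≤ ∑' j, ENNReal.ofReal (h (r j))) :
    a ≤ hContent d h (⋂ i, E i) := by
  refine le_iInf₂ fun x r => le_iInf₂ fun hr hcov => ?_
  refine ENNReal.le_of_forall_pos_le_add fun η hη _ => ?_
  obtain ⟨y, hy0, hy⟩ := exists_pos_seq (ENNReal.coe_ne_zero.2 hη.ne')
  choose ρ hρ0 hρ using fun j => hh.exists_eq (add_pos (hh.pos (hr j)) (hy0 j))
  have hlt : ∀ j, r j < ρ j := fun j => hh.lt_of_lt (hρ0 j).le (by rw [hρ]; linarith [hy0 j])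
  obtain ⟨i, hi⟩ := exists_subset_nhds_of_isCompact
    (antitone_nat_of_succ_le hanti).directed_ge hE (U := ⋃ j, ball (x j) (ρ j)) fun y hyE => by
      refine (isOpen_iUnion fun j => isOpen_ball).mem_nhds ?_
      obtain ⟨j, hj⟩ := mem_iUnion.1 (hcov hyE)
      exact mem_iUnion.2 ⟨j, closedBall_subset_ball (hlt j) hj⟩
  calc a ≤ ∑' j, ENNReal.ofReal (h (ρ j)) := ha i x ρ hρ0
        (hi.trans (iUnion_mono fun j => ball_subset_closedBall))
    _ = ∑' j, ENNReal.ofReal (h (r j)) + ∑' j, ENNReal.ofReal (y j) := by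
        rw [← ENNReal.tsum_add]
        congr 1
        ext j
        rw [hρ, ENNReal.ofReal_add (hh.pos (hr j)).le (hy0 j).le]
    _ ≤ _ := by gcongr

end Content

section NextStage

variable {d : ℕ} [NeZero d] {s : ℝ} {h : ℝ → ℝ} {h₀ A : ℝ}
  {C : Finset (EuclideanSpace ℝ (Fin d))} {ρ : ℝ}

open Classical in
/-- The centres obtained by translating the points `p ω`, `ω ∈ P`, by the points of `C`. -/
def nextCentres {Ω : Type} (C : Finset (EuclideanSpace ℝ (Fin d))) (P : Finset Ω)
    (p : Ω → EuclideanSpace ℝ (Fin d)) : Finset (EuclideanSpace ℝ (Fin d)) :=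
  (C ×ˢ P).image fun z => z.1 + p z.2

lemma mem_nextCentres {Ω : Type} {P : Finset Ω} {p : Ω → EuclideanSpace ℝ (Fin d)}
    {x : EuclideanSpace ℝ (Fin d)} :
    x ∈ nextCentres C P p ↔ ∃ c ∈ C, ∃ ω ∈ P, c + p ω = x := by
  classical
  unfold nextCentres
  rw [Finset.mem_image]
  constructor
  · rintro ⟨⟨c, ω⟩, hz, rfl⟩
    exact ⟨c, (Finset.mem_product.1 hz).1, ω, (Finset.mem_product.1 hz).2, rfl⟩
  · rintro ⟨c, hc, ω, hω, rfl⟩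
    exact ⟨(c, ω), Finset.mem_product.2 ⟨hc, hω⟩, rfl⟩

namespace IsStage

variable (hst : IsStage h h₀ A C ρ) {Ω : Type} [Fintype Ω] [DecidableEq Ω] {α D c₀ q e : ℝ}
  {H : ℝ → ℝ} {p : Ω → EuclideanSpace ℝ (Fin d)} {f : Ω → ℝ} {w S a X b : ℝ}
  (hB : IsRieszBlock s α D c₀ q e H ρ (h₀ / C.card) p f w S a X b) {ε : ℝ}

include hst

lemma card_pos : 0 < (C.card : ℝ) := Nat.cast_pos.2 hst.nonempty.card_pos

include hB

lemma e_le_norm_sub {c c' : EuclideanSpace ℝ (Fin d)} (hc : c ∈ C) (hc' : c' ∈ C) {ω ω' : Ω}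
    (hne : (c, ω) ≠ (c', ω')) : 4 * e ≤ ‖(c + p ω) - (c' + p ω')‖ := by
  have he := hB.e_pos
  by_cases hcc : c = c'
  · subst hcc
    have h1 := hB.sep ω ω' fun hω => hne (by rw [hω])
    rw [add_sub_add_left_eq_sub]
    linarith
  · have h1 := hst.sep c hc c' hc' hcc
    have h2 : c - c' = ((c + p ω) - (c' + p ω')) - (p ω - p ω') := by abel
    have h3 := norm_sub_le ((c + p ω) - (c' + p ω')) (p ω - p ω')
    rw [← h2] at h3
    linarith [hB.norm_sub_le ω ω', hB.e_le]

lemma card_nextCentres (P : Finset Ω) : (nextCentres C P p).card = C.card * P.card := by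
  classical
  unfold nextCentres
  rw [Finset.card_image_of_injOn, Finset.card_product]
  rintro ⟨c, ω⟩ hz ⟨c', ω'⟩ hz' heq
  have hz := Finset.mem_product.1 (Finset.mem_coe.1 hz)
  have hz' := Finset.mem_product.1 (Finset.mem_coe.1 hz')
  by_contra hne
  have h1 := hst.e_le_norm_sub hB hz.1 hz'.1 hne
  have h2 : c + p ω = c' + p ω' := heq
  rw [h2, sub_self, norm_zero] at h1
  linarith [hB.e_pos]

lemma stageSet_nextCentres_subset (hε : ε ≤ 1 / 8) (P : Finset Ω) :
    stageSet (nextCentres C P p) (ε * e) ⊆ stageSet C ρ := by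
  intro y hy
  obtain ⟨x, hx, hyx⟩ := mem_stageSet.1 hy
  obtain ⟨c, hc, ω, -, rfl⟩ := mem_nextCentres.1 hx
  refine mem_stageSet.2 ⟨c, hc, ?_⟩
  have h1 : y - c = (y - (c + p ω)) + p ω := by abel
  rw [h1]
  have he := hB.e_pos
  have h2 : ε * e ≤ e := by nlinarith
  exact (norm_add_le _ _).trans (by linarith [hB.norm_add_le ω])

/-- The parents of a set of centres contained in a large ball. -/
lemma card_le_of_large {P : Finset Ω} (hε : ε ≤ 1 / 8) {t : ℝ}
    (ht : ρ ≤ t) (x : EuclideanSpace ℝ (Fin d)) {T : Finset (EuclideanSpace ℝ (Fin d))}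
    (hT : T ⊆ nextCentres C P p) (hTx : ∀ c ∈ T, ‖c - x‖ ≤ t + ε * e) :
    h₀ * T.card ≤ A * h t * C.card * P.card := by
  classical
  have he := hB.e_pos
  have h0 := hst.h₀_pos
  set T₀ := C.filter fun c => ‖c - x‖ ≤ t + ρ with hT₀
  have h1 : T ⊆ nextCentres T₀ P p := by
    intro z hz
    obtain ⟨c, hc, ω, hω, rfl⟩ := mem_nextCentres.1 (hT hz)
    refine mem_nextCentres.2 ⟨c, Finset.mem_filter.2 ⟨hc, ?_⟩, ω, hω, rfl⟩
    have h2 : c - x = (c + p ω - x) - p ω := by abel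
    rw [h2]
    have h3 : ε * e ≤ e := by nlinarith
    exact (norm_sub_le _ _).trans (by linarith [hB.norm_add_le ω, hTx _ hz])
  have h2 : T.card ≤ T₀.card * P.card := by
    refine (Finset.card_le_card h1).trans ?_
    unfold nextCentres
    exact Finset.card_image_le.trans (Finset.card_product _ _).le
  have h3 := hst.count t ht x T₀ (Finset.filter_subset _ _) fun c hc => (Finset.mem_filter.1 hc).2
  calc h₀ * T.card ≤ h₀ * (T₀.card * P.card) := by
        gcongr
        exact_mod_cast h2
    _ = h₀ * T₀.card * P.card := by ring
    _ ≤ _ := by gcongr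

/-- Centres contained in a small ball have a common parent. -/
lemma exists_parent {P : Finset Ω} (hε : ε ≤ 1 / 8) {t : ℝ} (ht : t ≤ ρ)
    (x : EuclideanSpace ℝ (Fin d)) {T : Finset (EuclideanSpace ℝ (Fin d))} (hT0 : T.Nonempty)
    (hT : T ⊆ nextCentres C P p) (hTx : ∀ c ∈ T, ‖c - x‖ ≤ t + ε * e) :
    ∃ c ∈ C, ∃ Q ⊆ P, T.card ≤ Q.card ∧ ∀ ω ∈ Q, ‖p ω - (x - c)‖ ≤ t + ε * e := by
  classical
  have he := hB.e_pos
  have hεe : ε * e ≤ e / 8 := by nlinarith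
  obtain ⟨z₀, hz₀⟩ := hT0
  obtain ⟨c, hc, ω₀, hω₀, rfl⟩ := mem_nextCentres.1 (hT hz₀)
  refine ⟨c, hc, P.filter fun ω => ‖p ω - (x - c)‖ ≤ t + ε * e, Finset.filter_subset _ _, ?_,
    fun ω hω => (Finset.mem_filter.1 hω).2⟩
  refine (Finset.card_le_card (t := (P.filter fun ω => ‖p ω - (x - c)‖ ≤ t + ε * e).image
    fun ω => c + p ω) ?_).trans Finset.card_image_le
  intro z hz
  obtain ⟨c', hc', ω, hω, rfl⟩ := mem_nextCentres.1 (hT hz)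
  have h1 := hTx _ hz
  have h2 := hTx _ hz₀
  have hcc : c' = c := by
    by_contra hne
    have h3 := hst.sep c' hc' c hc hne
    have h4 : c' - c = ((c' + p ω - x) - (c + p ω₀ - x)) - (p ω - p ω₀) := by abel
    have h5 : ‖c' - c‖ ≤ ‖c' + p ω - x‖ + ‖c + p ω₀ - x‖ + ‖p ω - p ω₀‖ := by
      rw [h4]
      exact (norm_sub_le _ _).trans (by gcongr; exact norm_sub_le _ _)
    have h6 := hB.norm_sub_le ω ω₀
    linarith [hB.e_le]
  subst hcc
  refine Finset.mem_image.2 ⟨ω, Finset.mem_filter.2 ⟨hω, ?_⟩, rfl⟩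
  have h3 : p ω - (x - c') = c' + p ω - x := by abel
  rwa [h3]

/-- Selecting a proportion of the points of a block placed at each centre of a stage produces a
new stage. -/
lemma next (hh : IsMeasureFunction d h) {c' : ℝ} (hc' : 0 < c') (hε0 : 0 < ε) (hε : ε ≤ 1 / 8)
    {P : Finset Ω} (hP : c' * Fintype.card Ω ≤ P.card) (hw : w ≤ c' * h (ε * e))
    (hH : ∀ R, e ≤ R → H (2 * R) ≤ c' * A * h R) :
    IsStage h h₀ A (nextCentres C P p) (ε * e) := by
  have he := hB.e_pos
  have h0 := hst.h₀_pos
  have hA := hst.one_le_A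
  have hn := hst.card_pos
  have hΩ := hB.card_pos
  have hw0 := hB.w_pos
  have hεe : ε * e ≤ e / 8 := by nlinarith
  have hεe0 : 0 < ε * e := by positivity
  have hP0 : 0 < (P.card : ℝ) := lt_of_lt_of_le (by positivity) hP
  have hPne : P.Nonempty := Finset.card_pos.1 (Nat.cast_pos.1 hP0)
  have hmass : h₀ = C.card * (w * Fintype.card Ω) := by
    rw [hB.mass]
    field_simp
  have hmass' : h₀ ≤ C.card * P.card * h (ε * e) := by
    have h1 := hh.pos hεe0
    calc h₀ = C.card * (w * Fintype.card Ω) := hmass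
      _ ≤ C.card * (c' * h (ε * e) * Fintype.card Ω) := by gcongr
      _ = C.card * ((c' * Fintype.card Ω) * h (ε * e)) := by ring
      _ ≤ C.card * (P.card * h (ε * e)) := by gcongr
      _ = _ := by ring
  refine ⟨?_, hεe0, h0, hA, ?_, ?_, ?_⟩
  · obtain ⟨c, hc⟩ := hst.nonempty
    obtain ⟨ω, hω⟩ := hPne
    exact ⟨_, mem_nextCentres.2 ⟨c, hc, ω, hω, rfl⟩⟩
  · intro x hx y hy hxy
    obtain ⟨c, hc, ω, -, rfl⟩ := mem_nextCentres.1 hx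
    obtain ⟨c', hc', ω', -, rfl⟩ := mem_nextCentres.1 hy
    have h1 := hst.e_le_norm_sub hB hc hc' (ω := ω) (ω' := ω') (by
      intro heq
      rw [Prod.mk.injEq] at heq
      exact hxy (by rw [heq.1, heq.2]))
    linarith
  · rw [hst.card_nextCentres hB]
    push_cast
    exact hmass'
  · intro t ht x T hT hTx
    rw [hst.card_nextCentres hB]
    push_cast
    have hht := hh.pos (hεe0.trans_le ht)
    rcases le_or_gt ρ t with hρt | hρt
    · exact (hst.card_le_of_large hB hε hρt x hT hTx).trans (le_of_eq (by ring))
    rcases T.eq_empty_or_nonempty with rfl | hT0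
    · simp only [Finset.card_empty, Nat.cast_zero, mul_zero]
      positivity
    obtain ⟨c, hc, Q, hQ, hTQ, hQx⟩ := hst.exists_parent hB hε hρt.le x hT0 hT hTx
    have hTQ' : (T.card : ℝ) ≤ Q.card := by exact_mod_cast hTQ
    rcases le_or_gt e t with het | het
    · have h1 := hB.count Q (x - c) (2 * t) (by linarith) fun ω hω => (hQx ω hω).trans (by linarith)
      calc h₀ * T.card ≤ h₀ * Q.card := by gcongr
        _ = C.card * (w * Q.card) * Fintype.card Ω := by rw [hmass]; ring
        _ ≤ C.card * (c' * A * h t) * Fintype.card Ω :=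
            mul_le_mul_of_nonneg_right (mul_le_mul_of_nonneg_left (h1.trans (hH t het)) hn.le) hΩ.le
        _ = C.card * (A * h t) * (c' * Fintype.card Ω) := by ring
        _ ≤ C.card * (A * h t) * P.card := by gcongr
        _ = _ := by ring
    · have h1 : Q.card ≤ 1 := by
        rw [Finset.card_le_one]
        intro ω hω ω' hω'
        by_contra hne
        have h2 := hB.sep ω ω' hne
        have h3 : p ω - p ω' = (p ω - (x - c)) - (p ω' - (x - c)) := by abel
        have h4 := norm_sub_le (p ω - (x - c)) (p ω' - (x - c))
        rw [← h3] at h4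
        linarith [hQx ω hω, hQx ω' hω']
      have h2 : (T.card : ℝ) ≤ 1 := hTQ'.trans (by exact_mod_cast h1)
      have h3 := hh.le_of_le hεe0.le ht
      calc h₀ * T.card ≤ h₀ * 1 := by gcongr
        _ ≤ C.card * P.card * h (ε * e) := by rw [mul_one]; exact hmass'
        _ ≤ C.card * P.card * h t := by gcongr
        _ = 1 * h t * (C.card * P.card) := by ring
        _ ≤ _ := by gcongr

end IsStage

end NextStage

section Construction

variable {d : ℕ} [NeZero d] {s : ℝ} {α Ck ck Cc K D c₀ q : ℝ}

lemma IsRieszBlock.mono_count {Ω : Type} [Fintype Ω] [DecidableEq Ω] {e : ℝ} {H H' : ℝ → ℝ}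
    {r m : ℝ} {p : Ω → EuclideanSpace ℝ (Fin d)} {f : Ω → ℝ} {w S a X b : ℝ}
    (hB : IsRieszBlock s α D c₀ q e H r m p f w S a X b) (hH : ∀ R, e ≤ R → H R ≤ H' R) :
    IsRieszBlock s α D c₀ q e H' r m p f w S a X b :=
  { hB with count := fun t x R hR ht => (hB.count t x R hR ht).trans (hH R hR) }

lemma isStage_singleton {h : ℝ → ℝ} (hh : IsMeasureFunction d h) {h₀ A : ℝ} (h0 : 0 < h₀)
    (h1 : h₀ ≤ h 1) (hA : 1 ≤ A) : IsStage h h₀ A {(0 : EuclideanSpace ℝ (Fin d))} 1 where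
  nonempty := Finset.singleton_nonempty _
  ρ_pos := one_pos
  h₀_pos := h0
  one_le_A := hA
  sep := by
    intro x hx y hy hxy
    rw [Finset.mem_singleton] at hx hy
    exact absurd (hx.trans hy.symm) hxy
  mass := by simpa using h1
  count := by
    intro t ht x T hT _
    have h2 := Finset.card_le_card hT
    rw [Finset.card_singleton] at h2
    have h3 : (T.card : ℝ) ≤ 1 := by exact_mod_cast h2
    have h4 := hh.le_of_le zero_le_one ht
    have h5 := hh.pos one_pos
    rw [Finset.card_singleton, Nat.cast_one, mul_one]
    calc h₀ * T.card ≤ h₀ * 1 := by gcongr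
      _ ≤ 1 * h t := by linarith
      _ ≤ A * h t := by gcongr; linarith

lemma stageSet_singleton_subset :
    stageSet {(0 : EuclideanSpace ℝ (Fin d))} 1 ⊆ closedBall 0 1 := by
  simp [stageSet]

lemma integral_const_mul_gauge (h : ℝ → ℝ) (l δ r : ℝ) :
    ∫ t in δ..r, (l * h t / t ^ s) ^ 2 / t = l ^ 2 * ∫ t in δ..r, (h t / t ^ s) ^ 2 / t := by
  rw [← intervalIntegral.integral_const_mul]
  congr 1
  ext t
  ring

namespace IsBlockConst

variable (hc : IsBlockConst d s α Ck ck Cc K D c₀ q)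

include hc

/-- The passage from a stage to the next one inside given blocks. -/
lemma exists_next : ∃ l A : ℝ, 0 < l ∧ l ≤ 1 ∧ 1 ≤ A ∧ ∀ (h : ℝ → ℝ), IsMeasureFunction d h →
    ∀ (h₀ : ℝ) (C : Finset (EuclideanSpace ℝ (Fin d))) (ρ : ℝ), IsStage h h₀ A C ρ →
    ∀ (Ω : Type) (_ : Fintype Ω) (_ : DecidableEq Ω) (e : ℝ) (p : Ω → EuclideanSpace ℝ (Fin d))
      (f : Ω → ℝ) (w S a X b : ℝ),
      IsRieszBlock s α D c₀ q e (fun R => Cc * (K + 2 ^ d) * h R) ρ (h₀ / C.card) p f w S a X b →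
      0 < S → w ≤ K * (l * h e) → (w * e ^ (-s)) ^ 2 ≤ (2 * K) ^ (2 * s) * S →
      ∃ (C' : Finset (EuclideanSpace ℝ (Fin d))) (ρ' : ℝ), IsStage h h₀ A C' ρ' ∧
        stageSet C' ρ' ⊆ stageSet C ρ ∧
        ((C.card - 1) * (Ck * (4 * ρ) ^ (-s) * (h₀ / C.card * √S)) ≤ c₀ / 16 * S →
          ∀ F ⊆ stageSet C' ρ', gammaPlus d s F ≤ 16 * h₀ / (c₀ * √S)) := by
  have hK := hc.one_le_K
  have hCc := hc.one_le_C
  have hc₀ := hc.c₀_pos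
  obtain ⟨ε, c', hε0, hε, hc', hgood⟩ := hc.exists_good_points ((2 * K) ^ (2 * s)) (by positivity)
  refine ⟨min 1 (c' * ε ^ d / K), max 1 (Cc * (K + 2 ^ d) * 2 ^ d / c'), by positivity,
    min_le_left _ _, le_max_left _ _, ?_⟩
  intro h hh h₀ C ρ hst Ω i1 i2 e p f w S a X b hB hS hw hwe
  have he := hB.e_pos
  obtain ⟨P, hP, hfield⟩ := hgood Ω i1 i2 e _ ρ _ p f w S a X b hB hS hwe
  refine ⟨nextCentres C P p, ε * e, hst.next hB hh hc' hε0 hε hP ?_ ?_,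
    hst.stageSet_nextCentres_subset hB hε P, ?_⟩
  · have h1 := hh.mul_div_pow_le (show 0 < ε * e by positivity) (show ε * e ≤ e by nlinarith)
    rw [mul_div_cancel_right₀ _ he.ne'] at h1
    have h2 := hh.pos he
    calc w ≤ K * (min 1 (c' * ε ^ d / K) * h e) := hw
      _ ≤ K * (c' * ε ^ d / K * h e) := by
          gcongr
          exact min_le_right _ _
      _ = c' * (h e * ε ^ d) := by field_simp
      _ ≤ _ := by gcongr
  · intro R hR
    have hR0 : 0 < R := he.trans_le hR
    have h1 := hh.apply_mul_le hR0 (c := 2) (by norm_num)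
    have h2 := hh.pos hR0
    calc Cc * (K + 2 ^ d) * h (2 * R) ≤ Cc * (K + 2 ^ d) * (2 ^ d * h R) := by gcongr
      _ = c' * (Cc * (K + 2 ^ d) * 2 ^ d / c') * h R := by field_simp
      _ ≤ _ := by
          gcongr
          exact le_max_right _ _
  · intro hfar F hF
    have hn := hst.card_pos
    refine (hc.gammaPlus_le_of_block hB hS hε hfield hst.sep hfar fun y hy => ?_).trans
      (le_of_eq ?_)
    · obtain ⟨x, hx, hyx⟩ := mem_stageSet.1 (hF hy)
      obtain ⟨c, hcC, ω, hω, rfl⟩ := mem_nextCentres.1 hx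
      exact ⟨c, hcC, ω, hω, hyx⟩
    · have h1 : 0 < √S := Real.sqrt_pos.2 hS
      nth_rewrite 1 [← Real.mul_self_sqrt hS.le]
      field_simp

/-- The extremal set for a gauge with a finite square function. -/
lemma exists_compact_of_integral_pos : ∃ B κ : ℝ, 0 < B ∧ 0 < κ ∧
    ∀ (h : ℝ → ℝ), IsMeasureFunction d h → ∀ δ, 0 < δ →
      0 < ∫ t in δ..1, (h t / t ^ s) ^ 2 / t →
      ∃ E : Set (EuclideanSpace ℝ (Fin d)), IsCompact E ∧ E ⊆ closedBall 0 1 ∧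
        ENNReal.ofReal (κ * h 1) ≤ hContent d h E ∧
        gammaPlus d s E ≤ B * h 1 / √(∫ t in δ..1, (h t / t ^ s) ^ 2 / t) := by
  obtain ⟨l, A, hl0, hl1, hA, hnext⟩ := hc.exists_next
  have hc₀ := hc.c₀_pos
  have hs := hc.s_pos
  have hK := hc.one_le_K
  have hCc := hc.one_le_C
  have hds : 0 < (d : ℝ) - s := sub_pos.2 hc.s_lt
  set B' := 2 * K ^ 2 / (d - s) + 2 / s with hB'
  have hB'0 : 0 < B' := by positivity
  refine ⟨16 * √(2 * B') / c₀, l / A, by positivity, by positivity, fun h hh δ hδ hJ => ?_⟩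
  have h1 := hh.pos one_pos
  set J := ∫ t in δ..1, (h t / t ^ s) ^ 2 / t with hJdef
  obtain ⟨Ω, i1, i2, e, p, f, w, S, a, X, b, hB, hw, hwe, hS, hint⟩ :=
    hc.exists_block (hh.const_mul hl0) hδ one_pos
  have hS0 : 0 < S := lt_of_lt_of_le (by positivity) hS
  have he := hB.e_pos
  have hst : IsStage h (l * h 1) A {(0 : EuclideanSpace ℝ (Fin d))} 1 :=
    isStage_singleton hh (by positivity) (mul_le_of_le_one_left h1.le hl1) hA
  have hB2 : IsRieszBlock s α D c₀ q e (fun R => Cc * (K + 2 ^ d) * h R) 1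
      (l * h 1 / ({(0 : EuclideanSpace ℝ (Fin d))} : Finset _).card) p f w S a X b := by
    rw [Finset.card_singleton, Nat.cast_one, div_one]
    refine hB.mono_count fun R hR => ?_
    have h2 := hh.pos (he.trans_le hR)
    exact mul_le_mul_of_nonneg_left (mul_le_of_le_one_left h2.le hl1) (by positivity)
  obtain ⟨C', ρ', hst', hsub, hγ⟩ := hnext h hh _ _ _ hst Ω i1 i2 e p f w S a X b hB2 hS0 hw hwe
  refine ⟨stageSet C' ρ', isCompact_stageSet _ _, hsub.trans stageSet_singleton_subset, ?_, ?_⟩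
  · rw [div_mul_eq_mul_div]
    exact hst'.le_hContent hh
  · refine (hγ ?_ _ le_rfl).trans ?_
    · rw [Finset.card_singleton, Nat.cast_one, sub_self, zero_mul]
      positivity
    · rw [integral_const_mul_gauge, ← hJdef] at hint
      have h2 : l ^ 2 * J ≤ 2 * B' * S := by
        refine hint.trans ?_
        calc _ ≤ B' * (2 * S) := by
              gcongr
              linarith [sq_nonneg (l * h 1 * 1 ^ (-s))]
          _ = _ := by ring
      have h3 : l * √J ≤ √(2 * B') * √S := by
        rw [← Real.sqrt_mul (by positivity), ← Real.sqrt_sq hl0.le, ← Real.sqrt_mul (by positivity)]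
        exact Real.sqrt_le_sqrt h2
      have hSs : 0 < √S := Real.sqrt_pos.2 hS0
      have hJs : 0 < √J := Real.sqrt_pos.2 hJ
      rw [div_le_div_iff₀ (by positivity) hJs]
      calc 16 * (l * h 1) * √J = 16 * h 1 * (l * √J) := by ring
        _ ≤ 16 * h 1 * (√(2 * B') * √S) := by gcongr
        _ = _ := by field_simp

/-- A block in a ball of radius `ρ` and mass at most `h ρ`, with arbitrarily large energy, when the
square function of the gauge diverges. -/
lemma exists_large_block {h : ℝ → ℝ} (hh : IsMeasureFunction d h)
    (hinf : ∀ L, ∃ δ, 0 < δ ∧ L ≤ ∫ t in δ..1, (h t / t ^ s) ^ 2 / t) {l : ℝ} (hl0 : 0 < l)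
    (hl1 : l ≤ 1) {ρ m : ℝ} (hρ : 0 < ρ) (hm : 0 < m) (hmh : m ≤ h ρ) (L : ℝ) :
    ∃ (Ω : Type) (_ : Fintype Ω) (_ : DecidableEq Ω) (e : ℝ) (p : Ω → EuclideanSpace ℝ (Fin d))
      (f : Ω → ℝ) (w S a X b : ℝ),
      IsRieszBlock s α D c₀ q e (fun R => Cc * (K + 2 ^ d) * h R) ρ m p f w S a X b ∧
      L ≤ S ∧ w ≤ K * (l * h e) ∧ (w * e ^ (-s)) ^ 2 ≤ (2 * K) ^ (2 * s) * S := by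
  have hs := hc.s_pos
  have hK := hc.one_le_K
  have hCc := hc.one_le_C
  have hds : 0 < (d : ℝ) - s := sub_pos.2 hc.s_lt
  have hinf' : ∀ r, 0 < r → ∀ L, ∃ δ, 0 < δ ∧ L ≤ ∫ t in δ..r, (h t / t ^ s) ^ 2 / t := by
    intro r hr L
    obtain ⟨δ, hδ, h1⟩ := hinf (L + ∫ t in r..1, (h t / t ^ s) ^ 2 / t)
    refine ⟨δ, hδ, ?_⟩
    rw [← intervalIntegral.integral_add_adjacent_intervals (hh.intervalIntegrable hδ hr)
      (hh.intervalIntegrable hr one_pos)] at h1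
    linarith
  obtain ⟨r, hr, hhr⟩ := hh.exists_eq (show 0 < m / l by positivity)
  rcases hh.exists_scale (K := K * (r / ρ) ^ d) hr with hsmall | ⟨M, r', hM, hr', hhr', hMr, -⟩
  · exfalso
    set Z := (2 * (K * (r / ρ) ^ d) * h r * r ^ (-s)) ^ 2 / (2 * (d - s)) with hZ
    have hZ0 : 0 ≤ Z := by positivity
    obtain ⟨δ, hδ, h1⟩ := hinf' r hr (Z + 1)
    rcases le_or_gt δ r with hδr | hδr
    · have h2 := hh.integral_le hs hc.s_lt hδ hδr (A := 2 * (K * (r / ρ) ^ d) * h r) (B := 0)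
        fun t ht htr => Or.inl (hsmall t (hδ.trans_le ht) htr)
      rw [zero_mul, zero_pow two_ne_zero, zero_div, add_zero] at h2
      linarith
    · rw [intervalIntegral.integral_symm] at h1
      have h2 : 0 ≤ ∫ t in r..δ, (h t / t ^ s) ^ 2 / t :=
        intervalIntegral.integral_nonneg hδr.le fun t ht => by
          have := hr.trans_le ht.1
          positivity
      linarith
  set B' := 2 * K ^ 2 / (d - s) + 2 / s with hB'
  have hB'0 : 0 < B' := by positivity
  obtain ⟨δ, hδ, hL⟩ := hinf' r' hr' (2 * B' * L / l ^ 2)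
  obtain ⟨Ω, i1, i2, e, p, f, w, S, a, X, b, hB, hw, hwe, hS, hint⟩ :=
    hc.exists_block (hh.const_mul hl0) hδ hr'
  have he := hB.e_pos
  have hM0 : (0 : ℝ) < M := Nat.cast_pos.2 hM
  have hlr' : l * h r' = m / (2 * M) := by
    rw [hhr', hhr]
    field_simp
  have hLS : L ≤ S := by
    rw [integral_const_mul_gauge] at hint
    rw [div_le_iff₀ (by positivity)] at hL
    have h2 : 2 * B' * L ≤ 2 * B' * S := by
      calc _ ≤ _ := hL
        _ = l ^ 2 * ∫ t in δ..r', (h t / t ^ s) ^ 2 / t := mul_comm _ _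
        _ ≤ B' * (2 * S) := by
            refine hint.trans ?_
            gcongr
            linarith [sq_nonneg (l * h r' * r' ^ (-s))]
        _ = _ := by ring
    exact le_of_mul_le_mul_left h2 (by positivity)
  have hB2 : IsRieszBlock s α D c₀ q e (fun R => Cc * (K + 2 ^ d) * h R) r' (m / (2 * M))
      p f w S a X b := by
    rw [← hlr']
    refine hB.mono_count fun R hR => ?_
    have h2 := hh.pos (he.trans_le hR)
    exact mul_le_mul_of_nonneg_left (mul_le_of_le_one_left h2.le hl1) (by positivity)
  have hcoef : 1 ≤ Cc * (K + 2 ^ d) := by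
    have : (0 : ℝ) < 2 ^ d := by positivity
    nlinarith
  obtain ⟨u, hu⟩ := hc.exists_extend hB2 hρ hm hM (by
    rw [div_pow] at hMr
    have h3 : 0 < r ^ d := by positivity
    have h4 : 2 * M * (K * (r ^ d / ρ ^ d)) * r' ^ d = 2 * M * K * r' ^ d * r ^ d / ρ ^ d := by
      ring
    rw [h4, div_le_iff₀ (by positivity), mul_comm (r ^ d)] at hMr
    exact le_of_mul_le_mul_right hMr h3) (by
    intro R hR hRρ
    have hR0 := hr'.trans_le hR
    have h2 := hh.pos hR0
    have h3 : m / (2 * M) ≤ h R := by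
      rw [← hlr']
      exact (mul_le_of_le_one_left (hh.pos hr').le hl1).trans (hh.le_of_le hr'.le hR)
    have h4 : m * (R / ρ) ^ d ≤ h R :=
      (mul_le_mul_of_nonneg_right hmh (by positivity)).trans (hh.mul_div_pow_le hR0 hRρ)
    calc Cc * (m / (2 * M) + 2 ^ d * m * (R / ρ) ^ d)
        = Cc * (m / (2 * M) + 2 ^ d * (m * (R / ρ) ^ d)) := by ring
      _ ≤ Cc * (1 * h R + 2 ^ d * h R) := by rw [one_mul]; gcongr
      _ ≤ Cc * (K * h R + 2 ^ d * h R) := by gcongr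
      _ = _ := by ring) (by
    intro R hR
    have h2 := hh.pos (hρ.trans_le hR)
    calc m ≤ h R := hmh.trans (hh.le_of_le hρ.le hR)
      _ = 1 * h R := (one_mul _).symm
      _ ≤ _ := by gcongr)
  have hge : S ≤ (m * ρ ^ (-s)) ^ 2 + S := by linarith [sq_nonneg (m * ρ ^ (-s))]
  exact ⟨_, _, _, e, _, _, w, _, _, _, _, hu, hLS.trans hge, hw, hwe.trans (by gcongr)⟩

/-- The extremal set for a gauge with a divergent square function. -/
lemma exists_compact_of_divergent {h : ℝ → ℝ} (hh : IsMeasureFunction d h)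
    (hinf : ∀ L, ∃ δ, 0 < δ ∧ L ≤ ∫ t in δ..1, (h t / t ^ s) ^ 2 / t) :
    ∃ E : Set (EuclideanSpace ℝ (Fin d)), IsCompact E ∧ hContent d h E ≠ 0 ∧
      gammaPlus d s E ≤ 0 := by
  obtain ⟨l, A, hl0, hl1, hA, hnext⟩ := hc.exists_next
  have hc₀ := hc.c₀_pos
  have h1 := hh.pos one_pos
  have step : ∀ (C : Finset (EuclideanSpace ℝ (Fin d))) (ρ : ℝ), IsStage h (h 1) A C ρ →
      ∀ η : ℝ, 0 < η → ∃ (C' : Finset (EuclideanSpace ℝ (Fin d))) (ρ' : ℝ),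
        IsStage h (h 1) A C' ρ' ∧ stageSet C' ρ' ⊆ stageSet C ρ ∧
        ∀ F ⊆ stageSet C' ρ', gammaPlus d s F ≤ η := by
    intro C ρ hst η hη
    have hn := hst.card_pos
    have hρ := hst.ρ_pos
    have hn1 : (1 : ℝ) ≤ C.card := by exact_mod_cast hst.nonempty.card_pos
    have hCk := (hc.kernel 1 one_pos).C_pos
    set m := h 1 / C.card with hm
    set Y₁ := 16 * ((C.card - 1) * (Ck * (4 * ρ) ^ (-s) * m)) / c₀ with hY₁
    set Y₂ := 16 * h 1 / (c₀ * η) with hY₂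
    have hm0 : 0 < m := by positivity
    have hY₁0 : 0 ≤ Y₁ := by
      have : 0 ≤ (C.card : ℝ) - 1 := by linarith
      positivity
    have hY₂0 : 0 < Y₂ := by positivity
    obtain ⟨Ω, i1, i2, e, p, f, w, S, a, X, b, hB, hLS, hw, hwe⟩ :=
      hc.exists_large_block hh hinf hl0 hl1 hρ hm0 (by
        rw [hm, div_le_iff₀ hn]
        linarith [hst.mass]) ((Y₁ + Y₂) ^ 2)
    have hS0 : 0 < S := lt_of_lt_of_le (by positivity) hLS
    have hY : Y₁ + Y₂ ≤ √S := Real.le_sqrt_of_sq_le hLS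
    have hSs : 0 < √S := Real.sqrt_pos.2 hS0
    obtain ⟨C', ρ', hst', hsub, hγ⟩ := hnext h hh _ _ _ hst Ω i1 i2 e p f w S a X b hB hS0 hw hwe
    refine ⟨C', ρ', hst', hsub, fun F hF => (hγ ?_ F hF).trans ?_⟩
    · calc (C.card - 1) * (Ck * (4 * ρ) ^ (-s) * (m * √S)) = c₀ / 16 * (Y₁ * √S) := by
            rw [hY₁]
            field_simp
        _ ≤ c₀ / 16 * (√S * √S) := by
            gcongr
            linarith
        _ = _ := by rw [Real.mul_self_sqrt hS0.le]
    · rw [div_le_iff₀ (by positivity)]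
      calc 16 * h 1 = c₀ * η * Y₂ := by rw [hY₂]; field_simp
        _ ≤ c₀ * η * √S := by
            gcongr
            linarith
        _ = _ := by ring
  let Stage := {z : Finset (EuclideanSpace ℝ (Fin d)) × ℝ // IsStage h (h 1) A z.1 z.2}
  have step' : ∀ (i : ℕ) (z : Stage), ∃ z' : Stage, stageSet z'.1.1 z'.1.2 ⊆ stageSet z.1.1 z.1.2 ∧
      ∀ F ⊆ stageSet z'.1.1 z'.1.2, gammaPlus d s F ≤ 1 / (i + 1) := by
    intro i z
    obtain ⟨C', ρ', hst', hsub, hγ⟩ := step z.1.1 z.1.2 z.2 (1 / (i + 1)) (by positivity)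
    exact ⟨⟨(C', ρ'), hst'⟩, hsub, hγ⟩
  choose g hg1 hg2 using step'
  let z₀ : Stage := ⟨({0}, 1), isStage_singleton hh h1 le_rfl hA⟩
  let z : ℕ → Stage := fun i => Nat.rec z₀ g i
  set E : ℕ → Set (EuclideanSpace ℝ (Fin d)) := fun i => stageSet (z i).1.1 (z i).1.2 with hE
  have hEc : ∀ i, IsCompact (E i) := fun i => isCompact_stageSet _ _
  refine ⟨⋂ i, E i, (hEc 0).of_isClosed_subset (isClosed_iInter fun i => (hEc i).isClosed)
    (iInter_subset E 0), ?_, ?_⟩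
  · have hpos : (0 : ℝ≥0∞) < ENNReal.ofReal (h 1 / A) := ENNReal.ofReal_pos.2 (by positivity)
    exact (hpos.trans_le (le_hContent_iInter hh hEc (fun i => hg1 i (z i))
      fun i x r hr hcov => (z i).2.le_tsum hh hr hcov)).ne'
  · refine ge_of_tendsto' tendsto_one_div_add_atTop_nhds_zero_nat fun i => ?_
    exact hg2 i (z i) _ (iInter_subset E (i + 1))

end IsBlockConst

end Construction

namespace IsMeasureFunction

variable {d : ℕ} {h : ℝ → ℝ} {s : ℝ}

/-- The square function of a gauge is positive on any interval where it is integrable. -/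
lemma integral_pos (hh : IsMeasureFunction d h) {r : ℝ} (hr : 0 < r)
    (hf : IntervalIntegrable (fun t => (h t / t ^ s) ^ 2 / t) volume 0 r) :
    0 < ∫ t in (0 : ℝ)..r, (h t / t ^ s) ^ 2 / t := by
  refine intervalIntegral.intervalIntegral_pos_of_pos_on hf (fun t ht => ?_) hr
  have h1 := hh.pos ht.1
  have h2 := Real.rpow_pos_of_pos ht.1 s
  have h3 := ht.1
  positivity

/-- A truncation captures at least half of a convergent square function. -/
lemma exists_half_le_integral (hh : IsMeasureFunction d h)
    (hf : IntervalIntegrable (fun t => (h t / t ^ s) ^ 2 / t) volume 0 1) :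
    ∃ δ, 0 < δ ∧ (∫ t in (0 : ℝ)..1, (h t / t ^ s) ^ 2 / t) / 2 ≤
      ∫ t in δ..1, (h t / t ^ s) ^ 2 / t := by
  have hI := hh.integral_pos one_pos hf
  have hf' : IntegrableOn (fun t => (h t / t ^ s) ^ 2 / t) (uIcc 0 1) := by
    rw [uIcc_of_le zero_le_one]
    exact (intervalIntegrable_iff_integrableOn_Icc_of_le zero_le_one).1 hf
  have h0 := intervalIntegral.continuousOn_primitive_interval_left hf' 0 left_mem_uIcc
  rw [uIcc_of_le zero_le_one] at h0
  have h1 : ∀ᶠ δ in 𝓝[Ioc 0 1] (0 : ℝ), (∫ t in (0 : ℝ)..1, (h t / t ^ s) ^ 2 / t) / 2 <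
      ∫ t in δ..1, (h t / t ^ s) ^ 2 / t :=
    (h0.mono Ioc_subset_Icc_self).eventually (lt_mem_nhds (by linarith))
  have : (𝓝[Ioc 0 1] (0 : ℝ)).NeBot := by
    rw [nhdsWithin_Ioc_eq_nhdsGT one_pos]
    infer_instance
  obtain ⟨δ, hδ, hδm⟩ := (h1.and self_mem_nhdsWithin).exists
  exact ⟨δ, hδm.1, hδ.le⟩

/-- If the square function is not integrable, then its truncated integrals are unbounded. -/
lemma exists_le_integral_of_not_intervalIntegrable (hh : IsMeasureFunction d h)
    (hf : ¬ IntervalIntegrable (fun t => (h t / t ^ s) ^ 2 / t) volume 0 1) (L : ℝ) :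
    ∃ δ, 0 < δ ∧ L ≤ ∫ t in δ..1, (h t / t ^ s) ^ 2 / t := by
  by_contra! hL
  refine hf ((intervalIntegrable_iff_integrableOn_Ioc_of_le zero_le_one).2 ?_)
  have hpos : ∀ i : ℕ, (0 : ℝ) < 1 / (i + 1) := fun i => by positivity
  have hle : ∀ i : ℕ, (1 : ℝ) / (i + 1) ≤ 1 := fun i => by
    rw [div_le_one (by positivity)]
    linarith [(Nat.cast_nonneg i : (0 : ℝ) ≤ i)]
  refine integrableOn_Ioc_of_intervalIntegral_norm_bounded_left (I := L) (l := atTop)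
    (fun i => (hh.intervalIntegrable (s := s) (hpos i) one_pos).1)
    tendsto_one_div_add_atTop_nhds_zero_nat (Eventually.of_forall fun i => ?_)
  refine le_trans (le_of_eq ?_) (hL _ (hpos i)).le
  rw [intervalIntegral.integral_of_le (hle i)]
  refine setIntegral_congr_fun measurableSet_Ioc fun t ht => ?_
  have := (hpos i).trans ht.1
  exact Real.norm_of_nonneg (by positivity)

end IsMeasureFunction

/-- Proposition 7.3: for any gauge function `h` with `h(r)/r^d` nonincreasing there is a
constant `C = C(d,s)` and a compact set `E` with `M_h(E) > 0` and
`γ_{s,+}(E) ≤ C M_h(E) [∫_0^{t₂} (h(t)/t^s)² dt/t]^{-1/2}`, where `h(t₂) = M_h(E)`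
(if the integral diverges the right-hand side is `0`, so `γ_{s,+}(E) = 0`). -/
theorem statement17 (d : ℕ) (hd : 1 ≤ d) (s : ℝ) (hs : 0 < s) (hsd : s < d) :
    ∃ C : ℝ, 0 < C ∧
      ∀ h : ℝ → ℝ,
        ContinuousOn h (Ici 0) → StrictMonoOn h (Ici 0) → h 0 = 0 →
        Tendsto h atTop atTop →
        (∀ r₁ r₂ : ℝ, 0 < r₁ → r₁ ≤ r₂ → h r₂ / r₂ ^ d ≤ h r₁ / r₁ ^ d) →
      ∃ E : Set (EuclideanSpace ℝ (Fin d)), IsCompact E ∧ hContent d h E ≠ 0 ∧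
        ∀ t₂ : ℝ, 0 ≤ t₂ → h t₂ = (hContent d h E).toReal →
          gammaPlus d s E ≤ C * (hContent d h E).toReal *
            (∫ t in (0 : ℝ)..t₂, (h t / t ^ s) ^ 2 / t) ^ (-((1 : ℝ) / 2)) := by
  have : NeZero d := ⟨by omega⟩
  obtain ⟨α, Ck, ck, Cc, K, D, c₀, q, hc⟩ := exists_isBlockConst hs hsd
  obtain ⟨B, κ, hB, hκ, hmain⟩ := hc.exists_compact_of_integral_pos
  refine ⟨B * √2 / κ, by positivity, fun h h1 h2 h3 h4 h5 => ?_⟩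
  have hh : IsMeasureFunction d h := ⟨h1, h2, h3, h4, h5⟩
  have hh1 := hh.pos one_pos
  by_cases hf : IntervalIntegrable (fun t => (h t / t ^ s) ^ 2 / t) volume 0 1
  · have hI := hh.integral_pos one_pos hf
    obtain ⟨δ, hδ, hhalf⟩ := hh.exists_half_le_integral hf
    obtain ⟨E, hE, hE1, hκE, hγ⟩ := hmain h hh δ hδ (by linarith)
    have htop := hContent_le_of_subset hh hE1
    have hne : hContent d h E ≠ ⊤ := (htop.trans_lt ENNReal.ofReal_lt_top).ne
    have hlow : κ * h 1 ≤ (hContent d h E).toReal := (ENNReal.ofReal_le_iff_le_toReal hne).1 hκE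
    have hup : (hContent d h E).toReal ≤ h 1 := ENNReal.toReal_le_of_le_ofReal hh1.le htop
    refine ⟨E, hE, fun h0 => ?_, fun t₂ ht₂ heq => ?_⟩
    · rw [h0, ENNReal.toReal_zero] at hlow
      exact hlow.not_gt (by positivity)
    have ht₂1 : t₂ ≤ 1 := le_of_not_gt fun hlt =>
      ((h2 (mem_Ici.2 zero_le_one) ht₂ hlt).trans_le (heq.trans_le hup)).false
    have ht₂0 : 0 < t₂ := hh.lt_of_lt ht₂ (by
      rw [h3, heq]
      exact lt_of_lt_of_le (by positivity) hlow)
    have hf₂ : IntervalIntegrable (fun t => (h t / t ^ s) ^ 2 / t) volume 0 t₂ :=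
      hf.mono_set (by rw [uIcc_of_le ht₂, uIcc_of_le zero_le_one]; exact Icc_subset_Icc_right ht₂1)
    have hI₂ := hh.integral_pos ht₂0 hf₂
    have hII : ∫ t in (0 : ℝ)..t₂, (h t / t ^ s) ^ 2 / t ≤
        ∫ t in (0 : ℝ)..1, (h t / t ^ s) ^ 2 / t := by
      refine intervalIntegral.integral_mono_interval le_rfl ht₂ ht₂1 ?_ hf
      filter_upwards [ae_restrict_mem measurableSet_Ioc] with t ht
      have := ht.1
      simp only [Pi.zero_apply]
      positivity
    set I := ∫ t in (0 : ℝ)..t₂, (h t / t ^ s) ^ 2 / t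
    rw [Real.rpow_neg hI₂.le, ← Real.sqrt_eq_rpow]
    have hsq : √I / √2 ≤ √(∫ t in δ..1, (h t / t ^ s) ^ 2 / t) := by
      rw [← Real.sqrt_div hI₂.le]
      exact Real.sqrt_le_sqrt (by linarith)
    have hs0 : 0 < √I := Real.sqrt_pos.2 hI₂
    calc gammaPlus d s E ≤ B * h 1 / √(∫ t in δ..1, (h t / t ^ s) ^ 2 / t) := hγ
      _ ≤ B * h 1 / (√I / √2) := by gcongr
      _ = B * √2 / κ * (κ * h 1) * (√I)⁻¹ := by field_simp
      _ ≤ _ := by gcongr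
  · obtain ⟨E, hE, h0, hγ⟩ := hc.exists_compact_of_divergent hh
      (hh.exists_le_integral_of_not_intervalIntegrable hf)
    refine ⟨E, hE, h0, fun t₂ ht₂ _ => ?_⟩
    have hz : ∫ t in (0 : ℝ)..t₂, (h t / t ^ s) ^ 2 / t = 0 := by
      rcases ht₂.eq_or_lt with rfl | ht₂
      · exact intervalIntegral.integral_same
      · exact intervalIntegral.integral_undef fun hf₂ =>
          hf (hf₂.trans (hh.intervalIntegrable ht₂ one_pos))
    rwa [hz, Real.zero_rpow (by norm_num), mul_zero]
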